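/- Fix n ≥ 1, 1 ≤ k ≤ n, and a subset I ⊆ {1,…,n−1} with |I| = k−1, and let R_{n,I} ⊆ Q[x_1,…,x_n] be the Q-span of the polynomials F_{w,I} over all w ∈ S_n with Dsl(w) ⊆ I. Then: (i) R_{n,I} is an S_n-subrepresentation and equals the direct sum, over partitions λ ⊢ n and standard Young tableaux S of shape λ with Dsi^c(S) ⊆ I, of the spaces V^S_{h^S_I}; (ii) R_{n,I} is isomorphic, as a representation of S_n, to the permutation representation Q[OP_{n,I}]; (iii) the sum of the spaces R_{n,I} over all subsets I ⊆ {1,…,n−1} of size k−1 is a direct sum, and this direct sum lifts the quotient R_{n,k} into Q[x_1,…,x_n]. -/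

import Mathlib

open MvPolynomial

noncomputable section

namespace HigherSpecht

open scoped Classical

/-- A tableau: a filling of the plane (row, column), `0`-indexed, with `0` outside the diagram. -/
abbrev Tab := ℕ × ℕ → ℕ

/-- A permutation of `ℕ` represents an element of `Sₙ` (acting on `{1, …, n}`)
when it fixes `0` and everything above `n`. -/
def SuppIn (n : ℕ) (w : Equiv.Perm ℕ) : Prop := ∀ i, i = 0 ∨ n < i → w i = i

/-- Descending locations of a permutation (one-line notation `w 1, …, w n`). -/
def DslSet (n : ℕ) (w : Equiv.Perm ℕ) : Finset ℕ :=
  (Finset.Ioo 0 n).filter fun i => w (i + 1) < w i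

/-- Ascending locations of a permutation. -/
def AslSet (n : ℕ) (w : Equiv.Perm ℕ) : Finset ℕ :=
  (Finset.Ioo 0 n).filter fun i => w i < w (i + 1)

/-- The row in which the entry `i` shows up in a tableau. -/
def rowIdx (T : Tab) (i : ℕ) : ℕ := sInf {r | ∃ c, T (r, c) = i}

/-- The column in which the entry `i` shows up in a tableau. -/
def colIdx (T : Tab) (i : ℕ) : ℕ := sInf {c | T (rowIdx T i, c) = i}

/-- The box containing the entry `i`. -/
def posOf (T : Tab) (i : ℕ) : ℕ × ℕ := (rowIdx T i, colIdx T i)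

/-- Descending indices of a (standard) tableau: `i` with the row of `i+1` strictly below
the row of `i`. -/
def DsiSet (n : ℕ) (T : Tab) : Finset ℕ :=
  (Finset.Ioo 0 n).filter fun i => rowIdx T i < rowIdx T (i + 1)

/-- `Dsi^c`, the complemented descent set `{n - i | i ∈ Dsi}`. -/
def Dsic (n : ℕ) (T : Tab) : Finset ℕ := (DsiSet n T).image fun i => n - i

/-- The entry of `ct_J(S)` at a box `c`: the number of elements of `J` smaller than the
entry of `S` at `c`. -/
def ctEntry (T : Tab) (J : Finset ℕ) (c : ℕ × ℕ) : ℕ := (J.filter fun j => j < T c).card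

/-- The cocharge tableau `ct(S)` of a standard tableau. -/
def ctTab (n : ℕ) (T : Tab) : Tab := fun c => ctEntry T (DsiSet n T) c

/-- The (total) cocharge `cc(S)`: the sum of the entries of `ct(S)`. -/
def ccStat (n : ℕ) (T : Tab) : ℕ :=
  ∑ i ∈ Finset.Icc 1 n, ctEntry T (DsiSet n T) (posOf T i)

/-- `T` is a bijective filling of the given set of cells by `1, …, n` (`n` the number of
cells), with `0` outside. -/
def IsFillingF (cells : Finset (ℕ × ℕ)) (T : Tab) : Prop :=
  (∀ c, c ∉ cells → T c = 0) ∧ Set.BijOn T ↑cells (Set.Icc 1 cells.card)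

/-- A bijective filling of a Young diagram. -/
def IsFilling (μ : YoungDiagram) (T : Tab) : Prop := IsFillingF μ.cells T

/-- A standard Young tableau of shape `μ`: entries strictly increase along rows and columns. -/
def IsStandard (μ : YoungDiagram) (T : Tab) : Prop :=
  IsFilling μ T ∧ ∀ c₁ ∈ μ.cells, ∀ c₂ ∈ μ.cells,
    c₁ ≠ c₂ → c₁.1 ≤ c₂.1 → c₁.2 ≤ c₂.2 → T c₁ < T c₂

/-! ### Robinson–Schensted -/

/-- Row insertion: insert `x` into a row, returning the new row and the bumped entry. -/
def rowInsert : ℕ → List ℕ → List ℕ × Option ℕ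
  | x, [] => ([x], none)
  | x, y :: ys =>
    if x < y then (x :: ys, some y)
    else
      let p := rowInsert x ys
      (y :: p.1, p.2)

/-- Insertion of an entry into a tableau, given as a list of rows. -/
def tabInsert : List (List ℕ) → ℕ → List (List ℕ)
  | [], x => [[x]]
  | r :: rs, x =>
    match rowInsert x r with
    | (r', none) => r' :: rs
    | (r', some y) => r' :: tabInsert rs y

/-- One-line notation of `w ∈ Sₙ`. -/
def oneLine (n : ℕ) (w : Equiv.Perm ℕ) : List ℕ := (List.range n).map fun i => w (i + 1)

/-- The insertion tableau of the first `m` letters of `w`, as a list of rows. -/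
def PtabListPart (n : ℕ) (w : Equiv.Perm ℕ) (m : ℕ) : List (List ℕ) :=
  ((oneLine n w).take m).foldl tabInsert []

/-- Entry of a list-of-rows tableau at a (0-indexed) cell. -/
def listEntry (t : List (List ℕ)) (c : ℕ × ℕ) : ℕ := (t.getD c.1 []).getD c.2 0

/-- The Robinson–Schensted insertion tableau `P(w)`. -/
def Ptab (n : ℕ) (w : Equiv.Perm ℕ) : Tab := fun c => listEntry (PtabListPart n w n) c

/-- The Robinson–Schensted recording tableau `Q(w)`: the entry of a cell is the step at
which the cell is added to the shape. -/
def Qtab (n : ℕ) (w : Equiv.Perm ℕ) : Tab := fun c =>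
  sInf {m | listEntry (PtabListPart n w m) c ≠ 0}

/-! ### Schützenberger evacuation -/

/-- One step of a jeu de taquin slide into the hole at `c`. -/
def slideOnce (T : Tab) (c : ℕ × ℕ) : Tab × (ℕ × ℕ) :=
  let rc : ℕ × ℕ := (c.1, c.2 + 1)
  let dc : ℕ × ℕ := (c.1 + 1, c.2)
  if T rc = 0 ∧ T dc = 0 then (T, c)
  else if T dc = 0 ∨ (T rc ≠ 0 ∧ T rc < T dc) then
    (Function.update (Function.update T c (T rc)) rc 0, rc)
  else
    (Function.update (Function.update T c (T dc)) dc 0, dc)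

/-- Jeu de taquin slide (with fuel). -/
def slide : ℕ → Tab → ℕ × ℕ → Tab × (ℕ × ℕ)
  | 0, T, c => (T, c)
  | k + 1, T, c =>
    let p := slideOnce T c
    if p.2 = c then (T, c) else slide k p.1 p.2

/-- The Schützenberger evacuation: repeatedly delete the minimal entry, slide into the hole,
decrement the remaining entries, and record the vacated cell. -/
def evacAux : ℕ → Tab → Tab
  | 0, _ => fun _ => 0
  | m + 1, T =>
    let c0 := posOf T 1
    let p := slide (m + 1) (Function.update T c0 0) c0
    Function.update (evacAux m fun c => p.1 c - 1) p.2 (m + 1)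

/-- The evacuation tableau `ev S` of a standard tableau with `n` boxes. -/
def evac (n : ℕ) (T : Tab) : Tab := evacAux n T

/-- `Q̃(w) := ev (Q w)`. -/
def Qt (n : ℕ) (w : Equiv.Perm ℕ) : Tab := evac n (Qtab n w)

/-! ### Row and column groups, higher Specht polynomials -/

/-- The identification of `Fin n` with `{1, …, n} ⊆ ℕ`. -/
def finShift (n : ℕ) : Fin n ≃ {i : ℕ // 1 ≤ i ∧ i ≤ n} where
  toFun j := ⟨(j : ℕ) + 1, by have := j.isLt; omega⟩
  invFun i := ⟨(i : ℕ) - 1, by have := i.2; omega⟩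
  left_inv j := by apply Fin.ext; simp
  right_inv i := by apply Subtype.ext; have := i.2; simp; omega

/-- Embedding of the permutations of `Fin n` into permutations of `ℕ` (acting on `{1, …, n}`). -/
def embedPerm (n : ℕ) (σ : Equiv.Perm (Fin n)) : Equiv.Perm ℕ :=
  σ.extendDomain (finShift n)

/-- The row group `R(T)` of a filling, as a finset of permutations of `Fin n`. -/
def rowFinset (n : ℕ) (T : Tab) : Finset (Equiv.Perm (Fin n)) :=
  Finset.univ.filter fun τ => ∀ i ∈ Finset.Icc 1 n, rowIdx T (embedPerm n τ i) = rowIdx T i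

/-- The column group `C(T)` of a filling, as a finset of permutations of `Fin n`. -/
def colFinset (n : ℕ) (T : Tab) : Finset (Equiv.Perm (Fin n)) :=
  Finset.univ.filter fun σ => ∀ i ∈ Finset.Icc 1 n, colIdx T (embedPerm n σ i) = colIdx T i

/-- The row group `R(T)` as a set of permutations of `ℕ`. -/
def rowGroupSet (n : ℕ) (T : Tab) : Set (Equiv.Perm ℕ) :=
  {w | SuppIn n w ∧ ∀ i ∈ Finset.Icc 1 n, rowIdx T (w i) = rowIdx T i}

/-- The column group `C(T)` as a set of permutations of `ℕ`. -/
def colGroupSet (n : ℕ) (T : Tab) : Set (Equiv.Perm ℕ) :=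
  {w | SuppIn n w ∧ ∀ i ∈ Finset.Icc 1 n, colIdx T (w i) = colIdx T i}

/-- The Young symmetrizer `ε_T = Σ_{σ ∈ C(T)} Σ_{τ ∈ R(T)} sgn(σ) σ τ` acting on polynomials
(permutations acting by permuting the variables). -/
def epsAct (n : ℕ) (T : Tab) (p : MvPolynomial ℕ ℚ) : MvPolynomial ℕ ℚ :=
  ∑ σ ∈ colFinset n T, ∑ τ ∈ rowFinset n T,
    (Equiv.Perm.sign σ : ℤ) • rename (⇑(embedPerm n σ * embedPerm n τ)) p

/-- The monomial `p_T^S = Π_i x_i^{h_i}`, where `h_i` is the entry of `ct S` in the box of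
`T` containing `i`. -/
def pTS (n : ℕ) (T S : Tab) : MvPolynomial ℕ ℚ :=
  ∏ i ∈ Finset.Icc 1 n, X i ^ ctEntry S (DsiSet n S) (posOf T i)

/-- `s_T^S`: the order of the stabilizer of `p_T^S` in `R(T)`. -/
def sTS (n : ℕ) (T S : Tab) : ℕ :=
  ((rowFinset n T).filter fun τ =>
    rename (⇑(embedPerm n τ)) (pTS n T S) = pTS n T S).card

/-- The higher Specht polynomial `F_T^S := ε_T p_T^S / s_T^S`. -/
def FTS (n : ℕ) (T S : Tab) : MvPolynomial ℕ ℚ :=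
  ((sTS n T S : ℚ)⁻¹) • epsAct n T (pTS n T S)

/-- The higher Specht polynomial `F_w := F_{P(w)}^{Q̃(w)}` of a permutation. -/
def Fw (n : ℕ) (w : Equiv.Perm ℕ) : MvPolynomial ℕ ℚ := FTS n (Ptab n w) (Qt n w)

/-- The elementary symmetric polynomial `e_r` in the variables `x_1, …, x_n`. -/
def esym (n r : ℕ) : MvPolynomial ℕ ℚ :=
  ∑ s ∈ (Finset.Icc 1 n).powersetCard r, ∏ i ∈ s, X i

/-- The representation `V^S`: the span of the higher Specht polynomials `F_T^S` over all
bijective fillings `T` of the given cells. -/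
def VS (n : ℕ) (cells : Finset (ℕ × ℕ)) (S : Tab) : Submodule ℚ (MvPolynomial ℕ ℚ) :=
  Submodule.span ℚ {p | ∃ T : Tab, IsFillingF cells T ∧ p = FTS n T S}

/-- Multiplication of a subspace of polynomials by a fixed polynomial. -/
def polyMul (q : MvPolynomial ℕ ℚ) (V : Submodule ℚ (MvPolynomial ℕ ℚ)) :
    Submodule ℚ (MvPolynomial ℕ ℚ) :=
  Submodule.map (LinearMap.mulLeft ℚ q) V

/-- The symmetric multiplier `Π_r e_r^{h_r}`. -/
def eProd (n : ℕ) (h : ℕ → ℕ) : MvPolynomial ℕ ℚ := ∏ r ∈ Finset.Icc 1 n, esym n r ^ h r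

/-- `V^S_h := (Π_r e_r^{h_r}) V^S`. -/
def VSh (n : ℕ) (cells : Finset (ℕ × ℕ)) (S : Tab) (h : ℕ → ℕ) :
    Submodule ℚ (MvPolynomial ℕ ℚ) :=
  polyMul (eProd n h) (VS n cells S)

/-! ### The representations `R_{n,I}` -/

/-- For `i ∈ I`, `r_i := #{j ∈ {1,…,n-1} \ I : j < i}`. -/
def rIdxI (n : ℕ) (I : Finset ℕ) (i : ℕ) : ℕ :=
  ((Finset.Ioo 0 n \ I).filter fun j => j < i).card

/-- The vector `h^S_I`, whose `r`-th entry (for `r ≥ 1`) is `#{i ∈ I \ Dsi^c(S) : r_i = r}`. -/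
def hSI (n : ℕ) (I : Finset ℕ) (S : Tab) : ℕ → ℕ := fun r =>
  if 1 ≤ r then ((I \ Dsic n S).filter fun i => rIdxI n I i = r).card else 0

/-- The indicator vector `h(I,S)` of the set `I \ Dsi^c(S)`. -/
def hInd (n : ℕ) (I : Finset ℕ) (S : Tab) : ℕ → ℕ := fun r =>
  if r ∈ I \ Dsic n S then 1 else 0

/-- `F_{w,I} := F_w · Π_{i ∈ I \ Dsl(w)} e_{r_i}`. -/
def FwI (n : ℕ) (I : Finset ℕ) (w : Equiv.Perm ℕ) : MvPolynomial ℕ ℚ :=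
  Fw n w * ∏ i ∈ I \ DslSet n w, esym n (rIdxI n I i)

/-- The homogeneous version `F^hom_{w,I} := F_w · Π_{i ∈ I \ Dsl(w)} e_i`. -/
def FwIhom (n : ℕ) (I : Finset ℕ) (w : Equiv.Perm ℕ) : MvPolynomial ℕ ℚ :=
  Fw n w * ∏ i ∈ I \ DslSet n w, esym n i

/-- The representation `R_{n,I}`: span of the `F_{w,I}` over `w` with `Dsl(w) ⊆ I`. -/
def RnI (n : ℕ) (I : Finset ℕ) : Submodule ℚ (MvPolynomial ℕ ℚ) :=
  Submodule.span ℚ {p | ∃ w : Equiv.Perm ℕ, SuppIn n w ∧ DslSet n w ⊆ I ∧ p = FwI n I w}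

/-- The homogeneous representation `R^hom_{n,I}`. -/
def RnIhom (n : ℕ) (I : Finset ℕ) : Submodule ℚ (MvPolynomial ℕ ℚ) :=
  Submodule.span ℚ {p | ∃ w : Equiv.Perm ℕ, SuppIn n w ∧ DslSet n w ⊆ I ∧ p = FwIhom n I w}

/-- The index type for the decomposition of `R_{n,I}`: pairs of a partition `λ ⊢ n` and a
standard Young tableau `S` of shape `λ` with `Dsi^c(S) ⊆ I`. -/
def SIdx (n : ℕ) (I : Finset ℕ) : Type :=
  {q : YoungDiagram × Tab // q.1.cells.card = n ∧ IsStandard q.1 q.2 ∧ Dsic n q.2 ⊆ I}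

/-! ### Ordered set partitions -/

/-- The cumulative values `j_h` attached to a subset `I ⊆ {1,…,n-1}` (`j_0 = 0`,
`j_h` the `h`-th smallest element, `j_{|I|+1} = n`). -/
def jval (n : ℕ) (I : Finset ℕ) (h : ℕ) : ℕ :=
  if h = 0 then 0 else if h ≤ I.card then (I.sort (· ≤ ·)).getD (h - 1) 0 else n

/-- The composition `comp_n I`, as a function of the index `0 ≤ h ≤ |I|`. -/
def compFun (n : ℕ) (I : Finset ℕ) (h : ℕ) : ℕ := jval n I (h + 1) - jval n I h

/-- The set `OP_{n,I}` of ordered set partitions of `{1,…,n}` into `|I| + 1` blocks whose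
sizes are given by `comp_n I` (blocks indexed by `ℕ`, empty from index `|I| + 1` on). -/
def OPset (n : ℕ) (I : Finset ℕ) : Set (ℕ → Finset ℕ) :=
  {B | (∀ h, I.card + 1 ≤ h → B h = ∅) ∧
       (∀ h₁ h₂, h₁ ≠ h₂ → Disjoint (B h₁) (B h₂)) ∧
       (∀ h ≤ I.card, (B h).card = compFun n I h) ∧
       Finset.Icc 1 n = (Finset.range (I.card + 1)).biUnion B}

/-- The natural action of a permutation on an ordered set partition. -/
def permOP (w : Equiv.Perm ℕ) (B : ℕ → Finset ℕ) : ℕ → Finset ℕ := fun h => (B h).image w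

/-! ### The quotient `R_{n,k}` -/

/-- Elementary symmetric polynomials in `Fin n` variables. -/
def esymFin (n r : ℕ) : MvPolynomial (Fin n) ℚ :=
  ∑ s ∈ (Finset.univ : Finset (Fin n)).powersetCard r, ∏ i ∈ s, X i

/-- The ideal defining `R_{n,k}`: generated by `x_i^k` and `e_r`, `n-k+1 ≤ r ≤ n`. -/
def Jnk (n k : ℕ) : Ideal (MvPolynomial (Fin n) ℚ) :=
  Ideal.span ((Set.range fun i : Fin n => (X i : MvPolynomial (Fin n) ℚ) ^ k) ∪
    {p | ∃ r, n - k + 1 ≤ r ∧ r ≤ n ∧ p = esymFin n r})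

/-- The map sending `x_i` (for `1 ≤ i ≤ n`) to the corresponding variable of
`ℚ[x_1, …, x_n]`, and all other variables to `0`. -/
def toFin (n : ℕ) : MvPolynomial ℕ ℚ →ₐ[ℚ] MvPolynomial (Fin n) ℚ :=
  aeval fun i => if h : 1 ≤ i ∧ i ≤ n then X (⟨i - 1, by omega⟩ : Fin n) else 0

/-- The quotient projection onto `R_{n,k}`. -/
def projNK (n k : ℕ) : MvPolynomial ℕ ℚ →ₐ[ℚ] (MvPolynomial (Fin n) ℚ ⧸ Jnk n k) :=
  (Ideal.Quotient.mkₐ ℚ (Jnk n k)).comp (toFin n)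

/-! ### Corners, insertions and the induction/extension operators -/

/-- `v` is an external corner of `μ`. -/
def IsCorner (μ : YoungDiagram) (v : ℕ × ℕ) : Prop :=
  v ∉ μ.cells ∧ ∃ ν : YoungDiagram, ν.cells = insert v μ.cells

/-- `S +̃ v := ev (ev S + v)`, where `+ v` places the entry `n + 1` in the box `v`. -/
def Sadd (n : ℕ) (S : Tab) (v : ℕ × ℕ) : Tab :=
  evac (n + 1) (Function.update (evac n S) v (n + 1))

/-- `δ^{S,v}`: `0` if `v` lies strictly below the row of `n` in `ev S`, and `1` otherwise. -/
def deltaSV (n : ℕ) (S : Tab) (v : ℕ × ℕ) : ℕ :=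
  if rowIdx (evac n S) n < v.1 then 0 else 1

/-- `h + δ·1_t`: add `δ` to the coordinate `t` of `h` when `t ≥ 1`; do nothing for `t = 0`. -/
def addAt (h : ℕ → ℕ) (t δ : ℕ) : ℕ → ℕ := fun r =>
  if r = t ∧ 1 ≤ t then h r + δ else h r

/-- The induction operator on a single summand:
`Ind_t V^S_h := ⊕_{v ∈ EC(λ)} V^{S +̃ v}_{h + δ^{S,v}·1_t}`. -/
def IndVSh (t n : ℕ) (μ : YoungDiagram) (S : Tab) (h : ℕ → ℕ) :
    Submodule ℚ (MvPolynomial ℕ ℚ) :=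
  ⨆ v : ℕ × ℕ, ⨆ _ : IsCorner μ v,
    VSh (n + 1) (insert v μ.cells) (Sadd n S v) (addAt h t (deltaSV n S v))

/-- The extension operator on a single summand:
`Ext V^S_h := ⊕_{v ∈ EC(λ), δ^{S,v} = 1} V^{S +̃ v}_h`. -/
def ExtVSh (n : ℕ) (μ : YoungDiagram) (S : Tab) (h : ℕ → ℕ) :
    Submodule ℚ (MvPolynomial ℕ ℚ) :=
  ⨆ v : ℕ × ℕ, ⨆ _ : IsCorner μ v ∧ deltaSV n S v = 1,
    VSh (n + 1) (insert v μ.cells) (Sadd n S v) h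

/-- `Ind_t R_{n,I}`, applied summand-by-summand to the decomposition of `R_{n,I}`. -/
def IndR (t n : ℕ) (I : Finset ℕ) : Submodule ℚ (MvPolynomial ℕ ℚ) :=
  ⨆ q : SIdx n I, IndVSh t n q.1.1 q.1.2 (hSI n I q.1.2)

/-- `Ext R_{n,I}`, applied summand-by-summand. -/
def ExtR (n : ℕ) (I : Finset ℕ) : Submodule ℚ (MvPolynomial ℕ ℚ) :=
  ⨆ q : SIdx n I, ExtVSh n q.1.1 q.1.2 (hSI n I q.1.2)

/-- `Ind_t R^hom_{n,I}`, applied summand-by-summand. -/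
def IndRhom (t n : ℕ) (I : Finset ℕ) : Submodule ℚ (MvPolynomial ℕ ℚ) :=
  ⨆ q : SIdx n I, IndVSh t n q.1.1 q.1.2 (hInd n I q.1.2)

/-- `Ext R^hom_{n,I}`, applied summand-by-summand. -/
def ExtRhom (n : ℕ) (I : Finset ℕ) : Submodule ℚ (MvPolynomial ℕ ℚ) :=
  ⨆ q : SIdx n I, ExtVSh n q.1.1 q.1.2 (hInd n I q.1.2)

/-- The lift `R̃_{n,k} = ⊕_{|I| = k-1} R_{n,I}` of the quotient `R_{n,k}`. -/
def Rtil (n k : ℕ) : Submodule ℚ (MvPolynomial ℕ ℚ) :=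
  ⨆ I : Finset ℕ, ⨆ _ : I ⊆ Finset.Ioo 0 n ∧ I.card + 1 = k, RnI n I

/-! ### The extended column group -/

/-- The length of column `c` of a tableau. -/
def colLenT (n : ℕ) (T : Tab) (c : ℕ) : ℕ :=
  ((Finset.range (n + 1)).filter fun r => T (r, c) ≠ 0).card

/-- `q_a`: the number of columns of length `> a` (columns of length `a` occupy the
`0`-indexed columns `q_a, …, q_a + t_a - 1`). -/
def qaT (n : ℕ) (T : Tab) (a : ℕ) : ℕ :=
  ((Finset.range (n + 1)).filter fun c => a < colLenT n T c).card

/-- `t_a`: the number of columns of length `a`. -/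
def taT (n : ℕ) (T : Tab) (a : ℕ) : ℕ :=
  ((Finset.range (n + 1)).filter fun c => colLenT n T c = a).card

/-- The function underlying the permutation `η_T`: the entry in row `j` of column `q_a + i`
is sent to the entry in row `j` of column `q_a + η(i)`; everything else is fixed. -/
def etaFun (n : ℕ) (T : Tab) (a : ℕ) (η : Equiv.Perm ℕ) : ℕ → ℕ := fun m =>
  let c := colIdx T m
  if 1 ≤ m ∧ m ≤ n ∧ qaT n T a ≤ c ∧ c < qaT n T a + taT n T a then
    T (rowIdx T m, qaT n T a + η (c - qaT n T a))
  else m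

/-- The set of the permutations `η_T` (over all `a ≥ 1` and all `η ∈ S_{t_a}`). -/
def etaSet (n : ℕ) (T : Tab) : Set (Equiv.Perm ℕ) :=
  {w | ∃ a, 1 ≤ a ∧ ∃ η : Equiv.Perm ℕ, (∀ i, taT n T a ≤ i → η i = i) ∧
    ⇑w = etaFun n T a η}

/-- The subgroup generated by the permutations `η_T` (a copy of `Π_a S_{t_a}`). -/
def etaSubgroup (n : ℕ) (T : Tab) : Subgroup (Equiv.Perm ℕ) :=
  Subgroup.closure (etaSet n T)

/-- The column group `C(T)` as a subgroup. -/
def colSubgroup (n : ℕ) (T : Tab) : Subgroup (Equiv.Perm ℕ) :=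
  Subgroup.closure (colGroupSet n T)

/-- The extended column group `C̃(T)`, generated by `C(T)` and the `η_T`. -/
def extColSubgroup (n : ℕ) (T : Tab) : Subgroup (Equiv.Perm ℕ) :=
  Subgroup.closure (colGroupSet n T ∪ etaSet n T)

/-- The sign of a permutation of `ℕ` supported on `{1, …, n}`. -/
def signOn (n : ℕ) (σ : Equiv.Perm ℕ) : ℤ :=
  if h : ∃ τ : Equiv.Perm (Fin n), embedPerm n τ = σ then
    (Equiv.Perm.sign h.choose : ℤ) else 0

/-! ### Semistandard tableaux, (generalized) cocharge tableaux -/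

/-- A semistandard filling of the given cells: rows weakly increase, columns strictly
increase (entries outside the cells are normalized to `0`). -/
def IsSSYTOn (cells : Finset (ℕ × ℕ)) (C : Tab) : Prop :=
  (∀ c ∉ cells, C c = 0) ∧
  (∀ c₁ ∈ cells, ∀ c₂ ∈ cells, c₁.1 = c₂.1 → c₁.2 ≤ c₂.2 → C c₁ ≤ C c₂) ∧
  (∀ c₁ ∈ cells, ∀ c₂ ∈ cells, c₁.2 = c₂.2 → c₁.1 < c₂.1 → C c₁ < C c₂)

/-- A generalized cocharge tableau with entries exactly `{0, …, k-1}`. -/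
def IsGCT (cells : Finset (ℕ × ℕ)) (C : Tab) (k : ℕ) : Prop :=
  IsSSYTOn cells C ∧ (∀ c ∈ cells, C c < k) ∧ ∀ h < k, ∃ c ∈ cells, C c = h

/-- The type of a generalized cocharge tableau: the set of cumulative multiplicities
`#{c : C c < h}` for `1 ≤ h ≤ k - 1`. -/
def gctType (cells : Finset (ℕ × ℕ)) (C : Tab) (k : ℕ) : Finset ℕ :=
  (Finset.Ico 1 k).image fun h => (cells.filter fun c => C c < h).card

/-- The standardization of a semistandard tableau: entries are replaced by `1, …, n`,
processing the values in increasing order and, for equal values, from left to right. -/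
def stdz (cells : Finset (ℕ × ℕ)) (C : Tab) : Tab := fun c =>
  if c ∈ cells then
    (cells.filter fun c' => C c' < C c ∨
      (C c' = C c ∧ (c'.2 < c.2 ∨ (c'.2 = c.2 ∧ c'.1 ≤ c.1)))).card
  else 0

/-- A cocharge tableau of shape `μ`: one of the form `ct S` for a standard `S`. -/
def IsCCT (μ : YoungDiagram) (C : Tab) : Prop :=
  ∃ S : Tab, IsStandard μ S ∧ ctTab μ.cells.card S = C

/-- `k` for a tableau: one more than the maximal entry. -/
def kOf (cells : Finset (ℕ × ℕ)) (C : Tab) : ℕ := cells.sup C + 1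

/-- `Dsp^c(C) := {n - i : i ∈ J}`, `J` the type of the cocharge tableau `C`. -/
def Dspc (n : ℕ) (cells : Finset (ℕ × ℕ)) (C : Tab) : Finset ℕ :=
  (gctType cells C (kOf cells C)).image fun i => n - i

/-- The entry sum `Σ(C)`. -/
def entrySum (cells : Finset (ℕ × ℕ)) (C : Tab) : ℕ := ∑ c ∈ cells, C c

/-- `C +̂ v := ct (ct⁻¹(C) +̃ v)`, where `ct⁻¹` is the standardization. -/
def Cadd (n : ℕ) (μ : YoungDiagram) (C : Tab) (v : ℕ × ℕ) : Tab :=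
  ctTab (n + 1) (Sadd n (stdz μ.cells C) v)

/-- The standard Young tableau `S⁰` of shape `μ` filling the rows consecutively. -/
def rowWordTab (μ : YoungDiagram) : Tab := fun c =>
  if c ∈ μ.cells then (∑ r ∈ Finset.range c.1, μ.rowLen r) + c.2 + 1 else 0

/-- The word of an ordered set partition: the blocks listed in order, each sorted
increasingly. -/
def opWord (k : ℕ) (B : ℕ → Finset ℕ) : List ℕ :=
  (List.range k).foldr (fun h acc => (B h).sort (· ≤ ·) ++ acc) []

/-- Renaming the variables of a power series along a permutation. -/
def permSeries (g : Equiv.Perm ℕ) (F : MvPowerSeries ℕ ℚ) : MvPowerSeries ℕ ℚ :=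
  fun m => F (Finsupp.mapDomain ⇑g⁻¹ m)


abbrev Pn (n : ℕ) := MvPolynomial (Fin n) ℚ

def fs {n : ℕ} (b : Fin n → ℕ) : Fin n →₀ ℕ := Finsupp.equivFunOnFinite.symm b

def mon {n : ℕ} (b : Fin n → ℕ) : Pn n := monomial (fs b) 1

def cf {n : ℕ} (b : Fin n → ℕ) : Pn n →ₗ[ℚ] ℚ := lcoeff ℚ (fs b)

lemma fs_apply {n : ℕ} (b : Fin n → ℕ) (i : Fin n) : fs b i = b i := rfl

lemma fs_coe {n : ℕ} (m : Fin n →₀ ℕ) : fs (⇑m) = m := by ext i; rfl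

lemma fs_inj {n : ℕ} {a b : Fin n → ℕ} : fs a = fs b ↔ a = b := by
  constructor
  · intro h; funext i; rw [← fs_apply a, h, fs_apply]
  · rintro rfl; rfl

lemma fs_add {n : ℕ} (a b : Fin n → ℕ) : fs (a + b) = fs a + fs b := by ext i; rfl

lemma cf_apply {n : ℕ} (b : Fin n → ℕ) (p : Pn n) : cf b p = coeff (fs b) p := rfl

lemma cf_mon {n : ℕ} (a b : Fin n → ℕ) : cf a (mon b) = if b = a then 1 else 0 := by
  rw [cf_apply, mon, coeff_monomial]
  simp only [fs_inj]

lemma cf_ext {n : ℕ} {p q : Pn n} (h : ∀ b, cf b p = cf b q) : p = q := by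
  ext m
  have := h m
  rwa [cf_apply, cf_apply, fs_coe] at this

lemma eq_sum_mon {n : ℕ} (p : Pn n) : p = ∑ m ∈ p.support, cf (⇑m) p • mon (⇑m) := by
  conv_lhs => rw [p.as_sum]
  apply Finset.sum_congr rfl
  intro m _
  rw [cf_apply, mon, fs_coe, smul_monomial, smul_eq_mul, mul_one]

lemma mem_support_cf {n : ℕ} (p : Pn n) (m : Fin n →₀ ℕ) : m ∈ p.support ↔ cf (⇑m) p ≠ 0 := by
  rw [mem_support_iff, cf_apply, fs_coe]

lemma mon_mul {n : ℕ} (a b : Fin n → ℕ) : mon a * mon b = mon (a + b) := by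
  rw [mon, mon, mon, monomial_mul, fs_add, mul_one]

lemma rename_mon {n : ℕ} (σ : Equiv.Perm (Fin n)) (b : Fin n → ℕ) :
    rename σ (mon b) = mon (b ∘ σ.symm) := by
  rw [mon, rename_monomial, mon]
  congr 1
  refine congrArg _ (Finsupp.ext fun i => ?_)
  rw [fs_apply]
  conv_lhs => rw [← σ.apply_symm_apply i]
  rw [Finsupp.mapDomain_apply σ.injective]
  rfl

lemma cf_rename {n : ℕ} (σ : Equiv.Perm (Fin n)) (b : Fin n → ℕ) (p : Pn n) :
    cf b (rename σ p) = cf (b ∘ σ) p := by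
  rw [cf_apply, cf_apply]
  rw [← coeff_rename_mapDomain σ σ.injective p]
  congr 1
  ext i
  obtain ⟨j, rfl⟩ := σ.surjective i
  rw [Finsupp.mapDomain_apply σ.injective]
  simp [fs_apply]

lemma cf_mul {n : ℕ} (b : Fin n → ℕ) (p q : Pn n) :
    cf b (p * q) = ∑ x ∈ Finset.HasAntidiagonal.antidiagonal (fs b), cf (⇑x.1) p * cf (⇑x.2) q := by
  rw [cf_apply, coeff_mul]
  simp only [cf_apply, fs_coe]

lemma exists_of_cf_mul_ne {n : ℕ} {b : Fin n → ℕ} {p q : Pn n} (h : cf b (p * q) ≠ 0) :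
    ∃ a c, a + c = b ∧ cf a p ≠ 0 ∧ cf c q ≠ 0 := by
  rw [cf_mul] at h
  obtain ⟨x, hx, hne⟩ := Finset.exists_ne_zero_of_sum_ne_zero h
  rw [Finset.HasAntidiagonal.mem_antidiagonal] at hx
  refine ⟨x.1, x.2, ?_, left_ne_zero_of_mul hne, right_ne_zero_of_mul hne⟩
  rw [← fs_inj, fs_add, fs_coe, fs_coe, hx]

lemma cf_mul_nonneg {n : ℕ} {p q : Pn n} (hp : ∀ b, 0 ≤ cf b p) (hq : ∀ b, 0 ≤ cf b q) (b) :
    0 ≤ cf b (p * q) := by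
  rw [cf_mul]
  exact Finset.sum_nonneg fun x _ => mul_nonneg (hp _) (hq _)

lemma cf_mul_pos {n : ℕ} {p q : Pn n} (hp : ∀ b, 0 ≤ cf b p) (hq : ∀ b, 0 ≤ cf b q) {a c}
    (ha : 0 < cf a p) (hc : 0 < cf c q) : 0 < cf (a + c) (p * q) := by
  rw [cf_mul]
  apply Finset.sum_pos' (fun x _ => mul_nonneg (hp _) (hq _))
  refine ⟨(fs a, fs c), ?_, ?_⟩
  · rw [Finset.HasAntidiagonal.mem_antidiagonal, fs_add]
  · exact mul_pos ha hc

/-! dominance -/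

def topSum {n : ℕ} (β : Fin n → ℕ) (t : ℕ) : ℕ := ∑ i ∈ Finset.univ.filter (fun i : Fin n => n ≤ (i : ℕ) + t), β i

def Dom {n : ℕ} (b β : Fin n → ℕ) : Prop :=
  ∀ B : Finset (Fin n), ∑ i ∈ B, b i ≤ topSum β B.card

lemma topSum_add {n : ℕ} (β γ : Fin n → ℕ) (t : ℕ) :
    topSum (β + γ) t = topSum β t + topSum γ t := by
  simp [topSum, Finset.sum_add_distrib]

lemma Dom.add {n : ℕ} {b β c γ : Fin n → ℕ} (h : Dom b β) (h' : Dom c γ) :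
    Dom (b + c) (β + γ) := by
  intro B
  rw [topSum_add]
  simp only [Pi.add_apply, Finset.sum_add_distrib]
  exact add_le_add (h B) (h' B)

lemma Dom.perm {n : ℕ} {b β : Fin n → ℕ} (h : Dom b β) (σ : Equiv.Perm (Fin n)) :
    Dom (b ∘ σ) β := by
  intro B
  have := h (B.map σ.toEmbedding)
  simpa using this

lemma card_top {n : ℕ} (t : ℕ) (ht : t ≤ n) :
    (Finset.univ.filter fun i : Fin n => n ≤ (i : ℕ) + t).card = t := by
  have : (Finset.univ.filter fun i : Fin n => n ≤ (i : ℕ) + t).map Fin.valEmbedding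
      = Finset.Ico (n - t) n := by
    ext j
    simp only [Finset.mem_map, Finset.mem_filter, Finset.mem_univ, true_and, Fin.valEmbedding_apply,
      Finset.mem_Ico]
    constructor
    · rintro ⟨i, hi, rfl⟩; have := i.2; omega
    · rintro ⟨h1, h2⟩; exact ⟨⟨j, h2⟩, by simp; omega, rfl⟩
  rw [← Finset.card_map Fin.valEmbedding, this, Nat.card_Ico]; omega

lemma sum_le_topSum {n : ℕ} {β : Fin n → ℕ} (hβ : Monotone β) (B : Finset (Fin n)) :
    ∑ i ∈ B, β i ≤ topSum β B.card := by
  set A := Finset.univ.filter fun i : Fin n => n ≤ (i : ℕ) + B.card with hA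
  have hcard : A.card = B.card := card_top _ (by simpa using Finset.card_le_univ B)
  rw [topSum, ← hA]
  rw [← Finset.sum_sdiff (Finset.inter_subset_left : A ∩ B ⊆ A),
    ← Finset.sum_sdiff (Finset.inter_subset_right : A ∩ B ⊆ B)]
  apply Nat.add_le_add_right
  have hc : (B \ (A ∩ B)).card = (A \ (A ∩ B)).card := by
    rw [Finset.card_sdiff_of_subset Finset.inter_subset_left,
      Finset.card_sdiff_of_subset Finset.inter_subset_right, hcard]
  by_cases he : (A \ (A ∩ B)).Nonempty
  · have hbound : ∀ i ∈ B \ (A ∩ B), ∀ j ∈ A \ (A ∩ B), β i ≤ β j := by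
      intro i hi j hj
      apply hβ
      simp only [Finset.mem_sdiff, Finset.mem_inter, hA, Finset.mem_filter, Finset.mem_univ,
        true_and] at hi hj
      rw [Fin.le_def]
      have : ¬ (n ≤ (i : ℕ) + B.card) := fun h => hi.2 ⟨h, hi.1⟩
      omega
    obtain ⟨j0, hj0, hmin⟩ := Finset.exists_min_image _ β he
    calc ∑ i ∈ B \ (A ∩ B), β i ≤ (B \ (A ∩ B)).card • β j0 :=
          Finset.sum_le_card_nsmul _ _ _ fun i hi => hbound i hi j0 hj0
      _ = (A \ (A ∩ B)).card • β j0 := by rw [hc]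
      _ ≤ _ := Finset.card_nsmul_le_sum _ _ _ fun i hi => hmin i hi
  · rw [Finset.not_nonempty_iff_eq_empty] at he
    rw [he, Finset.card_empty, Finset.card_eq_zero] at hc
    rw [hc]; simp

lemma Dom.refl {n : ℕ} {β : Fin n → ℕ} (hβ : Monotone β) : Dom β β := sum_le_topSum hβ

lemma Dom.le {n : ℕ} {b β : Fin n → ℕ} (hβ : Monotone β) (h : Dom b β) (i : Fin n) (N : ℕ)
    (hN : ∀ i, β i ≤ N) : b i ≤ N := by
  have := h {i}
  rw [Finset.sum_singleton, Finset.card_singleton] at this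
  refine this.trans ?_
  rw [topSum]
  refine (Finset.sum_le_card_nsmul _ _ N fun i _ => hN i).trans ?_
  rw [card_top 1 (by have := i.2; omega)]; simp

/-- refinement lemma -/
lemma refine_lemma {n : ℕ} {α δ d : Fin n → ℕ} {g : Equiv.Perm (Fin n)}
    (hα : Monotone α) (hd : Dom d δ) (h : (α + δ) ∘ g = α + d) : α ∘ g = α := by
  have key : ∀ t, t ≤ n → ∑ i with n ≤ (g i : ℕ) + t, α i = topSum α t := by
    intro t ht
    set B := Finset.univ.filter fun i : Fin n => n ≤ (g i : ℕ) + t with hB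
    have hBc : B.card = t := by
      rw [← card_top t ht, ← Finset.card_map g.toEmbedding]
      congr 1
      ext j
      simp only [Finset.mem_map, hB, Finset.mem_filter, Finset.mem_univ, true_and,
        Equiv.coe_toEmbedding]
      constructor
      · rintro ⟨i, hi, rfl⟩; exact hi
      · intro hj; exact ⟨g.symm j, by simpa using hj, by simp⟩
    have e1 : ∑ i ∈ B, ((α + δ) ∘ g) i = topSum (α + δ) t := by
      rw [topSum]
      refine Finset.sum_equiv g ?_ ?_
      · intro i; simp [hB]
      · intro i _; rfl
    rw [h] at e1
    simp only [Pi.add_apply, Finset.sum_add_distrib] at e1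
    rw [topSum_add] at e1
    have a1 := sum_le_topSum hα B
    have a2 := hd B
    rw [hBc] at a1 a2
    omega
  have key2 : ∀ t, t ≤ n → ∑ i ∈ Finset.univ.filter (fun i : Fin n => n ≤ (i : ℕ) + t), α (g.symm i) = topSum α t := by
    intro t ht
    rw [← key t ht]
    refine Finset.sum_equiv g.symm ?_ ?_
    · intro i; simp
    · intro i _; rfl
  have key3 : ∀ i, α (g.symm i) = α i := by
    intro i
    have hi := i.2
    have split : ∀ f : Fin n → ℕ, ∑ j ∈ Finset.univ.filter (fun j : Fin n => n ≤ (j : ℕ) + (n - i)), f j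
        = f i + ∑ j ∈ Finset.univ.filter (fun j : Fin n => n ≤ (j : ℕ) + (n - i - 1)), f j := by
      intro f
      have : (Finset.univ.filter fun j : Fin n => n ≤ (j : ℕ) + (n - i))
          = insert i (Finset.univ.filter fun j : Fin n => n ≤ (j : ℕ) + (n - i - 1)) := by
        ext j
        simp only [Finset.mem_filter, Finset.mem_univ, true_and, Finset.mem_insert, Fin.ext_iff]
        omega
      rw [this, Finset.sum_insert]
      simp only [Finset.mem_filter, Finset.mem_univ, true_and]; omega
    have k1 := key2 (n - i) (by omega)
    have k2 := key2 (n - i - 1) (by omega)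
    rw [topSum] at k1 k2
    rw [split, split, k2] at k1
    omega
  funext i
  have := key3 (g i)
  simpa using this.symm

def Good {n : ℕ} (δ : Fin n → ℕ) (p : Pn n) : Prop :=
  (∀ b, 0 ≤ cf b p) ∧ (∀ b, cf b p ≠ 0 → Dom b δ) ∧ 0 < cf δ p

lemma Good.mul {n : ℕ} {δ ε : Fin n → ℕ} {p q : Pn n} (hp : Good δ p) (hq : Good ε q) :
    Good (δ + ε) (p * q) := by
  refine ⟨cf_mul_nonneg hp.1 hq.1, ?_, cf_mul_pos hp.1 hq.1 hp.2.2 hq.2.2⟩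
  intro b hb
  obtain ⟨a, c, rfl, ha, hc⟩ := exists_of_cf_mul_ne hb
  exact (hp.2.1 a ha).add (hq.2.1 c hc)

lemma mon_zero {n : ℕ} : mon (0 : Fin n → ℕ) = 1 := by
  rw [mon]
  have : fs (0 : Fin n → ℕ) = 0 := by ext; rfl
  rw [this]; rfl

lemma good_mon {n : ℕ} {α : Fin n → ℕ} (hα : Monotone α) : Good α (mon α) := by
  refine ⟨?_, ?_, ?_⟩
  · intro b; rw [cf_mon]; split_ifs <;> norm_num
  · intro b hb; rw [cf_mon] at hb
    split_ifs at hb with h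
    · rw [← h]; exact Dom.refl hα
    · exact absurd rfl hb
  · rw [cf_mon]; simp

def ind {n : ℕ} (s : Finset (Fin n)) : Fin n → ℕ := fun i => if i ∈ s then 1 else 0

lemma prod_X_eq_mon {n : ℕ} (s : Finset (Fin n)) : (∏ i ∈ s, X i : Pn n) = mon (ind s) := by
  induction s using Finset.induction_on with
  | empty => rw [Finset.prod_empty, ← mon_zero]; congr 1
  | insert a s ha ih =>
    rw [Finset.prod_insert ha, ih]
    have : (X a : Pn n) = mon (ind {a}) := by
      rw [mon, X]; refine congrArg (fun m => monomial m (1 : ℚ)) (Finsupp.ext fun i => ?_); rw [fs_apply, ind, Finsupp.single_apply]; simp [eq_comm]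
    rw [this, mon_mul]; congr 1; funext i
    simp only [Pi.add_apply, ind, Finset.mem_singleton, Finset.mem_insert]
    by_cases h : i = a
    · subst h; simp [ha]
    · simp [h]

def topv (n s : ℕ) : Fin n → ℕ := fun i => if n ≤ (i : ℕ) + s then 1 else 0

lemma topv_eq {n s : ℕ} : topv n s = ind (Finset.univ.filter fun i : Fin n => n ≤ (i : ℕ) + s) := by
  funext i; simp [topv, ind]

lemma topv_mono (n s : ℕ) : Monotone (topv n s) := by
  intro i j h
  rw [Fin.le_def] at h
  simp only [topv]
  split_ifs <;> omega

lemma esymFin_eq (n s : ℕ) : esymFin n s =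
    ∑ A ∈ (Finset.univ : Finset (Fin n)).powersetCard s, mon (ind A) := by
  rw [esymFin]; simp only [prod_X_eq_mon]

lemma topSum_topv {n s t : ℕ} (hs : s ≤ n) (ht : t ≤ n) : topSum (topv n s) t = min s t := by
  rw [topSum]
  simp only [topv]
  rw [← Finset.sum_filter, Finset.filter_filter, Finset.sum_const, smul_eq_mul, mul_one]
  rw [← card_top (min s t) (by omega : min s t ≤ n)]
  congr 1; ext i; simp only [Finset.mem_filter, Finset.mem_univ, true_and]; omega

lemma good_esym {n s : ℕ} (hs : s ≤ n) : Good (topv n s) (esymFin n s) := by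
  have hc : ∀ b, cf b (esymFin n s) = ∑ A ∈ (Finset.univ : Finset (Fin n)).powersetCard s,
      if ind A = b then (1 : ℚ) else 0 := by
    intro b; rw [esymFin_eq, map_sum]; simp only [cf_mon]
  refine ⟨?_, ?_, ?_⟩
  · intro b; rw [hc]; exact Finset.sum_nonneg fun A _ => by split_ifs <;> norm_num
  · intro b hb
    rw [hc] at hb
    obtain ⟨A, hA, hne⟩ := Finset.exists_ne_zero_of_sum_ne_zero hb
    have hA' : ind A = b := by by_contra h; simp [h] at hne
    rw [Finset.mem_powersetCard] at hA
    subst hA'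
    intro B
    rw [topSum_topv hs (by simpa using Finset.card_le_univ B)]
    simp only [ind]
    rw [← Finset.sum_filter, Finset.sum_const, smul_eq_mul, mul_one, le_min_iff]
    constructor
    · rw [← hA.2]; apply Finset.card_le_card; intro i; simp
    · exact Finset.card_filter_le _ _
  · rw [hc]
    apply Finset.sum_pos' (fun A _ => by split_ifs <;> norm_num)
    refine ⟨Finset.univ.filter fun i : Fin n => n ≤ (i : ℕ) + s, ?_, ?_⟩
    · rw [Finset.mem_powersetCard]; exact ⟨Finset.subset_univ _, card_top s hs⟩
    · rw [topv_eq]; simp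

def EL (n : ℕ) (L : Multiset ℕ) : Pn n := (L.map (esymFin n)).prod

def topL (n : ℕ) (L : Multiset ℕ) : Fin n → ℕ := (L.map (topv n)).sum

lemma good_EL {n : ℕ} (L : Multiset ℕ) (hL : ∀ s ∈ L, s ≤ n) : Good (topL n L) (EL n L) := by
  induction L using Multiset.induction_on with
  | empty =>
    have : Good (0 : Fin n → ℕ) (mon 0) := good_mon (fun _ _ _ => le_refl _)
    rw [mon_zero] at this
    simpa [topL, EL] using this
  | cons a L ih =>
    rw [topL, EL, Multiset.map_cons, Multiset.map_cons, Multiset.sum_cons, Multiset.prod_cons]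
    exact (good_esym (hL a (Multiset.mem_cons_self a L))).mul
      (ih fun s hs => hL s (Multiset.mem_cons_of_mem hs))

lemma rename_esymFin {n : ℕ} (s : ℕ) (σ : Equiv.Perm (Fin n)) :
    rename σ (esymFin n s) = esymFin n s := by
  have : esymFin n s = MvPolynomial.esymm (Fin n) ℚ s := rfl
  rw [this]; exact MvPolynomial.esymm_isSymmetric (Fin n) ℚ s σ

lemma rename_EL {n : ℕ} (L : Multiset ℕ) (σ : Equiv.Perm (Fin n)) :
    rename σ (EL n L) = EL n L := by
  rw [EL, map_multiset_prod, Multiset.map_map]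
  congr 1
  apply Multiset.map_congr rfl
  intro s _
  exact rename_esymFin s σ

lemma mono_add {n : ℕ} {a b : Fin n → ℕ} (ha : Monotone a) (hb : Monotone b) :
    Monotone (a + b) := fun i j h => add_le_add (ha h) (hb h)

lemma exists_topL {n : ℕ} (δ : Fin n → ℕ) (hδ : Monotone δ) :
    ∃ L : Multiset ℕ, (∀ s ∈ L, 1 ≤ s ∧ s ≤ n) ∧ topL n L = δ ∧
      ∀ h : 0 < n, L.card = δ ⟨n - 1, by omega⟩ := by
  induction hs : ∑ i, δ i using Nat.strong_induction_on generalizing δ with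
  | _ N ih =>
  by_cases h0 : δ = 0
  · subst h0; exact ⟨0, by simp, by simp [topL], by simp⟩
  · obtain ⟨i0, hi0⟩ : ∃ i, δ i ≠ 0 := by
      by_contra h; push Not at h; exact h0 (funext h)
    set A := Finset.univ.filter fun i : Fin n => δ i ≠ 0 with hA
    have hAne : A.Nonempty := ⟨i0, by simp [hA, hi0]⟩
    obtain ⟨m, hm, hmin⟩ := Finset.exists_min_image A (fun i => (i : ℕ)) hAne
    have hm0 : δ m ≠ 0 := by simpa [hA] using hm
    have hiff : ∀ i : Fin n, δ i ≠ 0 ↔ m ≤ i := by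
      intro i
      constructor
      · intro h; exact hmin i (by simp [hA, h])
      · intro h; have := hδ h; omega
    have hmn := m.2
    have htop : ∀ i : Fin n, topv n (n - m) i = if m ≤ i then 1 else 0 := by
      intro i; simp only [topv, Fin.le_def]; congr 1; apply propext; omega
    let δ' : Fin n → ℕ := fun i => δ i - 1
    have hadd : δ = topv n (n - m) + δ' := by
      funext i
      rw [Pi.add_apply, htop]
      have := hiff i
      simp only [δ']
      split_ifs with h
      · have := (hiff i).2 h; omega
      · have : δ i = 0 := by by_contra hh; exact h ((hiff i).1 hh)
        omega
    have hδ' : Monotone δ' := fun i j h => Nat.sub_le_sub_right (hδ h) 1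
    have hlt : ∑ i, δ' i < N := by
      rw [← hs]
      apply Finset.sum_lt_sum (fun i _ => Nat.sub_le _ _) ⟨m, Finset.mem_univ _, by simp [δ']; omega⟩
    obtain ⟨L, hL1, hL2, hL3⟩ := ih _ hlt δ' hδ' rfl
    refine ⟨(n - m) ::ₘ L, ?_, ?_, ?_⟩
    · intro s hs; rw [Multiset.mem_cons] at hs
      rcases hs with rfl | hs
      · omega
      · exact hL1 s hs
    · rw [topL, Multiset.map_cons, Multiset.sum_cons]
      rw [topL] at hL2; rw [hL2, ← hadd]
    · intro h
      rw [Multiset.card_cons, hL3 h]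
      have : δ ⟨n-1, by omega⟩ ≠ 0 := (hiff _).2 (by rw [Fin.le_def]; simp; omega)
      simp only [δ']; omega

lemma sort_uniq {n : ℕ} {A B : Type*} [LinearOrder B] (r : Fin n → A) (a : Fin n → B)
    (σ : Equiv.Perm (Fin n))
    (hr : ∀ i, r (σ i) = r i) (h1 : ∀ i j, i < j → r i = r j → a i ≤ a j)
    (h2 : ∀ i j, i < j → r i = r j → a (σ i) ≤ a (σ j)) : ∀ i, a (σ i) = a i := by
  have cnt : ∀ (c : A) (v : B), (Finset.univ.filter fun j => r j = c ∧ a (σ j) ≤ v).card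
      = (Finset.univ.filter fun j => r j = c ∧ a j ≤ v).card := by
    intro c v
    apply Finset.card_bij (fun j _ => σ j)
    · intro j hj; simpa [hr] using hj
    · intro j _ j' _ h; exact σ.injective h
    · intro j hj
      refine ⟨σ.symm j, ?_, by simp⟩
      have := hr (σ.symm j)
      simp only [Equiv.apply_symm_apply] at this
      simpa [← this] using hj
  have gen : ∀ (f g : Fin n → B), (∀ i j, i < j → r i = r j → f i ≤ f j) →
      (∀ i j, i < j → r i = r j → g i ≤ g j) →
      (∀ (c : A) (v : B), (Finset.univ.filter fun j => r j = c ∧ f j ≤ v).card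
      = (Finset.univ.filter fun j => r j = c ∧ g j ≤ v).card) → ∀ i, ¬ f i < g i := by
    intro f g hf hg hc i hlt
    have s1 : (Finset.univ.filter fun j => r j = r i ∧ j ≤ i) ⊆
        (Finset.univ.filter fun j => r j = r i ∧ f j ≤ f i) := by
      intro j
      simp only [Finset.mem_filter, Finset.mem_univ, true_and]
      rintro ⟨h, hle⟩
      refine ⟨h, ?_⟩
      rcases hle.lt_or_eq with h' | rfl
      · exact hf _ _ h' h
      · exact le_refl _
    have s2 : (Finset.univ.filter fun j => r j = r i ∧ g j ≤ f i) ⊂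
        (Finset.univ.filter fun j => r j = r i ∧ j ≤ i) := by
      rw [Finset.ssubset_iff_of_subset]
      · refine ⟨i, by simp, ?_⟩
        simp [hlt]
      · intro j
        simp only [Finset.mem_filter, Finset.mem_univ, true_and]
        rintro ⟨h, hle⟩
        refine ⟨h, ?_⟩
        by_contra hij
        push Not at hij
        have := hg _ _ hij h.symm
        exact absurd (hlt.trans_le (this.trans hle)) (lt_irrefl _)
    have := Finset.card_lt_card s2
    have := Finset.card_le_card s1
    have := hc (r i) (f i)
    omega
  intro i
  apply le_antisymm
  · exact not_lt.1 (gen a (fun i => a (σ i)) h1 h2 (fun c v => (cnt c v).symm) i)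
  · exact not_lt.1 (gen (fun i => a (σ i)) a h2 h1 cnt i)

lemma sum_swap_aux {n : ℕ} (f γ : Fin n → ℕ) (i j : Fin n) (hij : i ≠ j) :
    (∑ x, f x * γ (Equiv.swap i j x)) + f i * γ i + f j * γ j =
    (∑ x, f x * γ x) + f i * γ j + f j * γ i := by
  have hs : ∀ h : Fin n → ℕ, ∑ x, h x = (∑ x ∈ (Finset.univ.erase i).erase j, h x) + h j + h i := by
    intro h
    rw [← Finset.sum_erase_add _ _ (Finset.mem_univ i), ← Finset.sum_erase_add _ _
      (show j ∈ Finset.univ.erase i by simp [hij.symm])]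
  rw [hs, hs (fun x => f x * γ x)]
  have : ∑ x ∈ (Finset.univ.erase i).erase j, f x * γ (Equiv.swap i j x)
      = ∑ x ∈ (Finset.univ.erase i).erase j, f x * γ x := by
    apply Finset.sum_congr rfl
    intro x hx
    simp only [Finset.mem_erase, Finset.mem_univ] at hx
    rw [Equiv.swap_apply_of_ne_of_ne hx.2.1 hx.1]
  rw [this, Equiv.swap_apply_left, Equiv.swap_apply_right]
  ring

lemma lemma_Phi {n : ℕ} {r f α β : Fin n → ℕ} (hα : Monotone α) (hβ : Monotone β)
    (hfα : ∀ i j, i < j → α i = α j → f i < f j)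
    (hfr : ∀ i j, i < j → r i = r j → f i < f j)
    (g σ : Equiv.Perm (Fin n)) (hσ : ∀ i, r (σ i) = r i) (hg : ∀ i, α (g i) = α (σ i)) :
    (∑ i, f i * β (g i) ≤ ∑ i, f i * β i) ∧
    (∑ i, f i * β (g i) = ∑ i, f i * β i → ∀ i, β (g i) = β i) := by
  induction hm : (∑ i, ∑ j, f i * (α j + β j)) - ∑ i, f i * (α (g i) + β (g i))
    using Nat.strong_induction_on generalizing g σ with
  | _ N ih =>
  have hbound : ∀ g : Equiv.Perm (Fin n),
      ∑ i, f i * (α (g i) + β (g i)) ≤ ∑ i, ∑ j, f i * (α j + β j) := by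
    intro g
    apply Finset.sum_le_sum
    intro i _
    exact Finset.single_le_sum (f := fun j => f i * (α j + β j)) (fun _ _ => Nat.zero_le _)
      (Finset.mem_univ (g i))
  have swp : ∀ (γ : Fin n → ℕ) (i j : Fin n), i ≠ j →
      (∑ x, f x * γ ((g * Equiv.swap i j) x)) + f i * γ (g i) + f j * γ (g j) =
      (∑ x, f x * γ (g x)) + f i * γ (g j) + f j * γ (g i) := by
    intro γ i j hij
    exact sum_swap_aux f (fun x => γ (g x)) i j hij
  have meas : ∀ (i j : Fin n), i < j → f i < f j → α (g j) + β (g j) < α (g i) + β (g i) →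
      (∑ i, ∑ j, f i * (α j + β j)) - ∑ x, f x * (α ((g * Equiv.swap i j) x) +
        β ((g * Equiv.swap i j) x)) < N := by
    intro i j hij hf hlt
    have h1 := swp (fun x => α x + β x) i j hij.ne
    have h2 := hbound (g * Equiv.swap i j)
    have h3 : f i * (α (g i) + β (g i)) + f j * (α (g j) + β (g j)) <
      f i * (α (g j) + β (g j)) + f j * (α (g i) + β (g i)) := by nlinarith
    omega
  by_cases c1 : ∃ i j, i < j ∧ r i = r j ∧ α (g j) + β (g j) < α (g i) + β (g i)
  · obtain ⟨i, j, hij, hrij, hlt⟩ := c1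
    have hf := hfr i j hij hrij
    have hgij : g j < g i := by
      by_contra h
      push Not at h
      have := hα h; have := hβ h; omega
    have hrsw : ∀ x, r (Equiv.swap i j x) = r x := by
      intro x
      by_cases hx : x = i
      · subst hx; rw [Equiv.swap_apply_left, hrij]
      · by_cases hx' : x = j
        · subst hx'; rw [Equiv.swap_apply_right, hrij]
        · rw [Equiv.swap_apply_of_ne_of_ne hx hx']
    obtain ⟨i1, i2⟩ := ih _ (meas i j hij hf hlt) (g * Equiv.swap i j) (σ * Equiv.swap i j)
      (fun x => by rw [Equiv.Perm.mul_apply, hσ, hrsw])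
      (fun x => by rw [Equiv.Perm.mul_apply, hg, Equiv.Perm.mul_apply]) rfl
    have h1 := swp β i j hij.ne
    have hb := hβ hgij.le
    have hle : f i * β (g i) + f j * β (g j) ≤ f i * β (g j) + f j * β (g i) := by nlinarith
    refine ⟨by omega, ?_⟩
    intro he
    have he' : f i * β (g i) + f j * β (g j) = f i * β (g j) + f j * β (g i) := by omega
    have hbe : β (g i) = β (g j) := by
      by_contra hne
      have : β (g j) < β (g i) := by omega
      nlinarith
    have i3 := i2 (by omega)
    intro x
    rw [← i3 x, Equiv.Perm.mul_apply]
    by_cases hx : x = i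
    · subst hx; rw [Equiv.swap_apply_left, hbe]
    · by_cases hx' : x = j
      · subst hx'; rw [Equiv.swap_apply_right, hbe]
      · rw [Equiv.swap_apply_of_ne_of_ne hx hx']
  · push Not at c1
    have hασ : ∀ i, α (σ i) = α i := by
      apply sort_uniq r α σ hσ (fun i j hij _ => hα hij.le)
      intro i j hij hrij
      have h := c1 i j hij hrij
      rw [← hg, ← hg]
      by_contra hlt
      push Not at hlt
      have : g j ≤ g i := by
        by_contra hh; push Not at hh; have := hα hh.le; omega
      have := hβ this; omega
    have hαg : ∀ i, α (g i) = α i := fun i => by rw [hg, hασ]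
    by_cases c2 : ∃ i j, i < j ∧ α i = α j ∧ β (g j) < β (g i)
    · obtain ⟨i, j, hij, haij, hlt⟩ := c2
      have hf := hfα i j hij haij
      have hasw : ∀ x, α (Equiv.swap i j x) = α x := by
        intro x
        by_cases hx : x = i
        · subst hx; rw [Equiv.swap_apply_left, haij]
        · by_cases hx' : x = j
          · subst hx'; rw [Equiv.swap_apply_right, haij]
          · rw [Equiv.swap_apply_of_ne_of_ne hx hx']
      obtain ⟨i1, i2⟩ := ih _ (meas i j hij hf (by rw [hαg, hαg, haij]; omega))
        (g * Equiv.swap i j) 1 (fun x => rfl)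
        (fun x => by rw [Equiv.Perm.mul_apply, hαg, hasw]; rfl) rfl
      have h1 := swp β i j hij.ne
      have hle : f i * β (g i) + f j * β (g j) < f i * β (g j) + f j * β (g i) := by nlinarith
      exact ⟨by omega, fun he => by omega⟩
    · push Not at c2
      have := sort_uniq α β g hαg (fun i j hij _ => hβ hij.le) c2
      simp [this]

/-- K2 -/
lemma dom_sq {n : ℕ} {b β : Fin n → ℕ} (hβ : Monotone β) (h : Dom b β) :
    (∃ g : Equiv.Perm (Fin n), b = β ∘ g) ∨ ∑ i, b i * b i < ∑ i, β i * β i := by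
  set μ := b ∘ Tuple.sort b with hμ
  have hμm : Monotone μ := Tuple.monotone_sort b
  have hd : Dom μ β := h.perm _
  have hts : ∀ s, s ≤ n → topSum μ s ≤ topSum β s := by
    intro s hs
    have := hd (Finset.univ.filter fun i : Fin n => n ≤ (i : ℕ) + s)
    rwa [card_top s hs] at this
  obtain ⟨L, hL1, hL2, -⟩ := exists_topL μ hμm
  have hmul : ∀ (γ : Fin n → ℕ) (s : ℕ), ∑ i, topv n s i * γ i = topSum γ s := by
    intro γ s
    rw [topSum, Finset.sum_filter]
    apply Finset.sum_congr rfl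
    intro i _
    simp only [topv]; split_ifs <;> simp
  have hgen : ∀ L : Multiset ℕ, (∀ s ∈ L, 1 ≤ s ∧ s ≤ n) →
      ∑ i, topL n L i * μ i ≤ ∑ i, topL n L i * β i := by
    intro L
    induction L using Multiset.induction_on with
    | empty => simp [topL]
    | cons a L ih =>
      intro hL
      have e : topL n (a ::ₘ L) = topv n a + topL n L := by simp [topL]
      rw [e]
      simp only [Pi.add_apply, add_mul, Finset.sum_add_distrib, hmul]
      exact add_le_add (hts a (hL a (by simp)).2) (ih fun s hs => hL s (by simp [hs]))
  have k1 := hgen L hL1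
  rw [hL2] at k1
  have hbμ : ∑ i, b i * b i = ∑ i, μ i * μ i := by
    rw [hμ]; exact (Equiv.sum_comp (Tuple.sort b) (fun i => b i * b i)).symm
  rw [hbμ]
  by_cases he : μ = β
  · left
    refine ⟨(Tuple.sort b).symm, ?_⟩
    rw [← he, hμ]; funext i; simp
  · right
    have : 2 * ∑ i, μ i * β i < ∑ i, μ i * μ i + ∑ i, β i * β i := by
      rw [Finset.mul_sum, ← Finset.sum_add_distrib]
      obtain ⟨i0, hi0⟩ := Function.ne_iff.1 he
      apply Finset.sum_lt_sum
      · intro i _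
        zify
        nlinarith [sq_nonneg ((μ i : ℤ) - β i)]
      · refine ⟨i0, Finset.mem_univ _, ?_⟩
        zify
        have : ((μ i0 : ℤ) - β i0) ≠ 0 := by
          intro hh; apply hi0; omega
        have := sq_pos_of_ne_zero this
        nlinarith
    omega

def row {n : ℕ} (t : Fin n → ℕ × ℕ) : Fin n → ℕ := fun i => (t i).1
def col {n : ℕ} (t : Fin n → ℕ × ℕ) : Fin n → ℕ := fun i => (t i).2

/-- filling -/
structure Fil {n : ℕ} (t : Fin n → ℕ × ℕ) : Prop where
  inj : Function.Injective t
  low : ∀ i c, c.1 ≤ (t i).1 → c.2 ≤ (t i).2 → ∃ j, t j = c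

structure Lin {n : ℕ} (t : Fin n → ℕ × ℕ) : Prop extends Fil t where
  std : ∀ i j, (t i).1 ≤ (t j).1 → (t i).2 ≤ (t j).2 → i ≤ j

def extp {n : ℕ} (t : Fin n → ℕ × ℕ) : ℕ → ℕ × ℕ := fun j => if h : j < n then t ⟨j, h⟩ else (0, 0)

lemma extp_fin {n : ℕ} (t : Fin n → ℕ × ℕ) (i : Fin n) : extp t i = t i := by
  rw [extp, dif_pos i.2]

def Dset {n : ℕ} (t : Fin n → ℕ × ℕ) : Finset ℕ :=
  (Finset.Ioo 0 n).filter fun j => (extp t (j - 1)).1 < (extp t j).1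

def al {n : ℕ} (t : Fin n → ℕ × ℕ) : Fin n → ℕ := fun i => ((Dset t).filter fun j => j ≤ (i : ℕ)).card

lemma al_mono {n : ℕ} (t : Fin n → ℕ × ℕ) : Monotone (al t) := by
  intro i j h
  apply Finset.card_le_card
  intro x
  simp only [Finset.mem_filter]
  rw [Fin.le_def] at h
  rintro ⟨h1, h2⟩
  exact ⟨h1, h2.trans h⟩

lemma al_F1 {n : ℕ} {t : Fin n → ℕ × ℕ} (ht : Lin t) (a b : Fin n) (hab : a < b)
    (he : al t a = al t b) : col t a < col t b := by
  have hno : ∀ j, (a : ℕ) < j → j ≤ b → j ∉ Dset t := by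
    intro j h1 h2 hj
    have : al t a < al t b := by
      apply Finset.card_lt_card
      rw [Finset.ssubset_iff_of_subset]
      · exact ⟨j, by simp [hj, h2], by simp; intro _; omega⟩
      · intro x
        simp only [Finset.mem_filter]
        rw [Fin.lt_def] at hab
        rintro ⟨h1, h2⟩
        exact ⟨h1, by omega⟩
    omega
  have step : ∀ d, (a : ℕ) + d + 1 ≤ b → (extp t a).2 < (extp t (a + d + 1)).2 := by
    have one : ∀ j, (a : ℕ) ≤ j → j + 1 ≤ b → (extp t j).2 < (extp t (j + 1)).2 := by
      intro j h1 h2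
      have hb := b.2
      have hj := hno (j + 1) (by omega) h2
      simp only [Dset, Finset.mem_filter, Finset.mem_Ioo, not_and, not_lt,
        Nat.add_sub_cancel] at hj
      have hr := hj ⟨by omega, by omega⟩
      by_contra hc
      push Not at hc
      have e1 := extp_fin t ⟨j, by omega⟩
      have e2 := extp_fin t ⟨j + 1, by omega⟩
      simp only at e1 e2
      rw [e1, e2] at hr hc
      have := ht.std _ _ hr hc
      rw [Fin.le_def] at this
      simp at this
    intro d
    induction d with
    | zero => intro h; exact one _ le_rfl h
    | succ d ih => intro h; exact (ih (by omega)).trans (one _ (by omega) h)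
  have := step (b - a - 1) (by rw [Fin.lt_def] at hab; omega)
  rw [Fin.lt_def] at hab
  rw [show (a : ℕ) + (b - a - 1) + 1 = b by omega, extp_fin, extp_fin] at this
  exact this

lemma Lin.lt_of_col {n : ℕ} {t : Fin n → ℕ × ℕ} (ht : Lin t) {a b : Fin n}
    (hc : col t a = col t b) (hr : row t a < row t b) : a < b := by
  have h1 := ht.std a b hr.le hc.le
  rcases h1.lt_or_eq with h | rfl
  · exact h
  · exact absurd hr (lt_irrefl _)

lemma Lin.row_lt {n : ℕ} {t : Fin n → ℕ × ℕ} (ht : Lin t) {a b : Fin n} (hab : a < b)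
    (hc : col t a = col t b) : row t a < row t b := by
  by_contra h
  push Not at h
  have := ht.std b a h hc.symm.le
  exact absurd hab (not_lt.2 this)

lemma Lin.col_lt {n : ℕ} {t : Fin n → ℕ × ℕ} (ht : Lin t) {a b : Fin n} (hab : a < b)
    (hc : row t a = row t b) : col t a < col t b := by
  by_contra h
  push Not at h
  have := ht.std b a hc.symm.le h
  exact absurd hab (not_lt.2 this)

lemma al_F2 {n : ℕ} {t : Fin n → ℕ × ℕ} (ht : Lin t) {a b : Fin n} (hab : a < b)
    (hc : col t a = col t b) : al t a < al t b := by
  have h1 := al_mono t hab.le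
  rcases h1.lt_or_eq with h | h
  · exact h
  · have := al_F1 ht a b hab h; omega

/-! column group -/

def Cg {n : ℕ} (t : Fin n → ℕ × ℕ) : Finset (Equiv.Perm (Fin n)) :=
  Finset.univ.filter fun σ => ∀ i, col t (σ i) = col t i

lemma mem_Cg {n : ℕ} {t : Fin n → ℕ × ℕ} {σ : Equiv.Perm (Fin n)} :
    σ ∈ Cg t ↔ ∀ i, col t (σ i) = col t i := by simp [Cg]

lemma Cg_mul {n : ℕ} {t : Fin n → ℕ × ℕ} {σ τ : Equiv.Perm (Fin n)} (h : σ ∈ Cg t)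
    (h' : τ ∈ Cg t) : σ * τ ∈ Cg t := by
  rw [mem_Cg] at *
  intro i; rw [Equiv.Perm.mul_apply, h, h']

lemma Cg_inv {n : ℕ} {t : Fin n → ℕ × ℕ} {σ : Equiv.Perm (Fin n)} (h : σ ∈ Cg t) :
    σ⁻¹ ∈ Cg t := by
  rw [mem_Cg] at *
  intro i
  have := h (σ⁻¹ i)
  simpa using this.symm

lemma Cg_one {n : ℕ} {t : Fin n → ℕ × ℕ} : 1 ∈ Cg t := by simp [mem_Cg]

def sg {n : ℕ} (σ : Equiv.Perm (Fin n)) : ℚ := ((Equiv.Perm.sign σ : ℤ) : ℚ)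

lemma sg_mul {n : ℕ} (σ τ : Equiv.Perm (Fin n)) : sg (σ * τ) = sg σ * sg τ := by simp [sg]
lemma sg_inv {n : ℕ} (σ : Equiv.Perm (Fin n)) : sg σ⁻¹ = sg σ := by simp [sg]
lemma sg_one {n : ℕ} : sg (1 : Equiv.Perm (Fin n)) = 1 := by simp [sg]
lemma sg_sq {n : ℕ} (σ : Equiv.Perm (Fin n)) : sg σ * sg σ = 1 := by
  rw [← sg_mul, sg]
  simp [Equiv.Perm.sign_mul]

def ren {n : ℕ} (σ : Equiv.Perm (Fin n)) : Pn n →ₗ[ℚ] Pn n := (rename σ).toLinearMap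

lemma ren_apply {n : ℕ} (σ : Equiv.Perm (Fin n)) (p : Pn n) : ren σ p = rename σ p := rfl

lemma ren_mul {n : ℕ} (σ τ : Equiv.Perm (Fin n)) (p : Pn n) : ren (σ * τ) p = ren σ (ren τ p) := by
  rw [ren_apply, ren_apply, ren_apply, rename_rename]; rfl

lemma ren_one {n : ℕ} (p : Pn n) : ren 1 p = p := by
  rw [ren_apply, Equiv.Perm.coe_one, rename_id]; rfl

lemma ren_mon {n : ℕ} (σ : Equiv.Perm (Fin n)) (b : Fin n → ℕ) :
    ren σ (mon b) = mon (fun i => b (σ⁻¹ i)) := by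
  rw [ren_apply, rename_mon]; rfl

lemma cf_ren {n : ℕ} (σ : Equiv.Perm (Fin n)) (b : Fin n → ℕ) (p : Pn n) :
    cf b (ren σ p) = cf (fun i => b (σ i)) p := cf_rename σ b p

def Cm {n : ℕ} (t : Fin n → ℕ × ℕ) : Pn n →ₗ[ℚ] Pn n := ∑ σ ∈ Cg t, sg σ • ren σ

lemma Cm_apply {n : ℕ} (t : Fin n → ℕ × ℕ) (p : Pn n) : Cm t p = ∑ σ ∈ Cg t, sg σ • ren σ p := by
  simp [Cm, LinearMap.sum_apply]

lemma Cm_ren {n : ℕ} {t : Fin n → ℕ × ℕ} {κ : Equiv.Perm (Fin n)} (h : κ ∈ Cg t) (p : Pn n) :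
    Cm t (ren κ p) = sg κ • Cm t p := by
  rw [Cm_apply, Cm_apply, Finset.smul_sum]
  refine Finset.sum_bij (fun σ _ => σ * κ) ?_ ?_ ?_ ?_
  · intro σ hσ; exact Cg_mul hσ h
  · intro a _ b _ hab; exact mul_right_cancel hab
  · intro σ hσ; exact ⟨σ * κ⁻¹, Cg_mul hσ (Cg_inv h), by simp⟩
  · intro σ _
    rw [ren_mul, sg_mul, smul_smul, mul_comm (sg σ), ← mul_assoc, sg_sq, one_mul]

def et {n : ℕ} (t : Fin n → ℕ × ℕ) : Pn n := Cm t (mon (row t))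

lemma cf_Cm {n : ℕ} (t : Fin n → ℕ × ℕ) (b : Fin n → ℕ) (p : Pn n) :
    cf b (Cm t p) = ∑ κ ∈ Cg t, sg κ * cf (fun i => b (κ i)) p := by
  rw [Cm_apply, map_sum]
  simp only [map_smul, cf_ren, smul_eq_mul]

lemma cf_et {n : ℕ} (t : Fin n → ℕ × ℕ) (b : Fin n → ℕ) :
    cf b (et t) = ∑ κ ∈ Cg t, sg κ * if row t = (fun i => b (κ i)) then 1 else 0 := by
  rw [et, cf_Cm]
  simp only [cf_mon]

lemma exists_of_cf_et {n : ℕ} {t : Fin n → ℕ × ℕ} {b : Fin n → ℕ} (h : cf b (et t) ≠ 0) :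
    ∃ κ ∈ Cg t, ∀ i, row t i = b (κ i) := by
  rw [cf_et] at h
  obtain ⟨κ, hκ, hne⟩ := Finset.exists_ne_zero_of_sum_ne_zero h
  refine ⟨κ, hκ, ?_⟩
  by_contra hh
  apply hne
  rw [if_neg, mul_zero]
  intro h'; apply hh; intro i; rw [h']

lemma Cg_mul_conj {n : ℕ} {t : Fin n → ℕ × ℕ} (ρ σ : Equiv.Perm (Fin n)) :
    ρ * σ * ρ⁻¹ ∈ Cg (fun i => t (ρ⁻¹ i)) ↔ σ ∈ Cg t := by
  simp only [mem_Cg, col, Equiv.Perm.mul_apply]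
  constructor
  · intro h i; have := h (ρ i); simpa using this
  · intro h i; have := h (ρ⁻¹ i); simpa using this

lemma ren_et {n : ℕ} (t : Fin n → ℕ × ℕ) (ρ : Equiv.Perm (Fin n)) :
    ren ρ (et t) = et (fun i => t (ρ⁻¹ i)) := by
  rw [et, et, Cm_apply, Cm_apply, map_sum]
  refine Finset.sum_bij (fun σ _ => ρ * σ * ρ⁻¹) ?_ ?_ ?_ ?_
  · intro σ hσ; exact (Cg_mul_conj ρ σ).2 hσ
  · intro a _ b _ hab; simpa using hab
  · intro σ hσ
    refine ⟨ρ⁻¹ * σ * ρ, ?_, by group⟩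
    rw [← Cg_mul_conj ρ]
    convert hσ using 1; group
  · intro σ _
    rw [map_smul]
    congr 1
    · rw [sg_mul, sg_mul, sg_inv, mul_comm (sg ρ), mul_assoc, sg_sq, mul_one]
    · rw [show (row fun i => t (ρ⁻¹ i)) = fun i => row t (ρ⁻¹ i) from rfl, ← ren_mon,
        ← ren_mul, ← ren_mul]
      congr 2; group

lemma cf_row_et {n : ℕ} {t : Fin n → ℕ × ℕ} (ht : Function.Injective t) : cf (row t) (et t) = 1 := by
  rw [cf_et, Finset.sum_eq_single 1]
  · rw [if_pos (by funext i; rfl), sg_one, mul_one]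
  · intro κ hκ hne
    rw [if_neg, mul_zero]
    intro h
    apply hne
    ext1 i
    apply ht
    rw [mem_Cg] at hκ
    have h1 := hκ i
    have h2 := congrFun h i
    exact Prod.ext h2.symm h1
  · intro h; exact absurd Cg_one h

def Specht {n : ℕ} (t : Fin n → ℕ × ℕ) : Submodule ℚ (Pn n) :=
  Submodule.span ℚ {p | ∃ t' : Fin n → ℕ × ℕ, Function.Injective t' ∧ Set.range t' = Set.range t ∧
    p = et t'}

lemma Fil.congr {n : ℕ} {t t' : Fin n → ℕ × ℕ} (ht : Fil t) (h : Function.Injective t')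
    (hr : Set.range t' = Set.range t) : Fil t' := by
  refine ⟨h, ?_⟩
  intro i c h1 h2
  have : t' i ∈ Set.range t := by rw [← hr]; exact ⟨i, rfl⟩
  obtain ⟨j, hj⟩ := this
  rw [← hj] at h1 h2
  have hc : c ∈ Set.range t := ht.low j c h1 h2
  rw [← hr] at hc
  exact hc

lemma exists_perm {n : ℕ} {t t' : Fin n → ℕ × ℕ} (h : Function.Injective t)
    (h' : Function.Injective t') (hr : Set.range t' = Set.range t) :
    ∃ g : Equiv.Perm (Fin n), ∀ i, t' i = t (g i) := by
  have hex : ∀ i, ∃ j, t j = t' i := by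
    intro i
    have : t' i ∈ Set.range t := by rw [← hr]; exact ⟨i, rfl⟩
    exact this
  choose f hf using hex
  have hinj : Function.Injective f := by
    intro a b hab
    apply h'
    rw [← hf, ← hf, hab]
  exact ⟨Equiv.ofBijective f (Finite.injective_iff_bijective.1 hinj), fun i => (hf i).symm⟩

lemma C1 {n : ℕ} {t : Fin n → ℕ × ℕ} (ht : Fil t) (y : Fin n → ℕ)
    (hy : ∑ i, y i ≤ ∑ i, row t i) : ∃ c : ℚ, Cm t (mon y) = c • et t := by
  by_cases hc : ∃ a b, a ≠ b ∧ col t a = col t b ∧ y a = y b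
  · obtain ⟨a, b, hab, hcol, hyab⟩ := hc
    refine ⟨0, ?_⟩
    have hm : Equiv.swap a b ∈ Cg t := by
      rw [mem_Cg]; intro x
      by_cases hx : x = a
      · subst hx; rw [Equiv.swap_apply_left, hcol]
      · by_cases hx' : x = b
        · subst hx'; rw [Equiv.swap_apply_right, hcol]
        · rw [Equiv.swap_apply_of_ne_of_ne hx hx']
    have h1 := Cm_ren hm (mon y)
    have h2 : ren (Equiv.swap a b) (mon y) = mon y := by
      rw [ren_mon]; congr 1; funext x
      rw [Equiv.swap_inv]
      by_cases hx : x = a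
      · subst hx; rw [Equiv.swap_apply_left, hyab]
      · by_cases hx' : x = b
        · subst hx'; rw [Equiv.swap_apply_right, hyab]
        · rw [Equiv.swap_apply_of_ne_of_ne hx hx']
    have h3 : sg (Equiv.swap a b) = -1 := by simp [sg, Equiv.Perm.sign_swap hab]
    rw [h2, h3] at h1
    rw [zero_smul]
    have : (2 : ℚ) • Cm t (mon y) = 0 := by
      rw [two_smul]; nth_rewrite 1 [h1]; simp
    simpa using this
  · push Not at hc
    let ρ : Fin n → ℕ := fun i => (Finset.univ.filter fun j => col t j = col t i ∧ y j < y i).card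
    have hρy : ∀ i, ρ i ≤ y i := by
      intro i
      rw [← Finset.card_range (y i)]
      apply Finset.card_le_card_of_injOn y
      · intro j hj; simp at hj; simp [hj.2]
      · intro j hj k hk hjk
        simp at hj hk
        by_contra hne
        exact hc j k hne (hj.1.trans hk.1.symm) hjk
    have hρlt : ∀ i j, col t i = col t j → y i < y j → ρ i < ρ j := by
      intro i j hcol hlt
      apply Finset.card_lt_card
      rw [Finset.ssubset_iff_of_subset]
      · exact ⟨i, by simp [hcol, hlt], by simp⟩
      · intro x; simp only [Finset.mem_filter, Finset.mem_univ, true_and]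
        rintro ⟨h1, h2⟩; exact ⟨h1.trans hcol, h2.trans hlt⟩
    have hex : ∀ i, ∃ j, t j = (ρ i, col t i) := by
      intro i
      by_contra hno
      have hlt : ∀ j, col t j = col t i → row t j < ρ i := by
        intro j hj
        by_contra hle
        push Not at hle
        exact hno (ht.low j (ρ i, col t i) hle hj.symm.le)
      have h1 : (Finset.univ.filter fun j => col t j = col t i).card ≤ ρ i := by
        rw [← Finset.card_range (ρ i)]
        apply Finset.card_le_card_of_injOn (row t)
        · intro j hj; simp at hj; simp [hlt j hj]
        · intro j hj k hk hjk
          simp at hj hk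
          exact ht.inj (Prod.ext hjk (hj.trans hk.symm))
      have h2 : ρ i < (Finset.univ.filter fun j => col t j = col t i).card := by
        apply Finset.card_lt_card
        rw [Finset.ssubset_iff_of_subset]
        · exact ⟨i, by simp, by simp⟩
        · intro x; simp only [Finset.mem_filter, Finset.mem_univ, true_and]
          rintro ⟨h1, h2⟩; exact h1
      omega
    choose f hf using hex
    have hinj : Function.Injective f := by
      intro a b hab
      have h1 : (ρ a, col t a) = (ρ b, col t b) := by rw [← hf, ← hf, hab]
      rw [Prod.mk.injEq] at h1
      by_contra hne
      have := hc a b hne h1.2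
      rcases lt_or_gt_of_ne this with h | h
      · have := hρlt a b h1.2 h; omega
      · have := hρlt b a h1.2.symm h; omega
    let g : Equiv.Perm (Fin n) := Equiv.ofBijective f (Finite.injective_iff_bijective.1 hinj)
    have hgC : g ∈ Cg t := by
      rw [mem_Cg]; intro i
      change (t (f i)).2 = _; rw [hf]
    have hgr : ∀ i, row t (g i) = ρ i := by
      intro i; change (t (f i)).1 = _; rw [hf]
    have hsum : ∑ i, ρ i = ∑ i, row t i := by
      rw [← Equiv.sum_comp g (row t)]; exact Finset.sum_congr rfl fun i _ => (hgr i).symm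
    have hyρ : ∀ i, y i = ρ i := by
      have h1 : ∑ i, ρ i = ∑ i, y i := le_antisymm (Finset.sum_le_sum fun i _ => hρy i)
        (by rw [hsum]; exact hy)
      intro i
      exact ((Finset.sum_eq_sum_iff_of_le fun i _ => hρy i).1 h1 i (Finset.mem_univ i)).symm
    refine ⟨sg g⁻¹, ?_⟩
    rw [et, ← Cm_ren (Cg_inv hgC), ren_mon]
    congr 2; funext i
    rw [hyρ, ← hgr, inv_inv]

/-! dot product -/

def dot {n : ℕ} (p : Pn n) : Pn n →ₗ[ℚ] ℚ := ∑ m ∈ p.support, cf (⇑m) p • cf (⇑m)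

lemma dot_mon {n : ℕ} (p : Pn n) (b : Fin n → ℕ) : dot p (mon b) = cf b p := by
  rw [dot, LinearMap.sum_apply]
  simp only [LinearMap.smul_apply, cf_mon, smul_eq_mul]
  by_cases h : fs b ∈ p.support
  · rw [Finset.sum_eq_single (fs b)]
    · simp [fs]
    · intro m _ hne
      rw [if_neg, mul_zero]
      rintro rfl; exact hne (fs_coe m).symm
    · intro h'; exact absurd h h'
  · rw [mem_support_cf, not_not] at h
    have hb : (⇑(fs b) : Fin n → ℕ) = b := rfl
    rw [hb] at h
    rw [h]
    apply Finset.sum_eq_zero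
    intro m _
    split_ifs with h'
    · rw [← h', h]; simp
    · simp

lemma dot_et {n : ℕ} (p : Pn n) (t : Fin n → ℕ × ℕ) : dot p (et t) = cf (row t) (Cm t p) := by
  rw [et, Cm_apply, map_sum, cf_Cm]
  refine Finset.sum_bij (fun σ _ => σ⁻¹) ?_ ?_ ?_ ?_
  · intro σ h; exact Cg_inv h
  · intro a _ b _ h; exact inv_injective h
  · intro σ h; exact ⟨σ⁻¹, Cg_inv h, by simp⟩
  · intro σ _
    rw [map_smul, ren_mon, dot_mon, sg_inv, smul_eq_mul]

lemma C2 {n : ℕ} {t : Fin n → ℕ × ℕ} {v : Pn n} (hv : v ∈ Specht t)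
    (h : ∀ t' : Fin n → ℕ × ℕ, Function.Injective t' → Set.range t' = Set.range t → Cm t' v = 0) :
    v = 0 := by
  have h1 : ∀ w ∈ Specht t, dot v w = 0 := by
    intro w hw
    have : Specht t ≤ LinearMap.ker (dot v) := by
      rw [Specht, Submodule.span_le]
      rintro _ ⟨t', h1, h2, rfl⟩
      rw [SetLike.mem_coe, LinearMap.mem_ker, dot_et, h t' h1 h2, map_zero]
    exact this hw
  have h2 := h1 v hv
  rw [dot, LinearMap.sum_apply] at h2
  simp only [LinearMap.smul_apply, smul_eq_mul] at h2
  rw [Finset.sum_eq_zero_iff_of_nonneg fun m _ => mul_self_nonneg _] at h2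
  rw [← support_eq_empty, Finset.eq_empty_iff_forall_notMem]
  intro m hm
  have := h2 m hm
  rw [mem_support_cf] at hm
  exact hm (mul_self_eq_zero.1 this)

def th {n : ℕ} (s : Fin n → ℕ × ℕ) (G : Pn n) : Pn n →ₗ[ℚ] Pn n :=
  ∑ σ : Equiv.Perm (Fin n), (cf (fun i => row s (σ⁻¹ i))).smulRight (ren σ G)

lemma th_apply {n : ℕ} (s : Fin n → ℕ × ℕ) (G p : Pn n) :
    th s G p = ∑ σ : Equiv.Perm (Fin n), cf (fun i => row s (σ⁻¹ i)) p • ren σ G := by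
  simp [th, LinearMap.sum_apply]

lemma cf_th {n : ℕ} (s : Fin n → ℕ × ℕ) (G p : Pn n) (b : Fin n → ℕ) :
    cf b (th s G p) = ∑ σ : Equiv.Perm (Fin n), cf (fun i => row s (σ⁻¹ i)) p *
      cf (fun i => b (σ i)) G := by
  rw [th_apply, map_sum]
  simp only [map_smul, smul_eq_mul, cf_ren]

lemma th_ren {n : ℕ} (s : Fin n → ℕ × ℕ) (G p : Pn n) (ρ : Equiv.Perm (Fin n)) :
    th s G (ren ρ p) = ren ρ (th s G p) := by
  rw [th_apply, th_apply, map_sum, ← Equiv.sum_comp (Equiv.mulLeft ρ)]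
  apply Finset.sum_congr rfl
  intro σ _
  rw [map_smul, Equiv.coe_mulLeft]
  simp only [ren_mul, cf_ren]
  have : (fun i => row s ((ρ * σ)⁻¹ (ρ i))) = fun i => row s (σ⁻¹ i) := by
    funext i; simp [mul_inv_rev]
  rw [this]

lemma th_Cm {n : ℕ} (s t : Fin n → ℕ × ℕ) (G p : Pn n) : th s G (Cm t p) = Cm t (th s G p) := by
  rw [Cm_apply, Cm_apply, map_sum]
  simp only [map_smul, th_ren]

lemma th_mul {n : ℕ} (s : Fin n → ℕ × ℕ) (G E p : Pn n) (hE : ∀ σ : Equiv.Perm (Fin n), ren σ E = E) :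
    th s (G * E) p = th s G p * E := by
  rw [th_apply, th_apply, Finset.sum_mul]
  apply Finset.sum_congr rfl
  intro σ _
  rw [smul_mul_assoc, ren_apply, map_mul, ← ren_apply, ← ren_apply, hE]

lemma th_comm {n : ℕ} (s : Fin n → ℕ × ℕ) (G p : Pn n) (f : Pn n →ₗ[ℚ] Pn n)
    (hf : ∀ (σ : Equiv.Perm (Fin n)) q, f (ren σ q) = ren σ (f q)) :
    f (th s G p) = th s (f G) p := by
  rw [th_apply, th_apply, map_sum]
  simp only [map_smul, hf]

/-- G is a lead polynomial -/
structure IsLead {n : ℕ} (s : Fin n → ℕ × ℕ) (β : Fin n → ℕ) (G : Pn n) : Prop where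
  lin : Lin s
  split : ∃ δ : Fin n → ℕ, Monotone δ ∧ β = al s + δ
  nonneg : ∀ b, 0 ≤ cf b G
  supp : ∀ b, cf b G ≠ 0 → ∃ h : Equiv.Perm (Fin n), (∀ i, b i = β (h i)) ∧ ∀ i, al s (h i) = al s i
  pos : 0 < cf β G

lemma IsLead.mono {n : ℕ} {s : Fin n → ℕ × ℕ} {β : Fin n → ℕ} {G : Pn n} (h : IsLead s β G) :
    Monotone β := by
  obtain ⟨δ, h1, h2⟩ := h.split
  rw [h2]; exact mono_add (al_mono s) h1

lemma IsLead.strict {n : ℕ} {s : Fin n → ℕ × ℕ} {β : Fin n → ℕ} {G : Pn n} (h : IsLead s β G)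
    {a b : Fin n} (hab : a < b) (hc : col s a = col s b) : β a < β b := by
  obtain ⟨δ, h1, h2⟩ := h.split
  rw [h2]; have := al_F2 h.lin hab hc; have := h1 hab.le
  simp only [Pi.add_apply]; omega

lemma IsLead.F1 {n : ℕ} {s : Fin n → ℕ × ℕ} {β : Fin n → ℕ} {G : Pn n} (h : IsLead s β G)
    {a b : Fin n} (hab : a < b) (hc : β a = β b) : col s a < col s b := by
  obtain ⟨δ, h1, h2⟩ := h.split
  rw [h2] at hc; have := al_mono s hab.le; have := h1 hab.le
  simp only [Pi.add_apply] at hc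
  exact al_F1 h.lin a b hab (by omega)

lemma IsLead.inj {n : ℕ} {s : Fin n → ℕ × ℕ} {β : Fin n → ℕ} {G : Pn n} (h : IsLead s β G)
    {a b : Fin n} (hc : col s a = col s b) (hb : β a = β b) : a = b := by
  rcases lt_trichotomy a b with h1 | h1 | h1
  · have := h.strict h1 hc; omega
  · exact h1
  · have := h.strict h1 hc.symm; omega

lemma lead_aux {n : ℕ} {s t : Fin n → ℕ × ℕ} {β : Fin n → ℕ} {G : Pn n} (h : IsLead s β G)
    (g0 : Equiv.Perm (Fin n)) (ht : ∀ i, t i = s (g0 i)) (b : Fin n → ℕ)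
    (σ κ : Equiv.Perm (Fin n)) (hκ : κ ∈ Cg t) (hr : ∀ i, row t i = row s (σ⁻¹ (κ i)))
    (hG : cf (fun i => b (σ i)) G ≠ 0) :
    (∑ i, col t i * b i ≤ ∑ i, col t i * β (g0 i)) ∧
    (∑ i, col t i * b i = ∑ i, col t i * β (g0 i) → ∀ i, b (κ i) = β (g0 i)) := by
  obtain ⟨γ, hγ1, hγ2⟩ := h.supp _ hG
  rw [mem_Cg] at hκ
  set ρ : Equiv.Perm (Fin n) := σ⁻¹ * κ * g0⁻¹ with hρ
  have hb : ∀ i, b i = β (γ (σ⁻¹ i)) := by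
    intro i
    have := hγ1 (σ⁻¹ i)
    simpa using this
  have e1 : ∑ i, col t i * b i = ∑ x, col s x * β ((γ * ρ) x) := by
    rw [← Equiv.sum_comp (κ * g0⁻¹)]
    apply Finset.sum_congr rfl
    intro x _
    rw [Equiv.Perm.mul_apply, hκ, hb]
    congr 1
    rw [col, ht]; simp [col]
  have e2 : ∑ i, col t i * β (g0 i) = ∑ x, col s x * β x := by
    rw [← Equiv.sum_comp g0 (fun x => col s x * β x)]
    apply Finset.sum_congr rfl
    intro x _
    rw [col, ht]; rfl
  have hL := lemma_Phi (r := row s) (f := col s) (α := al s) (β := β) (al_mono s) h.mono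
    (fun i j hij => al_F1 h.lin i j hij) (fun i j hij => h.lin.col_lt hij) (γ * ρ) ρ
    (fun i => by
      have := hr (g0⁻¹ i)
      rw [row, ht] at this
      have e : g0 (g0⁻¹ i) = i := by simp
      rw [e] at this
      exact this.symm)
    (fun i => by rw [Equiv.Perm.mul_apply, hγ2])
  rw [e1, e2]
  refine ⟨hL.1, ?_⟩
  intro he i
  have := hL.2 he (g0 i)
  rw [← this, hb]
  simp [hρ]

lemma lead1 {n : ℕ} {s t : Fin n → ℕ × ℕ} {β : Fin n → ℕ} {G : Pn n} (h : IsLead s β G)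
    (g0 : Equiv.Perm (Fin n)) (ht : ∀ i, t i = s (g0 i)) (b : Fin n → ℕ)
    (hb : cf b (th s G (et t)) ≠ 0) :
    ∃ κ ∈ Cg t, (∑ i, col t i * b i ≤ ∑ i, col t i * β (g0 i)) ∧
    (∑ i, col t i * b i = ∑ i, col t i * β (g0 i) → ∀ i, b (κ i) = β (g0 i)) := by
  rw [cf_th] at hb
  obtain ⟨σ, -, hne⟩ := Finset.exists_ne_zero_of_sum_ne_zero hb
  obtain ⟨κ, hκ, hr⟩ := exists_of_cf_et (left_ne_zero_of_mul hne)
  exact ⟨κ, hκ, lead_aux h g0 ht b σ κ hκ hr (right_ne_zero_of_mul hne)⟩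

lemma lead2 {n : ℕ} {s t : Fin n → ℕ × ℕ} {β : Fin n → ℕ} {G : Pn n} (h : IsLead s β G)
    (g0 : Equiv.Perm (Fin n)) (ht : ∀ i, t i = s (g0 i)) :
    0 < cf (fun i => β (g0 i)) (th s G (et t)) := by
  rw [cf_th]
  apply Finset.sum_pos'
  · intro σ _
    by_cases hG : cf (fun i => β (g0 (σ i))) G = 0
    · rw [hG, mul_zero]
    · apply mul_nonneg _ (h.nonneg _)
      rw [cf_et]
      apply Finset.sum_nonneg
      intro κ hκ
      split_ifs with hr
      · have := (lead_aux h g0 ht (fun i => β (g0 i)) σ κ hκ (fun i => congrFun hr i) hG).2 rfl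
        have hk : κ = 1 := by
          ext1 i
          rw [mem_Cg] at hκ
          have h2 := hκ i
          rw [col, col, ht, ht] at h2
          exact g0.injective (h.inj h2 (this i))
        rw [hk, sg_one]; norm_num
      · simp
  · refine ⟨g0⁻¹, Finset.mem_univ _, ?_⟩
    have e1 : (fun i => row s ((g0⁻¹)⁻¹ i)) = row t := by
      funext i; rw [row, row, ht]; simp
    have e2 : (fun i => β (g0 (g0⁻¹ i))) = β := by funext i; simp
    have hti : Function.Injective t := by
      intro a b hab; rw [ht, ht] at hab; exact g0.injective (h.lin.inj hab)
    rw [e1, e2, cf_row_et hti, one_mul]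
    exact h.pos

/-- distinct standard tableaux give triangular leads -/
lemma lead3 {n : ℕ} {s s' t : Fin n → ℕ × ℕ} {β : Fin n → ℕ} {G G' : Pn n} (h : IsLead s β G)
    (h' : IsLead s' β G')
    (g0 g1 : Equiv.Perm (Fin n)) (ht : ∀ i, t i = s (g0 i)) (ht' : ∀ i, t i = s' (g1 i))
    (hne : cf (fun i => β (g0 i)) (th s' G' (et t)) ≠ 0) :
    (∑ i, col t i * β (g0 i) < ∑ i, col t i * β (g1 i)) ∨ s = s' := by
  obtain ⟨κ, hκ, h1, h2⟩ := lead1 h' g1 ht' _ hne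
  rcases h1.lt_or_eq with h1 | h1
  · left; exact h1
  · right
    have h3 := h2 h1
    have e0 : ∀ x, s x = s' (g1 (g0⁻¹ x)) := by
      intro x; rw [← ht', ht]; simp
    rw [mem_Cg] at hκ
    have hκ0 : ∀ x, col s (g0 (κ (g0⁻¹ x))) = col s x := by
      intro x
      have := hκ (g0⁻¹ x)
      rw [col, col, ht, ht] at this
      simpa [col] using this
    have hmono : ∀ i j, i < j → col s i = col s j → β (g1 (g0⁻¹ i)) ≤ β (g1 (g0⁻¹ j)) := by
      intro i j hij hc
      have hr := h.lin.row_lt hij hc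
      have hc' : col s' (g1 (g0⁻¹ i)) = col s' (g1 (g0⁻¹ j)) := by
        rw [col, col, ← e0, ← e0]; exact hc
      have hlt : g1 (g0⁻¹ i) < g1 (g0⁻¹ j) := h'.lin.lt_of_col hc' (by
        rw [row, row, ← e0, ← e0]; exact hr)
      exact (h'.mono hlt.le)
    have key := sort_uniq (col s) (fun x => β x) (g0 * κ * g0⁻¹)
      (by intro i; simpa using hκ0 i) (fun i j hij _ => h.mono hij.le)
      (by
        intro i j hij hc
        have a1 := h3 (g0⁻¹ i)
        have a2 := h3 (g0⁻¹ j)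
        have := hmono i j hij hc
        simp only [Equiv.Perm.mul_apply]
        rw [a1, a2]; exact this)
    have hU : ∀ i, β (g0 i) = β (g1 i) := by
      intro i
      have := key (g0 i)
      have e : (g0 * κ * g0⁻¹) (g0 i) = g0 (κ i) := by simp
      rw [e] at this
      rw [← this]
      exact h3 i
    have hβ : ∀ x, β ((g1 * g0⁻¹) x) = β x := by
      intro x
      have := hU (g0⁻¹ x)
      simpa using this.symm
    have key2 := sort_uniq β (col s') (g1 * g0⁻¹) hβ
      (fun i j hij hb => (h'.F1 hij hb).le)
      (fun i j hij hb => by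
        have := h.F1 hij hb
        rw [col, col, e0, e0] at this
        exact this.le)
    funext x
    rw [e0]
    congr 1
    exact h'.inj (key2 x) (hβ x)

/-- triangular independence -/
lemma triang {ι M : Type*} [AddCommGroup M] [Module ℚ M] (A : Finset ι) (v : ι → M)
    (l : ι → M →ₗ[ℚ] ℚ) (Φ : ι → ℕ) (h1 : ∀ i ∈ A, l i (v i) ≠ 0)
    (h2 : ∀ i ∈ A, ∀ j ∈ A, l i (v j) ≠ 0 → Φ i < Φ j ∨ i = j) (c : ι → ℚ)
    (h : ∑ i ∈ A, c i • v i = 0) : ∀ i ∈ A, c i = 0 := by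
  by_contra hne
  push Not at hne
  obtain ⟨i0, hi0, hc0⟩ := hne
  obtain ⟨i, hi, hmax⟩ := Finset.exists_max_image (A.filter fun i => c i ≠ 0) Φ
    ⟨i0, by simp [hi0, hc0]⟩
  rw [Finset.mem_filter] at hi
  have := congrArg (l i) h
  rw [map_sum, map_zero, Finset.sum_eq_single_of_mem i hi.1] at this
  · rw [map_smul, smul_eq_mul] at this
    exact (mul_ne_zero hi.2 (h1 i hi.1)) this
  · intro j hj hji
    rw [map_smul, smul_eq_mul]
    by_contra hz
    have hcj := left_ne_zero_of_mul hz
    rcases h2 i hi.1 j hj (right_ne_zero_of_mul hz) with h | h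
    · have := hmax j (by simp [hj, hcj]); omega
    · exact hji h.symm

abbrev St (n : ℕ) := {t : Fin n → ℕ × ℕ // Lin t}

lemma row_bound {n : ℕ} {t : Fin n → ℕ × ℕ} (ht : Fil t) (i : Fin n) : row t i < n := by
  have hex : ∀ r : Fin (row t i + 1), ∃ j, t j = ((r : ℕ), (t i).2) := by
    intro r
    exact ht.low i _ (by have := r.2; simp only [row] at this; simp only; omega) le_rfl
  choose f hf using hex
  have hinj : Function.Injective f := by
    intro a b hab
    have : ((a : ℕ), (t i).2) = ((b : ℕ), (t i).2) := by rw [← hf, ← hf, hab]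
    simp at this; exact Fin.ext this
  have := Fintype.card_le_of_injective f hinj
  simp at this; omega

lemma col_bound {n : ℕ} {t : Fin n → ℕ × ℕ} (ht : Fil t) (i : Fin n) : col t i < n := by
  have hex : ∀ r : Fin (col t i + 1), ∃ j, t j = ((t i).1, (r : ℕ)) := by
    intro r
    exact ht.low i _ le_rfl (by have := r.2; simp only [col] at this; simp only; omega)
  choose f hf using hex
  have hinj : Function.Injective f := by
    intro a b hab
    have : ((t i).1, (a : ℕ)) = ((t i).1, (b : ℕ)) := by rw [← hf, ← hf, hab]
    simp at this; exact Fin.ext this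
  have := Fintype.card_le_of_injective f hinj
  simp at this; omega

instance stFinite (n : ℕ) : Finite (St n) := by
  let F : St n → (Fin n → Fin n × Fin n) := fun t i =>
    (⟨row t.1 i, row_bound t.2.toFil i⟩, ⟨col t.1 i, col_bound t.2.toFil i⟩)
  apply Finite.of_injective F
  intro a b hab
  apply Subtype.ext
  funext i
  have := congrFun hab i
  simp only [F, Prod.mk.injEq, Fin.mk.injEq] at this
  exact Prod.ext this.1 this.2

instance stFintype (n : ℕ) : Fintype (St n) := Fintype.ofFinite _

/-- row counts determine the range -/
lemma range_of_row {n : ℕ} {s t : Fin n → ℕ × ℕ} (hs : Fil s) (ht : Fil t)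
    (ρ : Equiv.Perm (Fin n)) (h : ∀ i, row s i = row t (ρ i)) : Set.range s = Set.range t := by
  have gen : ∀ (s t : Fin n → ℕ × ℕ), Fil s → Fil t → ∀ ρ : Equiv.Perm (Fin n),
      (∀ i, row s i = row t (ρ i)) → Set.range s ⊆ Set.range t := by
    intro s t hs ht ρ h
    rintro _ ⟨i, rfl⟩
    by_contra hno
    have hlt : ∀ j, row t j = row s i → col t j < col s i := by
      intro j hj
      by_contra hle
      push Not at hle
      exact hno (ht.low j (s i) hj.symm.le hle)
    have h1 : (Finset.univ.filter fun j => row t j = row s i).card ≤ col s i := by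
      rw [← Finset.card_range (col s i)]
      apply Finset.card_le_card_of_injOn (col t)
      · intro j hj; simp at hj; simp [hlt j hj]
      · intro j hj k hk hjk
        simp at hj hk
        exact ht.inj (Prod.ext (hj.trans hk.symm) hjk)
    have h2 : (Finset.univ.filter fun j => row s j = row s i).card =
        (Finset.univ.filter fun j => row t j = row s i).card := by
      refine Finset.card_bij (fun j _ => ρ j) ?_ ?_ ?_
      · intro j hj; simp at hj; simp [← h, hj]
      · intro a _ b _ hab; exact ρ.injective hab
      · intro j hj; simp at hj
        exact ⟨ρ⁻¹ j, by simp [h, hj], by simp⟩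
    have hex : ∀ r : Fin (col s i + 1), ∃ j, s j = ((s i).1, (r : ℕ)) := by
      intro r
      exact hs.low i _ le_rfl (by have := r.2; simp only [col] at this; simp only; omega)
    choose f hf using hex
    have h3 : col s i + 1 ≤ (Finset.univ.filter fun j => row s j = row s i).card := by
      rw [← Fintype.card_fin (col s i + 1), ← Finset.card_univ]
      apply Finset.card_le_card_of_injOn f
      · intro r _
        simp only [Finset.coe_filter, Finset.mem_univ, true_and, Set.mem_setOf_eq]
        rw [row, hf]; rfl
      · intro a _ b _ hab
        have : ((s i).1, (a : ℕ)) = ((s i).1, (b : ℕ)) := by rw [← hf, ← hf, hab]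
        simp at this; exact Fin.ext this
    omega
  apply Set.Subset.antisymm (gen s t hs ht ρ h)
  exact gen t s ht hs ρ⁻¹ (fun i => by rw [h]; simp)

lemma th_eq_zero {n : ℕ} {s t : Fin n → ℕ × ℕ} (hs : Fil s) (ht : Fil t)
    (hne : Set.range s ≠ Set.range t) (G : Pn n) : th s G (et t) = 0 := by
  rw [th_apply]
  apply Finset.sum_eq_zero
  intro σ _
  have : cf (fun i => row s (σ⁻¹ i)) (et t) = 0 := by
    by_contra h
    obtain ⟨κ, -, hr⟩ := exists_of_cf_et h
    apply hne
    symm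
    exact range_of_row ht hs (σ⁻¹ * κ) hr
  rw [this, zero_smul]

lemma sum_row_eq {n : ℕ} {t t' : Fin n → ℕ × ℕ} (h : Function.Injective t)
    (h' : Function.Injective t') (hr : Set.range t' = Set.range t) :
    ∑ i, row t' i = ∑ i, row t i := by
  obtain ⟨g, hg⟩ := exists_perm h h' hr
  rw [← Equiv.sum_comp g (row t)]
  exact Finset.sum_congr rfl fun i _ => by rw [row, hg]; rfl

lemma C1' {n : ℕ} {t s : Fin n → ℕ × ℕ} (ht : Fil t) (hs : Function.Injective s) (v : Pn n)
    (hv : v ∈ Specht s) (hle : ∑ i, row s i ≤ ∑ i, row t i) : ∃ c : ℚ, Cm t v = c • et t := by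
  have : v ∈ Submodule.comap (Cm t) (Submodule.span ℚ {et t}) := by
    refine Submodule.span_le.2 ?_ hv
    rintro _ ⟨s', h1, h2, rfl⟩
    show Cm t (Cm s' (mon (row s'))) ∈ Submodule.span ℚ {et t}
    rw [Cm_apply s', map_sum]
    apply Submodule.sum_mem
    intro σ _
    rw [map_smul]
    apply Submodule.smul_mem
    rw [ren_mon, Submodule.mem_span_singleton]
    obtain ⟨c, hc⟩ := C1 ht (fun i => row s' (σ⁻¹ i)) (by
      rw [Equiv.sum_comp σ⁻¹ (row s'), sum_row_eq hs h1 h2]; exact hle)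
    exact ⟨c, hc.symm⟩
  rw [Submodule.mem_comap, Submodule.mem_span_singleton] at this
  obtain ⟨c, hc⟩ := this
  exact ⟨c, hc.symm⟩

lemma C3 {n : ℕ} (β : Fin n → ℕ) (A : Finset (St n)) (G : St n → Pn n)
    (hG : ∀ q ∈ A, IsLead q.1 β (G q)) (v : St n → Pn n) (hv : ∀ q ∈ A, v q ∈ Specht q.1)
    (h : ∑ q ∈ A, th q.1 (G q) (v q) = 0) : ∀ q ∈ A, v q = 0 := by
  by_contra hne
  push Not at hne
  obtain ⟨i0, hi0, hc0⟩ := hne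
  obtain ⟨q, hq, hmax⟩ := Finset.exists_max_image (A.filter fun i => v i ≠ 0)
    (fun q => ∑ i, row q.1 i) ⟨i0, by simp [hi0, hc0]⟩
  rw [Finset.mem_filter] at hq
  apply hq.2
  apply C2 (hv q hq.1)
  intro t ht1 ht2
  have htF : Fil t := q.2.toFil.congr ht1 ht2
  have hex : ∀ q' ∈ A, ∃ c : ℚ, Cm t (v q') = c • et t := by
    intro q' hq'
    by_cases h0 : v q' = 0
    · exact ⟨0, by rw [h0]; simp⟩
    · apply C1' htF q'.2.inj _ (hv q' hq')
      rw [sum_row_eq q.2.inj ht1 ht2]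
      exact hmax q' (by simp [hq', h0])
  choose! c hc using hex
  set A' := A.filter fun q' => Set.range q'.1 = Set.range t with hA'
  have h2 : ∑ q' ∈ A', c q' • th q'.1 (G q') (et t) = 0 := by
    have h3 := congrArg (Cm t) h
    rw [map_sum, map_zero] at h3
    rw [hA', Finset.sum_filter]
    refine Eq.trans ?_ h3
    apply Finset.sum_congr rfl
    intro q' hq'
    rw [← th_Cm, hc q' hq', map_smul]
    split_ifs with hr
    · rfl
    · rw [th_eq_zero q'.2.toFil htF hr, smul_zero]
  have hperm : ∀ q' : St n, ∃ g : Equiv.Perm (Fin n), q' ∈ A' → ∀ i, t i = q'.1 (g i) := by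
    intro q'
    by_cases hq' : q' ∈ A'
    · rw [hA', Finset.mem_filter] at hq'
      obtain ⟨g, hg⟩ := exists_perm q'.2.inj ht1 hq'.2.symm
      exact ⟨g, fun _ => hg⟩
    · exact ⟨1, fun h => absurd h hq'⟩
  choose g hg using hperm
  have hsub : ∀ q' ∈ A', q' ∈ A := fun q' hq' => (Finset.mem_filter.1 hq').1
  have h4 := triang A' (fun q' => th q'.1 (G q') (et t)) (fun q' => cf (fun i => β (g q' i)))
    (fun q' => ∑ i, col t i * β (g q' i))
    (fun q' hq' => (lead2 (hG q' (hsub q' hq')) (g q') (hg q' hq')).ne')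
    (fun q1 h1 q2 h2 hne => by
      rcases lead3 (hG q1 (hsub _ h1)) (hG q2 (hsub _ h2)) (g q1) (g q2) (hg q1 h1) (hg q2 h2) hne
        with h | h
      · left; exact h
      · right; exact Subtype.ext h) c h2 q (by
        rw [hA', Finset.mem_filter]; exact ⟨hq.1, ht2.symm⟩)
  rw [hc q hq.1, h4, zero_smul]

/-- independence of standard polytabloids -/
lemma et_indep {n : ℕ} (A : Finset (St n))
    (c : St n → ℚ) (h : ∑ q ∈ A, c q • et q.1 = 0) : ∀ q ∈ A, c q = 0 := by
  refine triang A (fun q => et q.1) (fun q => cf (row q.1)) (fun q => ∑ i : Fin n, (i : ℕ) * row q.1 i)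
    (fun q _ => by rw [cf_row_et q.2.inj]; exact one_ne_zero) ?_ c h
  intro q _ q' _ hne
  obtain ⟨κ, hκ, hr⟩ := exists_of_cf_et hne
  have hκ' := mem_Cg.1 hκ
  set s := q'.1 with hs
  have hrow : ∀ i, row q.1 i = row s (κ⁻¹ i) := by intro i; rw [hr]; simp
  have hcol : ∀ i, col s (κ⁻¹ i) = col s i := mem_Cg.1 (Cg_inv hκ)
  by_cases hk : κ = 1
  · right
    subst hk
    have hr' : row s = row q.1 := by funext i; exact hr i
    have hrange := range_of_row q.2.toFil q'.2.toFil 1 (fun i => (hr i).symm)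
    obtain ⟨g, hg⟩ := exists_perm q'.2.inj q.2.inj hrange
    apply Subtype.ext
    have hrg : ∀ i, row s (g i) = row s i := by
      intro i
      have h1 : (s (g i)).1 = (q.1 i).1 := by rw [hs, hg]
      exact h1.trans (congrFun hr' i).symm
    have := sort_uniq (row s) (col s) g hrg (fun i j hij h => (q'.2.col_lt hij h).le)
      (fun i j hij h => by
        have := q.2.col_lt hij (by rw [← hr']; exact h)
        rw [col, col, hg, hg] at this
        exact this.le)
    funext i
    rw [hg]
    exact Prod.ext (hrg i) (this i)
  · left
    let f : Fin n → ℕ := fun i => i + n * col s i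
    let w : Fin n → ℕ := fun i => row s i + n * col s i
    have hrb : ∀ i, row s i < n := fun i => row_bound q'.2.toFil i
    have hfw : ∀ i j, f i < f j ↔ w i < w j := by
      intro i j
      have hi := i.2
      have hj := j.2
      have hri := hrb i
      have hrj := hrb j
      simp only [f, w]
      rcases lt_trichotomy (col s i) (col s j) with hc | hc | hc
      · have : n * col s i + n ≤ n * col s j := by nlinarith
        constructor <;> intro _ <;> omega
      · rw [hc]
        constructor
        · intro hlt
          have := q'.2.row_lt (a := i) (b := j) (by rw [Fin.lt_def]; omega) hc
          simp only [hs]; omega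
        · intro hlt
          have := q'.2.lt_of_col (a := i) (b := j) hc (by simp only [hs] at hlt; omega)
          rw [Fin.lt_def] at this; omega
      · have : n * col s j + n ≤ n * col s i := by nlinarith
        constructor <;> intro _ <;> omega
    have hmv : Monovary f w := by
      intro i j hij; exact ((hfw i j).2 hij).le
    have hle := hmv.sum_mul_comp_perm_lt_sum_mul_iff (σ := κ⁻¹)
    have hstrict : ∑ i, f i * w (κ⁻¹ i) < ∑ i, f i * w i := by
      rw [hle]
      intro hmv2
      apply hk
      have hwinj : Function.Injective w := by
        intro i j hij
        by_contra hne
        have h1 : ¬ f i < f j := by rw [hfw]; omega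
        have h2 : ¬ f j < f i := by rw [hfw]; omega
        have hf : f i = f j := by omega
        simp only [f] at hf
        simp only [w] at hij
        have hi := i.2
        have hj := j.2
        have hc : col s i = col s j := by
          rcases lt_trichotomy (col s i) (col s j) with hc | hc | hc
          · have : n * col s i + n ≤ n * col s j := by nlinarith
            omega
          · exact hc
          · have : n * col s j + n ≤ n * col s i := by nlinarith
            omega
        rw [hc] at hf
        exact hne (Fin.ext (by omega))
      have hiff : ∀ i j, w (κ⁻¹ i) < w (κ⁻¹ j) → w i < w j := by
        intro i j hij
        have h1 := hmv2 hij
        rw [← hfw]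
        rcases h1.lt_or_eq with h | h
        · exact h
        · exfalso
          have h3 : ¬ w i < w j := by rw [← hfw]; omega
          have h4 : ¬ w j < w i := by rw [← hfw]; omega
          have : i = j := hwinj (by omega)
          subst this; omega
      have hrank : ∀ i, (Finset.univ.filter fun j => w j < w (κ⁻¹ i)).card ≤
          (Finset.univ.filter fun j => w j < w i).card := by
        intro i
        apply Finset.card_le_card_of_injOn κ
        · intro j hj
          simp only [Finset.coe_filter, Finset.mem_univ, true_and, Set.mem_setOf_eq] at hj ⊢
          apply hiff; simpa using hj
        · intro a _ b _ hab; exact κ.injective hab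
      have hwle : ∀ i, w (κ⁻¹ i) ≤ w i := by
        intro i
        by_contra hlt
        push Not at hlt
        have := hrank i
        have h2 : (Finset.univ.filter fun j => w j < w i).card <
          (Finset.univ.filter fun j => w j < w (κ⁻¹ i)).card := by
          apply Finset.card_lt_card
          rw [Finset.ssubset_iff_of_subset]
          · exact ⟨i, by simpa using hlt, by simp⟩
          · intro x; simp only [Finset.mem_filter, Finset.mem_univ, true_and]; omega
        omega
      have hweq := (Finset.sum_eq_sum_iff_of_le fun i _ => hwle i).1 (Equiv.sum_comp κ⁻¹ w)
      have : κ⁻¹ = 1 := by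
        ext1 i; exact hwinj (hweq i (Finset.mem_univ i))
      simpa using this
    have e1 : ∑ i, f i * w (κ⁻¹ i) = ∑ i : Fin n, (i : ℕ) * row q.1 i + ∑ i, (n * col s i) * row s i
        + ∑ i, f i * (n * col s i) := by
      have : ∑ i, (n * col s i) * row s i = ∑ i, (n * col s i) * row s (κ⁻¹ i) := by
        rw [← Equiv.sum_comp κ⁻¹]; simp only [hcol]
      rw [this, ← Finset.sum_add_distrib, ← Finset.sum_add_distrib]
      apply Finset.sum_congr rfl
      intro i _
      simp only [f, w, hcol, hrow]; ring
    have e2 : ∑ i, f i * w i = ∑ i : Fin n, (i : ℕ) * row s i + ∑ i, (n * col s i) * row s i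
        + ∑ i, f i * (n * col s i) := by
      rw [← Finset.sum_add_distrib, ← Finset.sum_add_distrib]
      apply Finset.sum_congr rfl
      intro i _
      simp only [f, w]; ring
    show ∑ i : Fin n, (i : ℕ) * row q.1 i < ∑ i : Fin n, (i : ℕ) * row s i
    omega

lemma ri_spec (x : ℕ) (r : List ℕ) :
    (∃ a y b, r = a ++ y :: b ∧ (∀ z ∈ a, z ≤ x) ∧ x < y ∧
      rowInsert x r = (a ++ x :: b, some y)) ∨
    ((∀ z ∈ r, z ≤ x) ∧ rowInsert x r = (r ++ [x], none)) := by
  induction r with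
  | nil => right; simp [rowInsert]
  | cons z zs ih =>
    by_cases hz : x < z
    · left; exact ⟨[], z, zs, rfl, by simp, hz, by simp [rowInsert, hz]⟩
    · rcases ih with ⟨a, y, b, h1, h2, h3, h4⟩ | ⟨h1, h2⟩
      · left
        refine ⟨z :: a, y, b, by simp [h1], ?_, h3, by simp [rowInsert, hz, h4]⟩
        intro u hu
        rcases List.mem_cons.1 hu with rfl | hu
        · omega
        · exact h2 u hu
      · right
        refine ⟨?_, by simp [rowInsert, hz, h2]⟩
        intro u hu
        rcases List.mem_cons.1 hu with rfl | hu
        · omega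
        · exact h1 u hu

def Above (r r' : List ℕ) : Prop := ∀ i (_ : i < r'.length), ∃ h' : i < r.length, r[i] < r'[i]

def IsT : List (List ℕ) → Prop
  | [] => True
  | r :: rs => r ≠ [] ∧ r.Pairwise (· ≤ ·) ∧ Above r (rs.headD []) ∧ IsT rs

def newRow : List (List ℕ) → ℕ → ℕ
  | [], _ => 0
  | r :: rs, x => match (rowInsert x r).2 with
    | none => 0
    | some y => newRow rs y + 1

def rl (t : List (List ℕ)) (r : ℕ) : ℕ := (t.getD r []).length

lemma ti_some {x y : ℕ} {r r' : List ℕ} {rs : List (List ℕ)} (h : rowInsert x r = (r', some y)) :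
    tabInsert (r :: rs) x = r' :: tabInsert rs y ∧ newRow (r :: rs) x = newRow rs y + 1 := by
  simp [tabInsert, newRow, h]

lemma ti_none {x : ℕ} {r r' : List ℕ} {rs : List (List ℕ)} (h : rowInsert x r = (r', none)) :
    tabInsert (r :: rs) x = r' :: rs ∧ newRow (r :: rs) x = 0 := by
  simp [tabInsert, newRow, h]

lemma ti_head (rs : List (List ℕ)) (y : ℕ) :
    (tabInsert rs y).headD [] = (rowInsert y (rs.headD [])).1 := by
  cases rs with
  | nil => simp [tabInsert, rowInsert]
  | cons r rs =>
    rcases ri_spec y r with ⟨a, z, b, _, _, _, h⟩ | ⟨_, h⟩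
    · rw [(ti_some h).1]; simp [h]
    · rw [(ti_none h).1]; simp [h]

lemma above_insert {a b r2 : List ℕ} {x y : ℕ} (hs : (a ++ y :: b).Pairwise (· ≤ ·))
    (ha : ∀ z ∈ a, z ≤ x) (hxy : x < y) (hab : Above (a ++ y :: b) r2) :
    Above (a ++ x :: b) (rowInsert y r2).1 := by
  have hle : ∀ i (h : i < (a ++ x :: b).length) (h2 : i < (a ++ y :: b).length),
      (a ++ x :: b)[i] ≤ (a ++ y :: b)[i] := by
    intro i h h2
    rcases lt_trichotomy i a.length with hi | hi | hi
    · rw [List.getElem_append_left hi, List.getElem_append_left hi]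
    · subst hi; simp; omega
    · rw [List.getElem_append_right hi.le, List.getElem_append_right hi.le]
      obtain ⟨k, hk⟩ : ∃ k, i - a.length = k + 1 := ⟨i - a.length - 1, by omega⟩
      simp [hk]
  have hsm : ∀ i (h : i < (a ++ x :: b).length), i ≤ a.length → (a ++ x :: b)[i] < y := by
    intro i h hi
    rcases hi.lt_or_eq with hi | hi
    · rw [List.getElem_append_left hi]
      have := ha _ (List.getElem_mem hi); omega
    · subst hi; simp; exact hxy
  rcases ri_spec y r2 with ⟨a2, y2, b2, h1, h2, h3, h4⟩ | ⟨h1, h2⟩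
  · have hlen : a2.length ≤ a.length := by
      by_contra hlt
      push Not at hlt
      obtain ⟨h', h2z⟩ := hab a.length (by rw [h1]; simp; omega)
      have : r2[a.length]'(by rw [h1]; simp; omega) ≤ y := by
        subst h1
        rw [List.getElem_append_left hlt]
        exact h2 _ (List.getElem_mem hlt)
      simp at h2z
      omega
    rw [h4]
    intro i hi
    simp only [List.length_append, List.length_cons] at hi
    obtain ⟨h', h2z⟩ := hab i (by rw [h1]; simpa using hi)
    have h5 : i < (a ++ x :: b).length := by simpa using h'
    refine ⟨h5, ?_⟩
    rcases lt_trichotomy i a2.length with hj | hj | hj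
    · subst h1
      simp only [List.getElem_append_left hj] at h2z ⊢
      exact (hle i h5 h').trans_lt h2z
    · subst hj
      have := hsm _ h5 hlen
      simpa using this
    · subst h1
      refine (hle i h5 h').trans_lt (h2z.trans_le ?_)
      rw [List.getElem_append_right hj.le, List.getElem_append_right hj.le]
      obtain ⟨k, hk⟩ : ∃ k, i - a2.length = k + 1 := ⟨i - a2.length - 1, by omega⟩
      simp [hk]
  · have hlen : r2.length ≤ a.length := by
      by_contra hlt
      push Not at hlt
      obtain ⟨h', h2z⟩ := hab a.length hlt
      have := h1 _ (List.getElem_mem hlt)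
      simp at h2z
      omega
    rw [h2]
    intro i hi
    simp only [List.length_append, List.length_cons, List.length_nil] at hi
    have h5 : i < (a ++ x :: b).length := by simp; omega
    refine ⟨h5, ?_⟩
    rcases (show i < r2.length ∨ i = r2.length by omega) with hj | hj
    · obtain ⟨h', h2z⟩ := hab i hj
      simp only [List.getElem_append_left hj]
      exact (hle i h5 h').trans_lt h2z
    · subst hj
      have := hsm _ h5 hlen
      simpa using this

lemma isT_insert (t : List (List ℕ)) : ∀ x, IsT t → IsT (tabInsert t x) := by
  induction t with
  | nil => intro x _; simp [tabInsert, IsT, Above]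
  | cons r rs ih =>
    rintro x ⟨h1, h2, h3, h4⟩
    rcases ri_spec x r with ⟨a, y, b, e, ha, hy, h⟩ | ⟨ha, h⟩
    · rw [(ti_some h).1]
      subst e
      refine ⟨by simp, ?_, ?_, ih y h4⟩
      · rw [List.pairwise_append, List.pairwise_cons] at h2 ⊢
        obtain ⟨p1, ⟨p2, p3⟩, p4⟩ := h2
        refine ⟨p1, ⟨fun z hz => ?_, p3⟩, ?_⟩
        · have := p2 z hz; omega
        · intro z hz u hu
          rcases List.mem_cons.1 hu with rfl | hu
          · exact ha z hz
          · exact p4 z hz u (List.mem_cons_of_mem _ hu)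
      · rw [ti_head]; exact above_insert h2 ha hy h3
    · rw [(ti_none h).1]
      refine ⟨by simp, ?_, ?_, h4⟩
      · rw [List.pairwise_append]
        refine ⟨h2, by simp, ?_⟩
        intro z hz u hu
        simp at hu; subst hu; exact ha z hz
      · intro i hi
        obtain ⟨h', h2z⟩ := h3 i hi
        refine ⟨by simp; omega, ?_⟩
        rw [List.getElem_append_left h']; exact h2z

lemma bump_le (t : List (List ℕ)) : ∀ x x', x ≤ x' → IsT t →
    newRow (tabInsert t x) x' ≤ newRow t x := by
  induction t with
  | nil => intro x x' h _; simp [tabInsert, newRow, rowInsert, not_lt.2 h]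
  | cons r rs ih =>
    rintro x x' hx ⟨h1, h2, h3, h4⟩
    rcases ri_spec x r with ⟨a, y, b, e, ha, hy, h⟩ | ⟨ha, h⟩
    · rw [(ti_some h).1, (ti_some h).2]
      rcases ri_spec x' (a ++ x :: b) with ⟨a', y', b', e', ha', hy', h'⟩ | ⟨ha', h'⟩
      · rw [(ti_some h').2]
        have : y ≤ y' := by
          have hm : y' ∈ a ++ x :: b := by rw [e']; simp
          subst e
          rw [List.pairwise_append, List.pairwise_cons] at h2
          rcases List.mem_append.1 hm with hm | hm
          · have := ha y' hm; omega
          · rcases List.mem_cons.1 hm with hm | hm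
            · omega
            · exact h2.2.1.1 y' hm
        have := ih y y' this h4
        omega
      · rw [(ti_none h').2]; omega
    · rw [(ti_none h).1, (ti_none h).2]
      rcases ri_spec x' (r ++ [x]) with ⟨a', y', b', e', ha', hy', h'⟩ | ⟨ha', h'⟩
      · exfalso
        have hm : y' ∈ r ++ [x] := by rw [e']; simp
        rcases List.mem_append.1 hm with hm | hm
        · have := ha y' hm; omega
        · simp at hm; omega
      · rw [(ti_none h').2]

lemma bump_gt (t : List (List ℕ)) : ∀ x x', x' < x → IsT t →
    newRow t x < newRow (tabInsert t x) x' := by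
  induction t with
  | nil => intro x x' h _; simp [tabInsert, newRow, rowInsert, h]
  | cons r rs ih =>
    rintro x x' hx ⟨h1, h2, h3, h4⟩
    rcases ri_spec x r with ⟨a, y, b, e, ha, hy, h⟩ | ⟨ha, h⟩
    · rw [(ti_some h).1, (ti_some h).2]
      rcases ri_spec x' (a ++ x :: b) with ⟨a', y', b', e', ha', hy', h'⟩ | ⟨ha', h'⟩
      · rw [(ti_some h').2]
        have : y' < y := by
          by_cases hm : x ∈ a'
          · have := ha' x hm; omega
          · have hs : (a ++ x :: b).Pairwise (· ≤ ·) := by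
              subst e
              rw [List.pairwise_append, List.pairwise_cons] at h2 ⊢
              obtain ⟨p1, ⟨p2, p3⟩, p4⟩ := h2
              refine ⟨p1, ⟨fun z hz => ?_, p3⟩, ?_⟩
              · have := p2 z hz; omega
              · intro z hz u hu
                rcases List.mem_cons.1 hu with rfl | hu
                · exact ha z hz
                · exact p4 z hz u (List.mem_cons_of_mem _ hu)
            have hmx : x ∈ a ++ x :: b := by simp
            rw [e'] at hs hmx
            rw [List.pairwise_append, List.pairwise_cons] at hs
            rcases List.mem_append.1 hmx with hmx | hmx
            · exact absurd hmx hm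
            · rcases List.mem_cons.1 hmx with hmx | hmx
              · omega
              · have := hs.2.1.1 x hmx; omega
        have := ih y y' this h4
        omega
      · have := ha' x (by simp); omega
    · rw [(ti_none h).1, (ti_none h).2]
      rcases ri_spec x' (r ++ [x]) with ⟨a', y', b', e', ha', hy', h'⟩ | ⟨ha', h'⟩
      · rw [(ti_some h').2]; omega
      · have := ha' x (by simp); omega

lemma ti_ne_nil (t : List (List ℕ)) (x : ℕ) : tabInsert t x ≠ [] := by
  cases t with
  | nil => simp [tabInsert]
  | cons r rs =>
    rcases ri_spec x r with ⟨a, y, b, e, ha, hy, h⟩ | ⟨ha, h⟩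
    · rw [(ti_some h).1]; simp
    · rw [(ti_none h).1]; simp

lemma rev_inj (t : List (List ℕ)) : ∀ t' x x', IsT t → IsT t' → tabInsert t x = tabInsert t' x' →
    newRow t x = newRow t' x' → t = t' ∧ x = x' := by
  induction t with
  | nil =>
    intro t' x x' _ hT he hn
    cases t' with
    | nil => simpa [tabInsert] using he
    | cons r' rs' =>
      exfalso
      rcases ri_spec x' r' with ⟨a, y, b, e, ha, hy, h⟩ | ⟨ha, h⟩
      · rw [(ti_some h).2] at hn; simp [newRow] at hn
      · rw [(ti_none h).1] at he
        simp only [tabInsert, List.cons.injEq] at he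
        have := congrArg List.length he.1
        simp at this
        exact hT.1 this
  | cons r rs ih =>
    intro t' x x' hT hT' he hn
    cases t' with
    | nil =>
      exfalso
      rcases ri_spec x r with ⟨a, y, b, e, ha, hy, h⟩ | ⟨ha, h⟩
      · rw [(ti_some h).2] at hn; simp [newRow] at hn
      · rw [(ti_none h).1] at he
        simp only [tabInsert, List.cons.injEq] at he
        have := congrArg List.length he.1
        simp at this
        exact hT.1 this
    | cons r' rs' =>
      rcases ri_spec x r with ⟨a, y, b, e, ha, hy, h⟩ | ⟨ha, h⟩ <;>
      rcases ri_spec x' r' with ⟨a', y', b', e', ha', hy', h'⟩ | ⟨ha', h'⟩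
      · rw [(ti_some h).1, (ti_some h').1, List.cons.injEq] at he
        rw [(ti_some h).2, (ti_some h').2] at hn
        obtain ⟨e1, e2⟩ := ih rs' y y' hT.2.2.2 hT'.2.2.2 he.2 (by omega)
        subst e1 e2 e e'
        have key : ∀ (a b : List ℕ) (x : ℕ), (∀ z ∈ a, z ≤ x) → x < y →
            (a ++ y :: b).Pairwise (· ≤ ·) →
            (a ++ x :: b).filter (fun z => z < y) = a ++ [x] ∧
            (a ++ x :: b).filter (fun z => ¬ z < y) = b := by
          intro a b x ha hy hp
          rw [List.pairwise_append, List.pairwise_cons] at hp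
          have f1 : a.filter (fun z => z < y) = a := by
            rw [List.filter_eq_self]; intro z hz; have := ha z hz; simp; omega
          have f2 : b.filter (fun z => z < y) = [] := by
            rw [List.filter_eq_nil_iff]; intro z hz; have := hp.2.1.1 z hz; simp; omega
          have f3 : a.filter (fun z => ¬ z < y) = [] := by
            rw [List.filter_eq_nil_iff]; intro z hz; have := ha z hz; simp; omega
          have f4 : b.filter (fun z => ¬ z < y) = b := by
            rw [List.filter_eq_self]; intro z hz; have := hp.2.1.1 z hz; simp; omega
          rw [List.filter_append, List.filter_append, List.filter_cons, List.filter_cons, f1, f2, f3, f4]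
          simp [hy]
        obtain ⟨k1, k2⟩ := key a b x ha hy hT.2.1
        obtain ⟨k3, k4⟩ := key a' b' x' ha' hy' hT'.2.1
        rw [he.1] at k1 k2
        have hb : b = b' := k2.symm.trans k4
        have := List.append_inj' (k1.symm.trans k3) rfl
        simp at this
        obtain ⟨p, q⟩ := this
        subst hb p q
        exact ⟨rfl, rfl⟩
      · rw [(ti_some h).2, (ti_none h').2] at hn; omega
      · rw [(ti_none h).2, (ti_some h').2] at hn; omega
      · rw [(ti_none h).1, (ti_none h').1, List.cons.injEq] at he
        have := List.append_inj' he.1 rfl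
        simp at this
        rw [this.1, this.2, he.2]
        exact ⟨rfl, rfl⟩

lemma ti_perm (t : List (List ℕ)) : ∀ x, (tabInsert t x).flatten.Perm (x :: t.flatten) := by
  induction t with
  | nil => intro x; simp [tabInsert]
  | cons r rs ih =>
    intro x
    rcases ri_spec x r with ⟨a, y, b, e, ha, hy, h⟩ | ⟨ha, h⟩
    · rw [(ti_some h).1]
      subst e
      simp only [List.flatten_cons]
      refine (List.Perm.append_left _ (ih y)).trans ?_
      rw [← Multiset.coe_eq_coe]
      simp only [← Multiset.coe_add, ← Multiset.cons_coe, Multiset.add_cons, Multiset.cons_add]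
      rw [Multiset.cons_swap]
    · rw [(ti_none h).1]
      simp only [List.flatten_cons]
      rw [← Multiset.coe_eq_coe]
      simp only [← Multiset.coe_add, ← Multiset.cons_coe, Multiset.add_cons, Multiset.cons_add]
      simp

lemma rl_nil (r : ℕ) : rl [] r = 0 := by simp [rl]
lemma rl_zero (r : List ℕ) (rs) : rl (r :: rs) 0 = r.length := by simp [rl]
lemma rl_succ (r : List ℕ) (rs) (i : ℕ) : rl (r :: rs) (i + 1) = rl rs i := by simp [rl]

lemma rl_insert (t : List (List ℕ)) : ∀ x i, rl (tabInsert t x) i =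
    rl t i + if i = newRow t x then 1 else 0 := by
  induction t with
  | nil =>
    intro x i
    cases i <;> simp [tabInsert, newRow, rl]
  | cons r rs ih =>
    intro x i
    rcases ri_spec x r with ⟨a, y, b, e, ha, hy, h⟩ | ⟨ha, h⟩
    · rw [(ti_some h).1, (ti_some h).2]
      cases i with
      | zero => simp [rl_zero, e]
      | succ i => rw [rl_succ, rl_succ, ih]; simp
    · rw [(ti_none h).1, (ti_none h).2]
      cases i with
      | zero => simp [rl_zero]
      | succ i => rw [rl_succ, rl_succ]; simp

lemma isT_rl (t : List (List ℕ)) : IsT t → ∀ i, rl t (i + 1) ≤ rl t i := by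
  induction t with
  | nil => intro _ i; simp [rl_nil]
  | cons r rs ih =>
    rintro ⟨h1, h2, h3, h4⟩ i
    cases i with
    | zero =>
      rw [rl_succ, rl_zero]
      by_contra hlt
      push Not at hlt
      cases rs with
      | nil => simp [rl_nil] at hlt
      | cons r' rs' =>
        rw [rl_zero] at hlt
        obtain ⟨h, _⟩ := h3 r.length (by simpa using hlt)
        omega
    | succ i => rw [rl_succ, rl_succ]; exact ih h4 i

lemma isT_row (t : List (List ℕ)) : IsT t → ∀ i c c', c ≤ c' → c' < rl t i →
    listEntry t (i, c) ≤ listEntry t (i, c') := by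
  induction t with
  | nil => intro _ i c c' _ h; simp [rl_nil] at h
  | cons r rs ih =>
    rintro ⟨h1, h2, h3, h4⟩ i c c' hc h
    cases i with
    | zero =>
      rw [rl_zero] at h
      simp only [listEntry, List.getD_cons_zero]
      rw [List.getD_eq_getElem _ _ (by omega), List.getD_eq_getElem _ _ h]
      rcases hc.lt_or_eq with hc | hc
      · exact List.pairwise_iff_getElem.1 h2 c c' _ _ hc
      · subst hc; exact le_rfl
    | succ i =>
      rw [rl_succ] at h
      have := ih h4 i c c' hc h
      simpa [listEntry] using this

lemma isT_col (t : List (List ℕ)) : IsT t → ∀ i c, c < rl t (i + 1) →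
    listEntry t (i, c) < listEntry t (i + 1, c) := by
  induction t with
  | nil => intro _ i c h; simp [rl_nil] at h
  | cons r rs ih =>
    rintro ⟨h1, h2, h3, h4⟩ i c h
    cases i with
    | zero =>
      rw [rl_succ] at h
      cases rs with
      | nil => simp [rl_nil] at h
      | cons r' rs' =>
        rw [rl_zero] at h
        obtain ⟨h', h2z⟩ := h3 c (by simpa using h)
        simp only [listEntry, List.getD_cons_zero, List.getD_cons_succ]
        rw [List.getD_eq_getElem _ _ h', List.getD_eq_getElem _ _ h]
        simpa using h2z
    | succ i =>
      rw [rl_succ] at h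
      have := ih h4 i c h
      simpa [listEntry] using this

def InS (t : List (List ℕ)) (c : ℕ × ℕ) : Prop := c.2 < rl t c.1

lemma InS_low {t : List (List ℕ)} (h : IsT t) {c c' : ℕ × ℕ} (h1 : c.1 ≤ c'.1) (h2 : c.2 ≤ c'.2)
    (hc : InS t c') : InS t c := by
  have : rl t c'.1 ≤ rl t c.1 := antitone_nat_of_succ_le (isT_rl t h) h1
  unfold InS at *; omega

lemma isT_mono {t : List (List ℕ)} (h : IsT t) {c c' : ℕ × ℕ} (h1 : c.1 ≤ c'.1) (h2 : c.2 ≤ c'.2)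
    (hc : InS t c') : listEntry t c ≤ listEntry t c' := by
  obtain ⟨i, j⟩ := c
  obtain ⟨i', j'⟩ := c'
  simp only at h1 h2
  have a1 : listEntry t (i', j) ≤ listEntry t (i', j') := isT_row t h i' j j' h2 hc
  refine le_trans ?_ a1
  have hs : InS t (i', j) := InS_low h (le_refl i') h2 hc
  clear a1 hc
  induction i' with
  | zero => have : i = 0 := by omega
            subst this; exact le_rfl
  | succ m ih =>
    rcases h1.lt_or_eq with hlt | heq
    · exact (ih (by omega) (InS_low h (c' := (m + 1, j)) (Nat.le_succ m) le_rfl hs)).trans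
        (isT_col t h m j hs).le
    · rw [heq]

lemma entry_mem {t : List (List ℕ)} {c : ℕ × ℕ} (h : InS t c) : listEntry t c ∈ t.flatten := by
  unfold InS rl at h
  rw [listEntry, List.getD_eq_getElem _ _ h]
  have h2 : c.1 < t.length := by
    by_contra hh
    rw [List.getD_eq_default _ _ (by omega)] at h
    simp at h
  rw [List.mem_flatten]
  refine ⟨t.getD c.1 [], ?_, List.getElem_mem h⟩
  rw [List.getD_eq_getElem _ _ h2]
  exact List.getElem_mem h2

lemma entry_zero {t : List (List ℕ)} {c : ℕ × ℕ} (h : ¬ InS t c) : listEntry t c = 0 := by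
  unfold InS rl at h
  rw [listEntry, List.getD_eq_default _ _ (by omega)]

lemma mem_entry {t : List (List ℕ)} {v : ℕ} (h : v ∈ t.flatten) : ∃ c, InS t c ∧ listEntry t c = v := by
  rw [List.mem_flatten] at h
  obtain ⟨r, hr, hv⟩ := h
  obtain ⟨i, hi, rfl⟩ := List.getElem_of_mem hr
  obtain ⟨j, hj, rfl⟩ := List.getElem_of_mem hv
  refine ⟨(i, j), ?_, ?_⟩
  · unfold InS rl; rw [List.getD_eq_getElem _ _ hi]; exact hj
  · rw [listEntry]
    simp only
    rw [List.getD_eq_getElem _ _ hi, List.getD_eq_getElem _ _ hj]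

lemma InS_insert (t : List (List ℕ)) (x : ℕ) (c : ℕ × ℕ) :
    InS (tabInsert t x) c ↔ InS t c ∨ c = (newRow t x, rl t (newRow t x)) := by
  obtain ⟨i, j⟩ := c
  simp only [InS, rl_insert, Prod.mk.injEq]
  split_ifs with h
  · subst h; simp only [true_and]; omega
  · simp [h]

def tabOf {n : ℕ} (t : Fin n → ℕ × ℕ) : Tab := fun c =>
  if h : ∃ j, t j = c then (h.choose : ℕ) + 1 else 0

lemma tabOf_apply {n : ℕ} {t : Fin n → ℕ × ℕ} (ht : Function.Injective t) (j : Fin n) :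
    tabOf t (t j) = j + 1 := by
  have h : ∃ i, t i = t j := ⟨j, rfl⟩
  rw [tabOf, dif_pos h, ht h.choose_spec]

lemma tabOf_out {n : ℕ} {t : Fin n → ℕ × ℕ} {c : ℕ × ℕ} (h : c ∉ Set.range t) : tabOf t c = 0 := by
  rw [tabOf, dif_neg]; exact h

lemma tabOf_eq_iff {n : ℕ} {t : Fin n → ℕ × ℕ} (ht : Function.Injective t) (j : Fin n) (c : ℕ × ℕ) :
    tabOf t c = j + 1 ↔ c = t j := by
  constructor
  · intro h
    by_cases hc : c ∈ Set.range t
    · obtain ⟨i, rfl⟩ := hc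
      rw [tabOf_apply ht] at h
      congr 1; apply Fin.ext; omega
    · rw [tabOf_out hc] at h; omega
  · rintro rfl; exact tabOf_apply ht j

lemma rowIdx_tabOf {n : ℕ} {t : Fin n → ℕ × ℕ} (ht : Function.Injective t) (j : Fin n) :
    rowIdx (tabOf t) (j + 1) = (t j).1 := by
  have : {r | ∃ c, tabOf t (r, c) = (j : ℕ) + 1} = {(t j).1} := by
    ext r
    simp only [Set.mem_setOf_eq, Set.mem_singleton_iff, tabOf_eq_iff ht]
    constructor
    · rintro ⟨c, hc⟩; rw [← hc]
    · rintro rfl; exact ⟨(t j).2, rfl⟩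
  rw [rowIdx, this, csInf_singleton]

lemma colIdx_tabOf {n : ℕ} {t : Fin n → ℕ × ℕ} (ht : Function.Injective t) (j : Fin n) :
    colIdx (tabOf t) (j + 1) = (t j).2 := by
  have : {c | tabOf t (rowIdx (tabOf t) (j + 1), c) = (j : ℕ) + 1} = {(t j).2} := by
    ext r
    simp only [Set.mem_setOf_eq, Set.mem_singleton_iff, tabOf_eq_iff ht, rowIdx_tabOf ht]
    constructor
    · intro h; rw [← h]
    · rintro rfl; rfl
  rw [colIdx, this, csInf_singleton]

lemma posOf_tabOf {n : ℕ} {t : Fin n → ℕ × ℕ} (ht : Function.Injective t) (j : Fin n) :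
    posOf (tabOf t) (j + 1) = t j := by
  rw [posOf, rowIdx_tabOf ht, colIdx_tabOf ht]

lemma tabOf_inj {n : ℕ} {t t' : Fin n → ℕ × ℕ} (ht : Function.Injective t)
    (ht' : Function.Injective t') (h : tabOf t = tabOf t') : t = t' := by
  funext j
  rw [← tabOf_eq_iff ht', ← h, tabOf_apply ht]

lemma dsi_tabOf {n : ℕ} {t : Fin n → ℕ × ℕ} (ht : Function.Injective t) :
    DsiSet n (tabOf t) = Dset t := by
  ext j
  simp only [DsiSet, Dset, Finset.mem_filter, Finset.mem_Ioo]
  apply and_congr_right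
  rintro ⟨h1, h2⟩
  have e1 := rowIdx_tabOf ht ⟨j - 1, by omega⟩
  have e2 := rowIdx_tabOf ht ⟨j, h2⟩
  simp only at e1 e2
  rw [show j - 1 + 1 = j by omega] at e1
  rw [e1, e2]
  have f1 := extp_fin t ⟨j - 1, by omega⟩
  have f2 := extp_fin t ⟨j, h2⟩
  simp only at f1 f2
  rw [f1, f2]

lemma filling_tabOf {n : ℕ} {t : Fin n → ℕ × ℕ} (ht : Function.Injective t)
    {cells : Finset (ℕ × ℕ)} (hc : (cells : Set (ℕ × ℕ)) = Set.range t) :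
    IsFillingF cells (tabOf t) ∧ cells.card = n := by
  have hc' : cells = Finset.univ.image t := by
    apply Finset.coe_injective; rw [hc]; simp
  have hcard : cells.card = n := by
    rw [hc', Finset.card_image_of_injective _ ht]; simp
  refine ⟨⟨?_, ?_, ?_, ?_⟩, hcard⟩
  · intro c h; apply tabOf_out; rw [← hc]; exact h
  · rw [hc]; rintro _ ⟨j, rfl⟩; rw [tabOf_apply ht, hcard]
    have := j.2
    exact ⟨by omega, by omega⟩
  · rw [hc]; rintro _ ⟨j, rfl⟩ _ ⟨i, rfl⟩ h
    rw [tabOf_apply ht, tabOf_apply ht] at h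
    congr 1; apply Fin.ext; omega
  · rw [hc, hcard]; rintro v ⟨h1, h2⟩
    exact ⟨t ⟨v - 1, by omega⟩, ⟨_, rfl⟩, by rw [tabOf_apply ht]; simp; omega⟩

lemma exists_seq {n : ℕ} {cells : Finset (ℕ × ℕ)} {T : Tab} (h : IsFillingF cells T)
    (hcard : cells.card = n) : ∃ t : Fin n → ℕ × ℕ, Function.Injective t ∧
      (cells : Set (ℕ × ℕ)) = Set.range t ∧ T = tabOf t := by
  obtain ⟨h1, h2, h3, h4⟩ := h
  have hex : ∀ j : Fin n, ∃ c ∈ (cells : Set (ℕ × ℕ)), T c = j + 1 := by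
    intro j
    have := j.2
    obtain ⟨c, hc, hc'⟩ := h4 (show (j : ℕ) + 1 ∈ Set.Icc 1 cells.card from ⟨by omega, by omega⟩)
    exact ⟨c, hc, hc'⟩
  choose t ht1 ht2 using hex
  have hinj : Function.Injective t := by
    intro a b hab
    have h5 := ht2 a
    rw [hab, ht2 b] at h5
    apply Fin.ext; omega
  have hr : (cells : Set (ℕ × ℕ)) = Set.range t := by
    ext c
    constructor
    · intro hc
      obtain ⟨a1, a2⟩ := h2 hc
      refine ⟨⟨T c - 1, by omega⟩, ?_⟩
      apply h3 (ht1 _) hc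
      rw [ht2]; simp; omega
    · rintro ⟨j, rfl⟩; exact ht1 j
  refine ⟨t, hinj, hr, ?_⟩
  funext c
  by_cases hc : c ∈ Set.range t
  · obtain ⟨j, rfl⟩ := hc
    rw [tabOf_apply hinj, ht2]
  · rw [tabOf_out hc]; apply h1; intro hh; apply hc; rw [← hr]; exact hh

lemma exists_lin {n : ℕ} {μ : YoungDiagram} {T : Tab} (h : IsStandard μ T)
    (hcard : μ.cells.card = n) : ∃ t : Fin n → ℕ × ℕ, Lin t ∧
      (μ.cells : Set (ℕ × ℕ)) = Set.range t ∧ T = tabOf t := by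
  obtain ⟨t, h1, h2, h3⟩ := exists_seq h.1 hcard
  have hm : ∀ i, t i ∈ μ.cells := by
    intro i
    rw [← Finset.mem_coe, h2]; exact ⟨i, rfl⟩
  refine ⟨t, ⟨⟨h1, ?_⟩, ?_⟩, h2, h3⟩
  · intro i c hc1 hc2
    have : c ∈ (μ.cells : Set (ℕ × ℕ)) := μ.isLowerSet (a := t i) (Prod.mk_le_mk.2 ⟨hc1, hc2⟩ : c ≤ t i) (hm i)
    rw [h2] at this
    exact this
  · intro i j hr hc
    by_contra hlt
    have hne : t i ≠ t j := by intro he; apply hlt; rw [h1 he]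
    have := h.2 _ (hm i) _ (hm j) hne hr hc
    rw [h3, tabOf_apply h1, tabOf_apply h1] at this
    apply hlt; rw [Fin.le_def]; omega

def ydOf {n : ℕ} {t : Fin n → ℕ × ℕ} (ht : Fil t) : YoungDiagram where
  cells := Finset.univ.image t
  isLowerSet := by
    intro a b hba ha
    simp only [Finset.coe_image, Finset.coe_univ, Set.image_univ] at ha ⊢
    obtain ⟨i, rfl⟩ := ha
    exact ht.low i b hba.1 hba.2

lemma ydOf_cells {n : ℕ} {t : Fin n → ℕ × ℕ} (ht : Fil t) :
    ((ydOf ht).cells : Set (ℕ × ℕ)) = Set.range t := by simp [ydOf]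

lemma std_tabOf {n : ℕ} {t : Fin n → ℕ × ℕ} (ht : Lin t) {μ : YoungDiagram}
    (hc : (μ.cells : Set (ℕ × ℕ)) = Set.range t) : IsStandard μ (tabOf t) := by
  refine ⟨(filling_tabOf ht.inj hc).1, ?_⟩
  intro c1 h1 c2 h2 hne hr hcol
  rw [← Finset.mem_coe, hc] at h1 h2
  obtain ⟨i, rfl⟩ := h1
  obtain ⟨j, rfl⟩ := h2
  rw [tabOf_apply ht.inj, tabOf_apply ht.inj]
  have := ht.std i j hr hcol
  have h3 : i ≠ j := fun h => hne (by rw [h])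
  have := lt_of_le_of_ne this h3
  rw [Fin.lt_def] at this; omega

/-! RSK summary -/

lemma suppIn_mem {n : ℕ} {w : Equiv.Perm ℕ} (h : SuppIn n w) {i : ℕ} (hi : 1 ≤ i ∧ i ≤ n) :
    1 ≤ w i ∧ w i ≤ n := by
  by_contra hno
  have : w i = 0 ∨ n < w i := by omega
  have h2 := h _ this
  have := w.injective h2
  omega

lemma PL_zero (n : ℕ) (w : Equiv.Perm ℕ) : PtabListPart n w 0 = [] := by simp [PtabListPart]

lemma PL_succ {n : ℕ} (w : Equiv.Perm ℕ) {m : ℕ} (hm : m < n) :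
    PtabListPart n w (m + 1) = tabInsert (PtabListPart n w m) (w (m + 1)) := by
  have hl : (oneLine n w).length = n := by simp [oneLine]
  rw [PtabListPart, PtabListPart, List.take_succ_eq_append_getElem (by omega), List.foldl_append]
  simp [oneLine]

lemma PL_ge {n : ℕ} (w : Equiv.Perm ℕ) {m : ℕ} (hm : n ≤ m) :
    PtabListPart n w m = PtabListPart n w n := by
  have hl : (oneLine n w).length = n := by simp [oneLine]
  rw [PtabListPart, PtabListPart, List.take_of_length_le (by omega), List.take_of_length_le (by omega)]

lemma PL_isT {n : ℕ} (w : Equiv.Perm ℕ) (m : ℕ) (hm : m ≤ n) : IsT (PtabListPart n w m) := by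
  induction m with
  | zero => rw [PL_zero]; trivial
  | succ m ih => rw [PL_succ w (by omega)]; exact isT_insert _ _ (ih (by omega))

lemma PL_mem {n : ℕ} (w : Equiv.Perm ℕ) (m : ℕ) (hm : m ≤ n) (v : ℕ) :
    v ∈ (PtabListPart n w m).flatten ↔ ∃ i, 1 ≤ i ∧ i ≤ m ∧ w i = v := by
  induction m with
  | zero => rw [PL_zero]; simp
  | succ m ih =>
    rw [PL_succ w (by omega), (ti_perm _ _).mem_iff, List.mem_cons, ih (by omega)]
    constructor
    · rintro (rfl | ⟨i, h1, h2, h3⟩)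
      · exact ⟨m + 1, by omega, le_rfl, rfl⟩
      · exact ⟨i, h1, by omega, h3⟩
    · rintro ⟨i, h1, h2, h3⟩
      rcases (show i ≤ m ∨ i = m + 1 by omega) with h | rfl
      · right; exact ⟨i, h1, h, h3⟩
      · left; exact h3.symm

def qcell (n : ℕ) (w : Equiv.Perm ℕ) (m : ℕ) : ℕ × ℕ :=
  (newRow (PtabListPart n w m) (w (m + 1)),
    rl (PtabListPart n w m) (newRow (PtabListPart n w m) (w (m + 1))))

lemma PL_InS {n : ℕ} (w : Equiv.Perm ℕ) (m : ℕ) (hm : m ≤ n) (c : ℕ × ℕ) :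
    InS (PtabListPart n w m) c ↔ ∃ j < m, c = qcell n w j := by
  induction m with
  | zero => rw [PL_zero]; simp [InS, rl_nil]
  | succ m ih =>
    rw [PL_succ w (by omega), InS_insert, ih (by omega)]
    constructor
    · rintro (⟨j, h1, h2⟩ | h)
      · exact ⟨j, by omega, h2⟩
      · exact ⟨m, by omega, h⟩
    · rintro ⟨j, h1, h2⟩
      rcases (show j < m ∨ j = m by omega) with h | rfl
      · left; exact ⟨j, h, h2⟩
      · right; exact h2

lemma qcell_notin {n : ℕ} (w : Equiv.Perm ℕ) (m : ℕ) : ¬ InS (PtabListPart n w m) (qcell n w m) := by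
  simp [InS, qcell]

lemma qcell_inj {n : ℕ} (w : Equiv.Perm ℕ) {i j : ℕ} (hij : i < j) (hj : j ≤ n) :
    qcell n w i ≠ qcell n w j := by
  intro h
  exact qcell_notin w j ((PL_InS w j hj _).2 ⟨i, hij, h.symm⟩)

def qseq (n : ℕ) (w : Equiv.Perm ℕ) : Fin n → ℕ × ℕ := fun i => qcell n w i

lemma qseq_lin (n : ℕ) (w : Equiv.Perm ℕ) : Lin (qseq n w) := by
  refine ⟨⟨?_, ?_⟩, ?_⟩
  · intro i j h
    rcases lt_trichotomy i j with h1 | h1 | h1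
    · exact absurd h (qcell_inj w h1 j.2.le)
    · exact h1
    · exact absurd h.symm (qcell_inj w h1 i.2.le)
  · intro i c h1 h2
    have := InS_low (PL_isT w n le_rfl) h1 h2 ((PL_InS w n le_rfl _).2 ⟨i, i.2, rfl⟩)
    obtain ⟨j, hj, rfl⟩ := (PL_InS w n le_rfl _).1 this
    exact ⟨⟨j, hj⟩, rfl⟩
  · intro i j h1 h2
    by_contra hlt
    push Not at hlt
    exact qcell_notin w i (InS_low (PL_isT w i i.2.le) h1 h2
      ((PL_InS w i i.2.le _).2 ⟨j, hlt, rfl⟩))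

lemma Qtab_eq {n : ℕ} {w : Equiv.Perm ℕ} (hw : SuppIn n w) : Qtab n w = tabOf (qseq n w) := by
  have hent : ∀ m, m ≤ n → ∀ c, listEntry (PtabListPart n w m) c ≠ 0 ↔ ∃ j < m, c = qcell n w j := by
    intro m hm c
    rw [← PL_InS w m hm]
    constructor
    · intro h; by_contra hno; exact h (entry_zero hno)
    · intro h
      obtain ⟨i, h1, h2, h3⟩ := (PL_mem w m hm _).1 (entry_mem h)
      have := suppIn_mem hw (i := i) ⟨h1, by omega⟩
      omega
  have hent' : ∀ m c, listEntry (PtabListPart n w m) c ≠ 0 ↔ ∃ j < m, j < n ∧ c = qcell n w j := by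
    intro m c
    rcases le_total m n with h | h
    · rw [hent m h]
      constructor
      · rintro ⟨j, h1, h2⟩; exact ⟨j, h1, by omega, h2⟩
      · rintro ⟨j, h1, _, h2⟩; exact ⟨j, h1, h2⟩
    · rw [PL_ge w h, hent n le_rfl]
      constructor
      · rintro ⟨j, h1, h2⟩; exact ⟨j, by omega, h1, h2⟩
      · rintro ⟨j, _, h1, h2⟩; exact ⟨j, h1, h2⟩
  funext c
  by_cases hc : c ∈ Set.range (qseq n w)
  · obtain ⟨j, rfl⟩ := hc
    rw [tabOf_apply (qseq_lin n w).inj]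
    apply le_antisymm
    · apply Nat.sInf_le
      exact (hent' _ _).2 ⟨j, by omega, j.2, rfl⟩
    · apply le_csInf
      · exact ⟨j + 1, (hent' _ _).2 ⟨j, by omega, j.2, rfl⟩⟩
      · intro m hm
        obtain ⟨i, h1, h2, h3⟩ := (hent' _ _).1 hm
        have : j = ⟨i, h2⟩ := (qseq_lin n w).inj h3
        subst this
        simp; omega
  · rw [tabOf_out hc]
    have : {m | listEntry (PtabListPart n w m) c ≠ 0} = ∅ := by
      ext m
      simp only [Set.mem_setOf_eq, Set.mem_empty_iff_false, iff_false]
      rw [hent']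
      rintro ⟨j, h1, h2, h3⟩
      exact hc ⟨⟨j, h2⟩, h3.symm⟩
    rw [Qtab, this, Nat.sInf_empty]

lemma Ptab_eq {n : ℕ} {w : Equiv.Perm ℕ} (hw : SuppIn n w) :
    ∃ p : Fin n → ℕ × ℕ, Lin p ∧ Set.range p = Set.range (qseq n w) ∧ Ptab n w = tabOf p := by
  set t := PtabListPart n w n with ht
  have hT : IsT t := PL_isT w n le_rfl
  have hin : ∀ i, InS t (qseq n w i) := fun i => (PL_InS w n le_rfl _).2 ⟨i, i.2, rfl⟩
  have hsurj : ∀ v : Fin n, ∃ j, listEntry t (qseq n w j) = v + 1 := by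
    intro v
    have hv := v.2
    have hm : (v : ℕ) + 1 ∈ t.flatten := by
      rw [ht, PL_mem w n le_rfl]
      have hs : SuppIn n w⁻¹ := by
        intro i hi
        rw [Equiv.Perm.inv_eq_iff_eq]; exact (hw i hi).symm
      have := suppIn_mem hs (i := v + 1) ⟨by omega, by omega⟩
      exact ⟨w⁻¹ (v + 1), this.1, this.2, by simp⟩
    obtain ⟨c, h1, h2⟩ := mem_entry hm
    obtain ⟨j, hj, rfl⟩ := (PL_InS w n le_rfl _).1 h1
    exact ⟨⟨j, hj⟩, h2⟩
  choose f hf using hsurj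
  have finj : Function.Injective f := by
    intro a b hab
    have := hf a
    rw [hab, hf b] at this
    apply Fin.ext; omega
  have fbij := Finite.injective_iff_bijective.1 finj
  have hr : Set.range (fun i => qseq n w (f i)) = Set.range (qseq n w) :=
    fbij.2.range_comp (qseq n w)
  have hinj : Function.Injective (fun i => qseq n w (f i)) := (qseq_lin n w).inj.comp finj
  have hF := (qseq_lin n w).toFil.congr hinj hr
  refine ⟨fun i => qseq n w (f i), ⟨hF, ?_⟩, hr, ?_⟩
  · intro i j h1 h2
    have := isT_mono hT h1 h2 (hin _)
    rw [hf, hf] at this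
    rw [Fin.le_def]; omega
  · funext c
    by_cases hc : c ∈ Set.range (fun i => qseq n w (f i))
    · obtain ⟨j, rfl⟩ := hc
      rw [tabOf_apply hinj j]
      exact hf j
    · rw [tabOf_out hc]
      apply entry_zero
      intro hI
      obtain ⟨j, hj, rfl⟩ := (PL_InS w n le_rfl _).1 hI
      rw [hr] at hc
      exact hc ⟨⟨j, hj⟩, rfl⟩

lemma dset_qseq {n : ℕ} {w : Equiv.Perm ℕ} : Dset (qseq n w) = DslSet n w := by
  ext j
  simp only [DslSet, Dset, Finset.mem_filter, Finset.mem_Ioo]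
  apply and_congr_right
  rintro ⟨h1, h2⟩
  obtain ⟨i, rfl⟩ : ∃ i, j = i + 1 := ⟨j - 1, by omega⟩
  have f1 := extp_fin (qseq n w) ⟨i, by omega⟩
  have f2 := extp_fin (qseq n w) ⟨i + 1, h2⟩
  simp only at f1 f2
  rw [Nat.add_sub_cancel, f1, f2]
  simp only [qseq, qcell, PL_succ w (show i < n by omega)]
  have hT := PL_isT w i (show i ≤ n by omega)
  constructor
  · intro h
    by_contra hno
    have := bump_le _ (w (i + 1)) (w (i + 1 + 1)) (by omega) hT
    omega
  · intro h
    exact bump_gt _ _ _ h hT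

lemma InS_ext {t t' : List (List ℕ)} (h : IsT t) (h' : IsT t')
    (he : ∀ c, listEntry t c = listEntry t' c) (hs : ∀ c, InS t c ↔ InS t' c) : t = t' := by
  have hrl : ∀ i, rl t i = rl t' i := by
    intro i
    apply le_antisymm
    · by_contra hlt
      have := (hs (i, rl t' i)).1 (by simp [InS]; omega)
      simp [InS] at this
    · by_contra hlt
      have := (hs (i, rl t i)).2 (by simp [InS]; omega)
      simp [InS] at this
  have hrow : ∀ i, t.getD i [] = t'.getD i [] := by
    intro i
    apply List.ext_getElem (hrl i)
    intro j h1 h2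
    have := he (i, j)
    simp only [listEntry] at this
    rwa [List.getD_eq_getElem _ _ h1, List.getD_eq_getElem _ _ h2] at this
  have hne : ∀ t : List (List ℕ), IsT t → ∀ i (h : i < t.length), t[i] ≠ [] := by
    intro t
    induction t with
    | nil => intro _ i h; simp at h
    | cons r rs ih =>
      rintro ⟨a1, a2, a3, a4⟩ i h
      cases i with
      | zero => simpa using a1
      | succ i => simpa using ih a4 i (by simpa using h)
  have hlen : t.length = t'.length := by
    rcases lt_trichotomy t.length t'.length with hl | hl | hl
    · exfalso
      have := hrow t.length
      rw [List.getD_eq_default _ _ le_rfl, List.getD_eq_getElem _ _ hl] at this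
      exact hne t' h' _ hl this.symm
    · exact hl
    · exfalso
      have := hrow t'.length
      rw [List.getD_eq_default t' _ le_rfl, List.getD_eq_getElem _ _ hl] at this
      exact hne t h _ hl this
  apply List.ext_getElem hlen
  intro i h1 h2
  have := hrow i
  rwa [List.getD_eq_getElem _ _ h1, List.getD_eq_getElem _ _ h2] at this

lemma rsk_inj {n : ℕ} {w w' : Equiv.Perm ℕ} (hw : SuppIn n w) (hw' : SuppIn n w')
    (hP : Ptab n w = Ptab n w') (hQ : Qtab n w = Qtab n w') : w = w' := by
  rw [Qtab_eq hw, Qtab_eq hw'] at hQ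
  have hq := tabOf_inj (qseq_lin n w).inj (qseq_lin n w').inj hQ
  have hqc : ∀ m, m < n → qcell n w m = qcell n w' m := fun m hm => congrFun hq ⟨m, hm⟩
  have key : ∀ d m, m + d = n → PtabListPart n w m = PtabListPart n w' m ∧
      ∀ i, m < i → i ≤ n → w i = w' i := by
    intro d
    induction d with
    | zero =>
      intro m hm
      have : m = n := by omega
      subst this
      refine ⟨InS_ext (PL_isT w m le_rfl) (PL_isT w' m le_rfl) (fun c => congrFun hP c) ?_, ?_⟩
      · intro c
        rw [PL_InS w m le_rfl, PL_InS w' m le_rfl]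
        constructor
        · rintro ⟨j, h1, h2⟩; exact ⟨j, h1, by rw [h2, hqc j h1]⟩
        · rintro ⟨j, h1, h2⟩; exact ⟨j, h1, by rw [h2, hqc j h1]⟩
      · intro i h1 h2; omega
    | succ d ih =>
      intro m hm
      obtain ⟨h1, h2⟩ := ih (m + 1) (by omega)
      rw [PL_succ w (by omega), PL_succ w' (by omega)] at h1
      have h3 := congrArg Prod.fst (hqc m (by omega))
      obtain ⟨h4, h5⟩ := rev_inj _ _ _ _ (PL_isT w m (by omega)) (PL_isT w' m (by omega)) h1 h3
      refine ⟨h4, ?_⟩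
      intro i hi1 hi2
      rcases (show i = m + 1 ∨ m + 1 < i by omega) with rfl | h
      · exact h5
      · exact h2 i h hi2
  ext i
  rcases (show (i = 0 ∨ n < i) ∨ (0 < i ∧ i ≤ n) by omega) with h | h
  · rw [hw i h, hw' i h]
  · exact (key n 0 (by omega)).2 i h.1 h.2

structure LinN (m : ℕ) (p : ℕ → ℕ × ℕ) : Prop where
  inj : ∀ i j, i < m → j < m → p i = p j → i = j
  low : ∀ i c, i < m → c.1 ≤ (p i).1 → c.2 ≤ (p i).2 → ∃ j < m, p j = c
  std : ∀ i j, i < m → j < m → (p i).1 ≤ (p j).1 → (p i).2 ≤ (p j).2 → i ≤ j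

def cmp (x y : ℕ × ℕ) : Prop := x.1 ≤ y.1 ∧ x.2 ≤ y.2

def tg (i : ℕ) (p : ℕ → ℕ × ℕ) : ℕ → ℕ × ℕ :=
  if cmp (p i) (p (i + 1)) then p else fun j => p (Equiv.swap i (i + 1) j)

lemma tg_pos {i : ℕ} {p : ℕ → ℕ × ℕ} (h : cmp (p i) (p (i + 1))) : tg i p = p := if_pos h
lemma tg_neg {i : ℕ} {p : ℕ → ℕ × ℕ} (h : ¬ cmp (p i) (p (i + 1))) :
    tg i p = fun j => p (Equiv.swap i (i + 1) j) := if_neg h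
lemma tg_neg_l {i : ℕ} {p : ℕ → ℕ × ℕ} (h : ¬ cmp (p i) (p (i + 1))) : tg i p i = p (i + 1) := by
  rw [tg_neg h]; simp
lemma tg_neg_r {i : ℕ} {p : ℕ → ℕ × ℕ} (h : ¬ cmp (p i) (p (i + 1))) : tg i p (i + 1) = p i := by
  rw [tg_neg h]; simp
lemma tg_ne {i j : ℕ} (p : ℕ → ℕ × ℕ) (h1 : j ≠ i) (h2 : j ≠ i + 1) : tg i p j = p j := by
  unfold tg
  split_ifs
  · rfl
  · simp only; rw [Equiv.swap_apply_of_ne_of_ne h1 h2]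

lemma LinN.ncmp {m : ℕ} {p : ℕ → ℕ × ℕ} (h : LinN m p) {i j : ℕ} (hij : i < j) (hj : j < m) :
    ¬ cmp (p j) (p i) := by
  rintro ⟨h1, h2⟩
  have := h.std j i hj (by omega) h1 h2
  omega

lemma swap_lt {i m j : ℕ} (hi : i + 1 < m) (hj : j < m) : Equiv.swap i (i + 1) j < m := by
  rw [Equiv.swap_apply_def]; split_ifs <;> omega

lemma LinN.tg {m : ℕ} {p : ℕ → ℕ × ℕ} (h : LinN m p) {i : ℕ} (hi : i + 1 < m) :
    LinN m (tg i p) := by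
  by_cases hc : cmp (p i) (p (i + 1))
  · rw [tg_pos hc]; exact h
  · rw [tg_neg hc]
    refine ⟨?_, ?_, ?_⟩
    · intro a b ha hb hab
      have := h.inj _ _ (swap_lt hi ha) (swap_lt hi hb) hab
      exact (Equiv.swap i (i + 1)).injective this
    · intro a c ha h1 h2
      obtain ⟨j, hj, rfl⟩ := h.low _ c (swap_lt hi ha) h1 h2
      exact ⟨Equiv.swap i (i + 1) j, swap_lt hi hj, by simp⟩
    · intro a b ha hb h1 h2
      have h3 := h.std _ _ (swap_lt hi ha) (swap_lt hi hb) h1 h2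
      have hcc := h.ncmp (Nat.lt_succ_self i) hi
      by_cases he : a = b
      · omega
      · have h4 : Equiv.swap i (i + 1) a ≠ Equiv.swap i (i + 1) b :=
          fun hh => he ((Equiv.swap i (i + 1)).injective hh)
        by_cases hsp : Equiv.swap i (i + 1) a = i ∧ Equiv.swap i (i + 1) b = i + 1
        · exfalso
          rw [hsp.1, hsp.2] at h1 h2
          exact hc ⟨h1, h2⟩
        · clear h1 h2
          rw [Equiv.swap_apply_def, Equiv.swap_apply_def] at *
          split_ifs at * <;> omega

lemma tg_inj {m : ℕ} {p q : ℕ → ℕ × ℕ} (h : LinN m p) (h' : LinN m q) {i : ℕ} (hi : i + 1 < m)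
    (he : tg i p = tg i q) : p = q := by
  have key : ∀ p, LinN m p → tg i (tg i p) = p := by
    intro p h
    by_cases hc : cmp (p i) (p (i + 1))
    · rw [tg_pos hc, tg_pos hc]
    · have : ¬ cmp (tg i p i) (tg i p (i + 1)) := by
        rw [tg_neg_l hc, tg_neg_r hc]; exact h.ncmp (Nat.lt_succ_self i) hi
      rw [tg_neg this, tg_neg hc]
      simp
  rw [← key p h, ← key q h', he]

lemma tg_comm {i j : ℕ} (hij : i + 2 ≤ j) (p : ℕ → ℕ × ℕ) : tg i (tg j p) = tg j (tg i p) := by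
  have e1 : tg j p i = p i := tg_ne p (by omega) (by omega)
  have e2 : tg j p (i + 1) = p (i + 1) := tg_ne p (by omega) (by omega)
  have e3 : tg i p j = p j := tg_ne p (by omega) (by omega)
  have e4 : tg i p (j + 1) = p (j + 1) := tg_ne p (by omega) (by omega)
  by_cases h1 : cmp (p i) (p (i + 1)) <;> by_cases h2 : cmp (p j) (p (j + 1))
  · rw [tg_pos h2, tg_pos h1, tg_pos h2]
  · rw [tg_pos (i := i) (by rw [e1, e2]; exact h1), tg_pos h1]
  · rw [tg_pos h2, tg_pos (i := j) (p := tg i p) (by rw [e3, e4]; exact h2)]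
  · rw [tg_neg (i := i) (p := tg j p) (by rw [e1, e2]; exact h1),
      tg_neg (i := j) (p := tg i p) (by rw [e3, e4]; exact h2), tg_neg h1, tg_neg h2]
    funext k
    simp only
    congr 1
    simp only [Equiv.swap_apply_def]
    split_ifs <;> omega

lemma LinN.adj {m : ℕ} {p : ℕ → ℕ × ℕ} (h : LinN m p) {i : ℕ} (hi : i + 1 < m)
    (hc : cmp (p i) (p (i + 1))) : p (i + 1) = ((p i).1, (p i).2 + 1) ∨
      p (i + 1) = ((p i).1 + 1, (p i).2) := by
  have hne : p i ≠ p (i + 1) := fun he => by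
    have := h.inj _ _ (by omega) hi he; omega
  have key : ∀ c : ℕ × ℕ, c ≠ p i → cmp (p i) c → cmp c (p (i + 1)) → p (i + 1) = c := by
    intro c h1 h2 h3
    obtain ⟨j, hj, rfl⟩ := h.low (i + 1) c hi h3.1 h3.2
    have a1 := h.std i j (by omega) hj h2.1 h2.2
    have a2 := h.std j (i + 1) hj hi h3.1 h3.2
    have a3 : j ≠ i := fun he => h1 (by rw [he])
    have : j = i + 1 := by omega
    rw [this]
  by_cases hr : (p i).1 < (p (i + 1)).1
  · right
    apply key
    · intro he; have := congrArg Prod.fst he; simp at this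
    · simp [cmp]
    · exact ⟨hr, hc.2⟩
  · left
    apply key
    · intro he; have := congrArg Prod.snd he; simp at this
    · simp [cmp]
    · refine ⟨hc.1, ?_⟩
      by_contra hcc
      apply hne
      have := hc.1
      have := hc.2
      apply Prod.ext <;> simp at * <;> omega

lemma LinN.tri {m : ℕ} {p : ℕ → ℕ × ℕ} (h : LinN m p) {i : ℕ} (hi : i + 2 < m)
    (hc : cmp (p i) (p (i + 1))) (hc' : cmp (p (i + 1)) (p (i + 2))) :
    ((p i).1 < (p (i + 1)).1 ↔ (p (i + 1)).1 < (p (i + 2)).1) := by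
  have key : ∀ c : ℕ × ℕ, c ≠ p i → c ≠ p (i + 1) → c ≠ p (i + 2) → cmp (p i) c →
      cmp c (p (i + 2)) → False := by
    intro c h0 h1 h2 h3 h4
    obtain ⟨j, hj, rfl⟩ := h.low (i + 2) c hi h4.1 h4.2
    have a1 := h.std i j (by omega) hj h3.1 h3.2
    have a2 := h.std j (i + 2) hj hi h4.1 h4.2
    rcases (show j = i ∨ j = i + 1 ∨ j = i + 2 by omega) with rfl | rfl | rfl
    · exact h0 rfl
    · exact h1 rfl
    · exact h2 rfl
  rcases h.adj (by omega) hc with h1 | h1 <;> rcases h.adj (i := i + 1) (by omega) hc' with h2 | h2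
  · simp only [show i + 1 + 1 = i + 2 from rfl] at h2; rw [h2, h1]
  · exfalso
    simp only [show i + 1 + 1 = i + 2 from rfl] at h2
    apply key ((p i).1 + 1, (p i).2)
    all_goals
      have e1 := congrArg Prod.fst h1
      have e2 := congrArg Prod.snd h1
      have e3 := congrArg Prod.fst h2
      have e4 := congrArg Prod.snd h2
      clear h1 h2 key
      simp only at e1 e2 e3 e4
      first
        | (intro he
           have e5 := congrArg Prod.fst he
           have e6 := congrArg Prod.snd he
           simp only at e5 e6
           omega)
        | (constructor <;> simp only [] <;> omega)
  · exfalso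
    simp only [show i + 1 + 1 = i + 2 from rfl] at h2
    apply key ((p i).1, (p i).2 + 1)
    all_goals
      have e1 := congrArg Prod.fst h1
      have e2 := congrArg Prod.snd h1
      have e3 := congrArg Prod.fst h2
      have e4 := congrArg Prod.snd h2
      clear h1 h2 key
      simp only at e1 e2 e3 e4
      first
        | (intro he
           have e5 := congrArg Prod.fst he
           have e6 := congrArg Prod.snd he
           simp only at e5 e6
           omega)
        | (constructor <;> simp only [] <;> omega)
  · simp only [show i + 1 + 1 = i + 2 from rfl] at h2; rw [h2, h1]; simp

def dsc (p : ℕ → ℕ × ℕ) (j : ℕ) : Prop := (p j).1 < (p (j + 1)).1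

lemma LinN.adj' {m : ℕ} {p : ℕ → ℕ × ℕ} (h : LinN m p) {i : ℕ} (hi : i + 1 < m)
    (hc : cmp (p i) (p (i + 1))) :
    (p i).1 ≤ (p (i + 1)).1 ∧ (p (i + 1)).1 ≤ (p i).1 + 1 := by
  rcases h.adj hi hc with h1 | h1 <;> rw [h1] <;> simp

lemma LinN.inc {m : ℕ} {p : ℕ → ℕ × ℕ} (h : LinN m p) {i : ℕ} (hi : i + 1 < m)
    (hc : ¬ cmp (p i) (p (i + 1))) : (p i).1 ≠ (p (i + 1)).1 := by
  have := h.ncmp (Nat.lt_succ_self i) hi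
  simp only [cmp, Nat.succ_eq_add_one] at *
  omega

lemma three1 {m : ℕ} {r : ℕ → ℕ × ℕ} (h : LinN m r) {i : ℕ} (hi : i + 2 < m) :
    dsc (tg (i + 1) (tg i r)) i ↔ dsc r (i + 1) := by
  have hT := h.tg (i := i) (by omega)
  have z1 : tg i r (i + 2) = r (i + 2) := tg_ne r (by omega) (by omega)
  have z2 : tg (i + 1) (tg i r) i = tg i r i := tg_ne _ (by omega) (by omega)
  unfold dsc
  rw [z2]
  by_cases h1 : cmp (r i) (r (i + 1))
  · have a1 := h.adj' (by omega) h1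
    rw [tg_pos h1]
    by_cases h2 : cmp (r (i + 1)) (r (i + 1 + 1))
    · rw [tg_pos h2]; exact h.tri hi h1 h2
    · have a2 := h.inc hi h2
      rw [tg_neg_l h2]; omega
  · have a1 := h.inc (by omega) h1
    rw [tg_neg_l h1]
    by_cases h2 : cmp (tg i r (i + 1)) (tg i r (i + 1 + 1))
    · have a2 := hT.adj' (i := i + 1) hi h2
      rw [tg_pos h2]
      rw [tg_neg_r h1] at *
      rw [show i + 1 + 1 = i + 2 from rfl] at *
      rw [z1] at a2
      omega
    · rw [tg_neg_l h2]
      rw [show i + 1 + 1 = i + 2 from rfl, z1]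

lemma three2 {m : ℕ} {r : ℕ → ℕ × ℕ} (h : LinN m r) {i : ℕ} (hi : i + 2 < m) :
    dsc (tg i (tg (i + 1) r)) (i + 1) ↔ dsc r i := by
  have hT := h.tg (i := i + 1) (by omega)
  have z1 : tg (i + 1) r i = r i := tg_ne r (by omega) (by omega)
  have z2 : tg i (tg (i + 1) r) (i + 1 + 1) = tg (i + 1) r (i + 1 + 1) := tg_ne _ (by omega) (by omega)
  unfold dsc
  rw [z2]
  by_cases h1 : cmp (r (i + 1)) (r (i + 1 + 1))
  · have a1 := h.adj' (by omega) h1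
    rw [tg_pos h1]
    by_cases h2 : cmp (r i) (r (i + 1))
    · rw [tg_pos h2]; exact (h.tri hi h2 h1).symm
    · have a2 := h.inc (by omega) h2
      rw [tg_neg_r h2]; omega
  · have a1 := h.inc (by omega) h1
    rw [tg_neg_r h1]
    by_cases h2 : cmp (tg (i + 1) r i) (tg (i + 1) r (i + 1))
    · have a2 := hT.adj' (i := i) (by omega) h2
      rw [tg_pos h2]
      rw [tg_neg_l h1, z1] at *
      omega
    · rw [tg_neg_r h2, z1]

def pas : ℕ → (ℕ → ℕ × ℕ) → ℕ → ℕ × ℕ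
  | 0, p => p
  | i + 1, p => tg i (pas i p)

def evs : ℕ → (ℕ → ℕ × ℕ) → ℕ → ℕ × ℕ
  | 0, p => p
  | m + 1, p => evs m (pas m p)

lemma LinN.pas {m : ℕ} {p : ℕ → ℕ × ℕ} (h : LinN m p) {i : ℕ} (hi : i < m ∨ i = 0) : LinN m (pas i p) := by
  induction i with
  | zero => exact h
  | succ i ih => exact (ih (by omega)).tg (by omega)

lemma LinN.evs {n : ℕ} (m : ℕ) : ∀ {p : ℕ → ℕ × ℕ} (_ : LinN n p) (_ : m ≤ n), LinN n (evs m p) := by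
  induction m with
  | zero => intro p h _; exact h
  | succ m ih => intro p h hm; exact ih (h.pas (by omega)) (by omega)

lemma pas_inj {m : ℕ} {i : ℕ} : ∀ {p q : ℕ → ℕ × ℕ}, LinN m p → LinN m q → (i < m ∨ i = 0) →
    pas i p = pas i q → p = q := by
  induction i with
  | zero => intro p q _ _ _ h; exact h
  | succ i ih =>
    intro p q hp hq hi h
    exact ih hp hq (by omega) (tg_inj (hp.pas (by omega)) (hq.pas (by omega)) (by omega) h)

lemma evs_inj {n : ℕ} (m : ℕ) : ∀ {p q : ℕ → ℕ × ℕ}, LinN n p → LinN n q → m ≤ n →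
    evs m p = evs m q → p = q := by
  induction m with
  | zero => intro p q _ _ _ h; exact h
  | succ m ih =>
    intro p q hp hq hm h
    exact pas_inj hp hq (by omega) (ih (hp.pas (by omega)) (hq.pas (by omega)) (by omega) h)

lemma pas_gt {i j : ℕ} (p : ℕ → ℕ × ℕ) (h : i < j) : pas i p j = p j := by
  induction i with
  | zero => rfl
  | succ i ih => rw [pas, tg_ne _ (by omega) (by omega), ih (by omega)]

lemma pas_stab {i k j : ℕ} (p : ℕ → ℕ × ℕ) (h : j < i) (hk : i ≤ k) : pas k p j = pas i p j := by
  induction k with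
  | zero => have : i = 0 := by omega
            rw [this]
  | succ k ih =>
    rcases hk.lt_or_eq with hk | hk
    · rw [pas, tg_ne _ (by omega) (by omega), ih (by omega)]
    · rw [hk]

lemma evs_ge {m j : ℕ} : ∀ (p : ℕ → ℕ × ℕ), m ≤ j → evs m p j = p j := by
  induction m with
  | zero => intro p _; rfl
  | succ m ih => intro p h; rw [evs, ih _ (by omega), pas_gt _ (by omega)]

lemma pas_tg_comm {i k : ℕ} (h : i + 1 ≤ k) (p : ℕ → ℕ × ℕ) : pas i (tg k p) = tg k (pas i p) := by
  induction i with
  | zero => rfl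
  | succ i ih => rw [pas, pas, ih (by omega), tg_comm (by omega)]

lemma P1 {m : ℕ} {p : ℕ → ℕ × ℕ} (h : LinN (m + 1) p) {j : ℕ} (hj : j + 2 ≤ m) :
    dsc (pas m p) j ↔ dsc p (j + 1) := by
  have e : dsc (pas m p) j ↔ dsc (pas (j + 2) p) j := by
    unfold dsc
    rw [pas_stab p (show j < j + 2 by omega) hj, pas_stab p (show j + 1 < j + 2 by omega) hj]
  rw [e, pas, pas, three1 (h.pas (by omega)) (by omega)]
  unfold dsc
  rw [pas_gt _ (by omega), pas_gt _ (by omega)]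

lemma P2 {m : ℕ} {p : ℕ → ℕ × ℕ} (h : LinN m p) (i : ℕ) (hi : i + 1 < m) :
    dsc (pas i (pas (i + 1) p)) i ↔ dsc p 0 := by
  induction i with
  | zero =>
    have hc : cmp (p 0) (p 1) := by
      obtain ⟨j, hj, hj'⟩ := h.low 0 (0, 0) (by omega) (Nat.zero_le _) (Nat.zero_le _)
      have := h.std j 0 hj (by omega) (by rw [hj']; simp) (by rw [hj']; simp)
      have : j = 0 := by omega
      subst this
      rw [hj']; simp [cmp]
    simp only [pas]
    rw [tg_pos hc]
  | succ i ih =>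
    rw [← ih (by omega)]
    rw [pas, pas, pas_tg_comm (by omega)]
    exact three2 ((h.pas (by omega)).pas (by omega)) (by omega)

lemma evs_dsc (m : ℕ) : ∀ {p : ℕ → ℕ × ℕ} (_ : LinN m p) (i : ℕ), i + 2 ≤ m →
    (dsc (evs m p) (m - 2 - i) ↔ dsc p i) := by
  induction m with
  | zero => intro p _ i h; omega
  | succ m ih =>
    intro p h i hi
    have hm : LinN m (pas m p) := by
      have h' := h.pas (i := m) (by omega)
      refine ⟨fun a b ha hb => h'.inj a b (by omega) (by omega), ?_,
        fun a b ha hb => h'.std a b (by omega) (by omega)⟩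
      intro a c ha h1 h2
      obtain ⟨j, hj, rfl⟩ := h'.low a c (by omega) h1 h2
      have := h'.std j a hj (by omega) h1 h2
      exact ⟨j, by omega, rfl⟩
    rw [evs]
    cases i with
    | succ i =>
      have := ih hm i (by omega)
      rw [show m + 1 - 2 - (i + 1) = m - 2 - i by omega, this, P1 h (by omega)]
    | zero =>
      obtain ⟨k, rfl⟩ : ∃ k, m = k + 1 := ⟨m - 1, by omega⟩
      rw [← P2 h k (by omega), show k + 1 + 1 - 2 - 0 = k by omega]
      unfold dsc
      rw [evs, evs_ge _ le_rfl, evs_ge _ (by omega)]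

def HasL (m : ℕ) (f : ℕ → ℕ) (p : ℕ → ℕ × ℕ) (T : Tab) : Prop :=
  (∀ j < m, T (p j) = f j) ∧ ∀ c, (∀ j < m, p j ≠ c) → T c = 0

def Lab (i j : ℕ) : ℕ := if j < i then j + 2 else if j = i then 0 else j + 1

lemma nb_val {m i : ℕ} {q : ℕ → ℕ × ℕ} {U : Tab} (h : LinN m q) (hU : HasL m (Lab i) q U)
    (hi : i < m) {c : ℕ × ℕ} (hc : cmp (q i) c) (hne : c ≠ q i) (hne' : i + 1 < m → c ≠ q (i + 1)) :
    U c = 0 ∨ i + 2 < U c := by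
  by_cases hx : ∃ j < m, q j = c
  · obtain ⟨j, hj, rfl⟩ := hx
    have h1 := h.std i j hi hj hc.1 hc.2
    have h2 : j ≠ i := fun he => hne (by rw [he])
    have h3 : j ≠ i + 1 := fun he => hne' (by omega) (by rw [he])
    right
    rw [hU.1 j hj, Lab, if_neg (by omega), if_neg h2]
    omega
  · push Not at hx
    exact Or.inl (hU.2 c hx)

lemma slide_pas {m : ℕ} {p : ℕ → ℕ × ℕ} (h : LinN (m + 1) p) (d : ℕ) : ∀ (i f : ℕ) (U : Tab),
    i + d = m → d ≤ f → HasL (m + 1) (Lab i) (pas i p) U →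
    ∃ U', HasL (m + 1) (Lab m) (pas m p) U' ∧ slide f U (pas i p i) = (U', pas m p m) := by
  induction d with
  | zero =>
    intro i f U hi _ hU
    obtain rfl : i = m := by omega
    refine ⟨U, hU, ?_⟩
    cases f with
    | zero => rfl
    | succ f =>
      have hq := h.pas (i := i) (by omega)
      have key : ∀ c, cmp (pas i p i) c → c ≠ pas i p i → U c = 0 := by
        intro c h1 h2
        apply hU.2
        intro j hj he
        have := hq.std i j (by omega) hj (by rw [he]; exact h1.1) (by rw [he]; exact h1.2)
        have : j = i := by omega
        rw [this] at he
        exact h2 he.symm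
      have k1 := key ((pas i p i).1, (pas i p i).2 + 1) (by constructor <;> simp)
        (by intro he; have := congrArg Prod.snd he; simp at this)
      have k2 := key ((pas i p i).1 + 1, (pas i p i).2) (by constructor <;> simp)
        (by intro he; have := congrArg Prod.fst he; simp at this)
      have : slideOnce U (pas i p i) = (U, pas i p i) := by
        unfold slideOnce
        simp [k1, k2]
      simp [slide, this]
  | succ d ih =>
    intro i f U hi hf hU
    have hq := h.pas (i := i) (by omega)
    by_cases hc : cmp (pas i p i) (pas i p (i + 1))
    · obtain ⟨f, rfl⟩ : ∃ f', f = f' + 1 := ⟨f - 1, by omega⟩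
      have e : pas (i + 1) p = pas i p := by rw [pas, tg_pos hc]
      have hv : U (pas i p (i + 1)) = i + 2 := by
        rw [hU.1 _ (by omega), Lab, if_neg (by omega), if_neg (by omega)]
      have hn : pas i p (i + 1) ≠ pas i p i := by
        intro he
        have := hq.inj _ _ (by omega) (by omega) he
        omega
      have hso : slideOnce U (pas i p i) =
          (Function.update (Function.update U (pas i p i) (i + 2)) (pas i p (i + 1)) 0,
            pas i p (i + 1)) := by
        rcases hq.adj (by omega) hc with ha | ha
        · have := nb_val hq hU (by omega) (c := ((pas i p i).1 + 1, (pas i p i).2))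
            (by constructor <;> simp)
            (by intro he; have := congrArg Prod.fst he; simp at this)
            (by rw [ha]; intro _ he; have := congrArg Prod.fst he; simp at this)
          rw [ha] at hv ⊢
          unfold slideOnce
          simp only [hv]
          rw [if_neg (by omega), if_pos (by omega)]
        · have := nb_val hq hU (by omega) (c := ((pas i p i).1, (pas i p i).2 + 1))
            (by constructor <;> simp)
            (by intro he; have := congrArg Prod.snd he; simp at this)
            (by rw [ha]; intro _ he; have := congrArg Prod.fst he; simp at this)
          rw [ha] at hv ⊢
          unfold slideOnce
          simp only [hv]
          rw [if_neg (by omega), if_neg (by omega)]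
      have hU' : HasL (m + 1) (Lab (i + 1)) (pas (i + 1) p)
          (Function.update (Function.update U (pas i p i) (i + 2)) (pas i p (i + 1)) 0) := by
        rw [e]
        refine ⟨?_, ?_⟩
        · intro j hj
          by_cases h1 : j = i + 1
          · subst h1; rw [Function.update_self]; simp [Lab]
          · have h1' : pas i p j ≠ pas i p (i + 1) := fun he => h1 (hq.inj _ _ hj (by omega) he)
            rw [Function.update_of_ne h1']
            by_cases h2 : j = i
            · subst h2; rw [Function.update_self]; simp [Lab]
            · have h2' : pas i p j ≠ pas i p i := fun he => h2 (hq.inj _ _ hj (by omega) he)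
              rw [Function.update_of_ne h2', hU.1 j hj]
              unfold Lab
              split_ifs <;> omega
        · intro c hcc
          rw [Function.update_of_ne (hcc _ (by omega)).symm, Function.update_of_ne (hcc _ (by omega)).symm]
          exact hU.2 c hcc
      obtain ⟨U', h1, h2⟩ := ih (i + 1) f _ (by omega) (by omega) hU'
      refine ⟨U', h1, ?_⟩
      rw [slide]
      simp only [hso]
      rw [if_neg hn, ← h2, e]
    · have e1 : pas (i + 1) p (i + 1) = pas i p i := by rw [pas, tg_neg_r hc]
      have e2 : pas (i + 1) p i = pas i p (i + 1) := by rw [pas, tg_neg_l hc]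
      have e3 : ∀ j, j ≠ i → j ≠ i + 1 → pas (i + 1) p j = pas i p j := by
        intro j h1 h2; rw [pas, tg_ne _ h1 h2]
      rw [← e1]
      apply ih (i + 1) f U (by omega) (by omega)
      refine ⟨?_, ?_⟩
      · intro j hj
        by_cases h1 : j = i + 1
        · subst h1; rw [e1, hU.1 _ (by omega)]; simp [Lab]
        · by_cases h2 : j = i
          · subst h2; rw [e2, hU.1 _ (by omega)]; simp [Lab]
          · rw [e3 j h2 h1, hU.1 j hj]
            unfold Lab
            split_ifs <;> omega
      · intro c hcc
        apply hU.2
        intro j hj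
        by_cases h1 : j = i + 1
        · subst h1; rw [← e2]; exact hcc _ (by omega)
        · by_cases h2 : j = i
          · subst h2; rw [← e1]; exact hcc _ (by omega)
          · rw [← e3 j h2 h1]; exact hcc j hj

lemma LinN.pred {m : ℕ} {p : ℕ → ℕ × ℕ} (h : LinN (m + 1) p) : LinN m p := by
  refine ⟨fun i j hi hj => h.inj i j (by omega) (by omega), ?_,
    fun i j hi hj => h.std i j (by omega) (by omega)⟩
  intro i c hi h1 h2
  obtain ⟨j, hj, rfl⟩ := h.low i c (by omega) h1 h2
  have := h.std j i hj (by omega) h1 h2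
  exact ⟨j, by omega, rfl⟩

lemma hasL_tabOf {m : ℕ} {p : ℕ → ℕ × ℕ} {T : Tab}
    (hp : Function.Injective fun i : Fin m => p i) (hT : HasL m (fun j => j + 1) p T) :
    T = tabOf fun i : Fin m => p i := by
  funext c
  by_cases hc : ∃ j < m, p j = c
  · obtain ⟨j, hj, rfl⟩ := hc
    rw [hT.1 j hj]
    exact (tabOf_apply hp ⟨j, hj⟩).symm
  · push Not at hc
    rw [hT.2 c hc, tabOf_out]
    rintro ⟨i, hi⟩
    exact hc i i.2 hi

lemma LinN.injf {m : ℕ} {p : ℕ → ℕ × ℕ} (h : LinN m p) : Function.Injective fun i : Fin m => p i :=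
  fun i j hij => Fin.ext (h.inj i j i.2 j.2 hij)

lemma evacAux_spec (m : ℕ) : ∀ (p : ℕ → ℕ × ℕ) (T : Tab), LinN m p →
    HasL m (fun j => j + 1) p T → HasL m (fun j => j + 1) (evs m p) (evacAux m T) := by
  induction m with
  | zero =>
    intro p T _ _
    exact ⟨fun j hj => by omega, fun c _ => rfl⟩
  | succ m ih =>
    intro p T h hT
    have hpos : posOf T 1 = p 0 := by
      rw [hasL_tabOf h.injf hT]
      exact posOf_tabOf h.injf (0 : Fin (m + 1))
    have hU0 : HasL (m + 1) (Lab 0) (pas 0 p) (Function.update T (p 0) 0) := by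
      refine ⟨?_, ?_⟩
      · intro j hj
        show Function.update T (p 0) 0 (p j) = _
        by_cases h0 : j = 0
        · subst h0; rw [Function.update_self]; simp [Lab]
        · rw [Function.update_of_ne (fun he => h0 (h.inj _ _ hj (by omega) he)), hT.1 j hj]
          simp [Lab, h0]
      · intro c hc
        change ∀ j < m + 1, p j ≠ c at hc
        rw [Function.update_of_ne (hc 0 (by omega)).symm]
        exact hT.2 c hc
    obtain ⟨U', h1, h2⟩ := slide_pas h m 0 (m + 1) _ (by omega) (by omega) hU0
    have h2' : slide (m + 1) (Function.update T (p 0) 0) (p 0) = (U', pas m p m) := h2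
    have hq := h.pas (i := m) (by omega)
    have h3 := ih (pas m p) (fun c => U' c - 1) hq.pred (by
      refine ⟨?_, ?_⟩
      · intro j hj
        simp only
        rw [h1.1 j (by omega), Lab, if_pos hj]
        omega
      · intro c hc
        simp only
        by_cases he : pas m p m = c
        · rw [← he, h1.1 m (by omega)]; simp [Lab]
        · rw [h1.2 c]
          intro j hj
          by_cases hjm : j = m
          · rw [hjm]; exact he
          · exact hc j (by omega))
    have hE := LinN.evs (n := m + 1) m hq (by omega)
    have hem : evs m (pas m p) m = pas m p m := evs_ge _ le_rfl
    rw [evacAux]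
    simp only [hpos, h2']
    refine ⟨?_, ?_⟩
    · intro j hj
      rw [evs]
      by_cases hjm : j = m
      · rw [hjm, hem, Function.update_self]
      · rw [Function.update_of_ne, h3.1 j (by omega)]
        rw [← hem]
        intro he
        exact hjm (hE.inj _ _ hj (by omega) he)
    · intro c hc
      rw [evs] at hc
      rw [Function.update_of_ne]
      · exact h3.2 c fun j hj => hc j (by omega)
      · rw [← hem]; exact (hc m (by omega)).symm

def evF {n : ℕ} (t : Fin n → ℕ × ℕ) : Fin n → ℕ × ℕ := fun i => evs n (extp t) i

lemma Lin.linN {n : ℕ} {t : Fin n → ℕ × ℕ} (h : Lin t) : LinN n (extp t) := by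
  refine ⟨?_, ?_, ?_⟩
  · intro i j hi hj he
    rw [extp, extp, dif_pos hi, dif_pos hj] at he
    exact congrArg Fin.val (h.inj he)
  · intro i c hi h1 h2
    rw [extp, dif_pos hi] at h1 h2
    obtain ⟨j, rfl⟩ := h.low _ c h1 h2
    exact ⟨j, j.2, extp_fin t j⟩
  · intro i j hi hj h1 h2
    rw [extp, extp, dif_pos hi, dif_pos hj] at h1 h2
    exact h.std _ _ h1 h2

lemma LinN.lin {n : ℕ} {p : ℕ → ℕ × ℕ} (h : LinN n p) : Lin (fun i : Fin n => p i) := by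
  refine ⟨⟨h.injf, ?_⟩, ?_⟩
  · intro i c h1 h2
    obtain ⟨j, hj, rfl⟩ := h.low i c i.2 h1 h2
    exact ⟨⟨j, hj⟩, rfl⟩
  · intro i j h1 h2
    exact h.std i j i.2 j.2 h1 h2

lemma evF_lin {n : ℕ} {t : Fin n → ℕ × ℕ} (h : Lin t) : Lin (evF t) :=
  (LinN.evs n h.linN le_rfl).lin

lemma evac_tabOf {n : ℕ} {t : Fin n → ℕ × ℕ} (h : Lin t) : evac n (tabOf t) = tabOf (evF t) := by
  have h1 : HasL n (fun j => j + 1) (extp t) (tabOf t) := by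
    refine ⟨?_, ?_⟩
    · intro j hj
      rw [extp, dif_pos hj, tabOf_apply h.inj]
    · intro c hc
      apply tabOf_out
      rintro ⟨i, rfl⟩
      exact hc i i.2 (extp_fin t i)
  exact hasL_tabOf (LinN.evs n h.linN le_rfl).injf (evacAux_spec n _ _ h.linN h1)

lemma tg_range (i : ℕ) (p : ℕ → ℕ × ℕ) (m : ℕ) (hi : i + 1 < m) (c : ℕ × ℕ) :
    (∃ j < m, tg i p j = c) → (∃ j < m, p j = c) := by
  rintro ⟨j, hj, rfl⟩
  unfold tg
  split_ifs
  · exact ⟨j, hj, rfl⟩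
  · exact ⟨_, swap_lt hi hj, rfl⟩

lemma pas_range (i : ℕ) (p : ℕ → ℕ × ℕ) (m : ℕ) (hi : i < m ∨ i = 0) (c : ℕ × ℕ) :
    (∃ j < m, pas i p j = c) → (∃ j < m, p j = c) := by
  induction i with
  | zero => exact id
  | succ i ih => exact fun h => ih (by omega) (tg_range i _ m (by omega) c h)

lemma evs_range (i : ℕ) : ∀ (p : ℕ → ℕ × ℕ) (m : ℕ) (_ : i ≤ m) (c : ℕ × ℕ),
    (∃ j < m, evs i p j = c) → (∃ j < m, p j = c) := by
  induction i with
  | zero => exact fun _ _ _ _ => id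
  | succ i ih => exact fun p m hi c h => pas_range i p m (by omega) c (ih _ m (by omega) c h)

lemma evF_range {n : ℕ} {t : Fin n → ℕ × ℕ} (h : Lin t) : Set.range (evF t) = Set.range t := by
  have hs : Set.range (evF t) ⊆ Set.range t := by
    rintro c ⟨i, rfl⟩
    obtain ⟨j, hj, he⟩ := evs_range n (extp t) n le_rfl _ ⟨i, i.2, rfl⟩
    refine ⟨⟨j, hj⟩, ?_⟩
    rw [extp, dif_pos hj] at he
    exact he
  apply Set.eq_of_subset_of_ncard_le hs
  · rw [← Set.image_univ, ← Set.image_univ, Set.ncard_image_of_injective _ h.inj,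
      Set.ncard_image_of_injective _ (evF_lin h).inj]

lemma evF_inj {n : ℕ} {t t' : Fin n → ℕ × ℕ} (h : Lin t) (h' : Lin t') (he : evF t = evF t') :
    t = t' := by
  have h1 : evs n (extp t) = evs n (extp t') := by
    funext j
    by_cases hj : j < n
    · exact congrFun he ⟨j, hj⟩
    · rw [evs_ge _ (by omega), evs_ge _ (by omega), extp, extp, dif_neg hj, dif_neg hj]
  have h2 := evs_inj n h.linN h'.linN le_rfl h1
  funext i
  rw [← extp_fin t, ← extp_fin t', h2]

lemma evF_Dset {n : ℕ} {t : Fin n → ℕ × ℕ} (h : Lin t) :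
    (Dset (evF t)).image (fun i => n - i) = Dset t := by
  have key : ∀ j, 0 < j → j < n → (n - j ∈ Dset (evF t) ↔ j ∈ Dset t) := by
    intro j h0 hj
    have e := evs_dsc n h.linN (j - 1) (by omega)
    unfold dsc at e
    unfold Dset
    rw [Finset.mem_filter, Finset.mem_filter, Finset.mem_Ioo, Finset.mem_Ioo]
    have e1 : extp (evF t) (n - j - 1) = evs n (extp t) (n - 2 - (j - 1)) := by
      rw [extp, dif_pos (by omega), evF]
      congr 1
      simp only; omega
    have e2 : extp (evF t) (n - j) = evs n (extp t) (n - 2 - (j - 1) + 1) := by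
      rw [extp, dif_pos (by omega), evF]
      congr 1
      simp only; omega
    rw [e1, e2, e, show j - 1 + 1 = j by omega]
    constructor
    · rintro ⟨_, h2⟩; exact ⟨⟨h0, hj⟩, h2⟩
    · rintro ⟨_, h2⟩; exact ⟨⟨by omega, by omega⟩, h2⟩
  ext j
  rw [Finset.mem_image]
  constructor
  · rintro ⟨i, hi, rfl⟩
    have hi' : 0 < i ∧ i < n := by
      have := hi
      rw [Dset, Finset.mem_filter, Finset.mem_Ioo] at this
      exact this.1
    rw [← key (n - i) (by omega) (by omega), show n - (n - i) = i by omega]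
    exact hi
  · intro hj
    have hj' : 0 < j ∧ j < n := by
      have := hj
      rw [Dset, Finset.mem_filter, Finset.mem_Ioo] at this
      exact this.1
    exact ⟨n - j, (key j hj'.1 hj'.2).2 hj, by omega⟩

def Orb {n : ℕ} (β : Fin n → ℕ) : Finset (Fin n → ℕ) :=
  Finset.univ.image fun g : Equiv.Perm (Fin n) => β ∘ g

lemma mem_Orb {n : ℕ} {β b : Fin n → ℕ} : b ∈ Orb β ↔ ∃ g : Equiv.Perm (Fin n), b = β ∘ g := by
  simp [Orb, eq_comm]

lemma Orb_self {n : ℕ} (β : Fin n → ℕ) : β ∈ Orb β := mem_Orb.2 ⟨1, rfl⟩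

lemma Orb_perm {n : ℕ} {β b : Fin n → ℕ} (σ : Equiv.Perm (Fin n)) :
    (fun i => b (σ i)) ∈ Orb β ↔ b ∈ Orb β := by
  rw [mem_Orb, mem_Orb]
  constructor
  · rintro ⟨g, h⟩
    refine ⟨g * σ⁻¹, ?_⟩
    funext i
    have := congrFun h (σ⁻¹ i)
    simpa using this
  · rintro ⟨g, rfl⟩
    exact ⟨g * σ, rfl⟩

def pj {n : ℕ} (β : Fin n → ℕ) : Pn n →ₗ[ℚ] Pn n := ∑ b ∈ Orb β, (cf b).smulRight (mon b)

lemma cf_pj {n : ℕ} (β b : Fin n → ℕ) (p : Pn n) : cf b (pj β p) = if b ∈ Orb β then cf b p else 0 := by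
  simp only [pj, LinearMap.sum_apply, map_sum, LinearMap.smulRight_apply, map_smul, cf_mon,
    smul_eq_mul, mul_ite, mul_one, mul_zero]
  rw [Finset.sum_ite_eq']

lemma pj_ren {n : ℕ} (β : Fin n → ℕ) (σ : Equiv.Perm (Fin n)) (p : Pn n) :
    pj β (ren σ p) = ren σ (pj β p) := by
  apply cf_ext
  intro b
  rw [cf_pj, cf_ren, cf_ren, cf_pj]
  simp only [Orb_perm]

def LeB {n : ℕ} (q : Fin n → ℕ × ℕ) (β : Fin n → ℕ) : Prop :=
  ∃ δ : Fin n → ℕ, Monotone δ ∧ β = al q + δ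

lemma LeB.exL {n : ℕ} {q : Fin n → ℕ × ℕ} {β : Fin n → ℕ} (h : LeB q β) :
    ∃ L : Multiset ℕ, (∀ s ∈ L, 1 ≤ s ∧ s ≤ n) ∧ β = al q + topL n L ∧
      ∀ h : 0 < n, L.card = topL n L ⟨n - 1, by omega⟩ := by
  obtain ⟨δ, h1, h2⟩ := h
  obtain ⟨L, h3, h4, h5⟩ := exists_topL δ h1
  exact ⟨L, h3, by rw [h4, h2], fun h => by rw [h4]; exact h5 h⟩

def LL {n : ℕ} (β : Fin n → ℕ) (q : Fin n → ℕ × ℕ) : Multiset ℕ :=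
  if h : LeB q β then h.exL.choose else 0

lemma LL_spec {n : ℕ} {q : Fin n → ℕ × ℕ} {β : Fin n → ℕ} (h : LeB q β) :
    (∀ s ∈ LL β q, 1 ≤ s ∧ s ≤ n) ∧ β = al q + topL n (LL β q) ∧
      ∀ h : 0 < n, (LL β q).card = topL n (LL β q) ⟨n - 1, by omega⟩ := by
  rw [LL, dif_pos h]
  exact h.exL.choose_spec

def tp {n : ℕ} (q : Fin n → ℕ × ℕ) : Pn n →ₗ[ℚ] Pn n := th q (mon (al q))

def ld {n : ℕ} (β : Fin n → ℕ) (q : Fin n → ℕ × ℕ) : Pn n →ₗ[ℚ] Pn n :=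
  th q (pj β (mon (al q) * EL n (LL β q)))

lemma ren_EL {n : ℕ} (L : Multiset ℕ) (σ : Equiv.Perm (Fin n)) : ren σ (EL n L) = EL n L :=
  rename_EL L σ

lemma ld_eq {n : ℕ} (β : Fin n → ℕ) (q : Fin n → ℕ × ℕ) (v : Pn n) :
    ld β q v = pj β (tp q v * EL n (LL β q)) := by
  rw [ld, ← th_comm _ _ _ (pj β) (pj_ren β), th_mul _ _ _ _ (ren_EL _)]
  rfl

lemma topL_mono {n : ℕ} (L : Multiset ℕ) : Monotone (topL n L) := by
  induction L using Multiset.induction_on with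
  | empty => intro i j _; simp [topL]
  | cons a L ih =>
    rw [topL, Multiset.map_cons, Multiset.sum_cons]
    exact mono_add (topv_mono n a) ih

lemma isLead_ld {n : ℕ} {β : Fin n → ℕ} {q : Fin n → ℕ × ℕ} (hq : Lin q) (h : LeB q β) :
    IsLead q β (pj β (mon (al q) * EL n (LL β q))) := by
  obtain ⟨h1, h2, -⟩ := LL_spec h
  have hG : Good β (mon (al q) * EL n (LL β q)) := by
    have := (good_mon (al_mono q)).mul (good_EL (LL β q) fun s hs => (h1 s hs).2)
    rwa [← h2] at this
  refine ⟨hq, h, ?_, ?_, ?_⟩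
  · intro b
    rw [cf_pj]
    split_ifs
    · exact hG.1 b
    · exact le_rfl
  · intro b hb
    rw [cf_pj] at hb
    split_ifs at hb with hO
    · obtain ⟨g, rfl⟩ := mem_Orb.1 hO
      obtain ⟨a, c, e1, e2, e3⟩ := exists_of_cf_mul_ne hb
      rw [cf_mon] at e2
      split_ifs at e2 with he
      · subst he
        have hd : Dom c (topL n (LL β q)) := (good_EL (LL β q) fun s hs => (h1 s hs).2).2.1 c e3
        have := refine_lemma (g := g) (al_mono q) hd (by rw [← h2, e1])
        exact ⟨g, fun i => rfl, fun i => congrFun this i⟩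
      · exact absurd rfl e2
    · exact absurd rfl hb
  · rw [cf_pj, if_pos (Orb_self β)]
    exact hG.2.2

def MS {n : ℕ} (β : Fin n → ℕ) : Submodule ℚ (Pn n) :=
  Submodule.span ℚ ((Orb β).image mon : Finset (Pn n))

lemma pj_mem {n : ℕ} (β : Fin n → ℕ) (p : Pn n) : pj β p ∈ MS β := by
  rw [pj, LinearMap.sum_apply]
  apply Submodule.sum_mem
  intro b hb
  rw [LinearMap.smulRight_apply]
  apply Submodule.smul_mem
  apply Submodule.subset_span
  exact Finset.mem_coe.2 (Finset.mem_image_of_mem _ hb)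

lemma ld_mem {n : ℕ} (β : Fin n → ℕ) (q : Fin n → ℕ × ℕ) (v : Pn n) : ld β q v ∈ MS β := by
  rw [ld_eq]; exact pj_mem _ _

instance msFin {n : ℕ} (β : Fin n → ℕ) : FiniteDimensional ℚ (MS β) := by
  unfold MS; exact FiniteDimensional.span_finset ℚ _

lemma finrank_MS {n : ℕ} (β : Fin n → ℕ) : Module.finrank ℚ (MS β) ≤ (Orb β).card :=
  (finrank_span_finset_le_card _).trans Finset.card_image_le

def PB {n : ℕ} (β : Fin n → ℕ) : Finset (St n × St n) :=
  Finset.univ.filter fun x => Set.range x.1.1 = Set.range x.2.1 ∧ LeB x.2.1 β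

lemma et_mem {n : ℕ} {p q : Fin n → ℕ × ℕ} (hp : Function.Injective p)
    (h : Set.range p = Set.range q) : et p ∈ Specht q :=
  Submodule.subset_span ⟨p, hp, h, rfl⟩

def colS {n : ℕ} (c : St n × St n → ℚ) (q : St n) : Pn n :=
  ∑ p ∈ (Finset.univ.filter fun p : St n => Set.range p.1 = Set.range q.1), c (p, q) • et p.1

lemma colS_mem {n : ℕ} (c : St n × St n → ℚ) (q : St n) : colS c q ∈ Specht q.1 := by
  apply Submodule.sum_mem
  intro p hp
  exact Submodule.smul_mem _ _ (et_mem p.2.inj (Finset.mem_filter.1 hp).2)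

lemma sum_PB {n : ℕ} {M : Type*} [AddCommMonoid M] (β : Fin n → ℕ) (f : St n × St n → M) :
    ∑ x ∈ PB β, f x = ∑ q ∈ (Finset.univ.filter fun q : St n => LeB q.1 β),
      ∑ p ∈ (Finset.univ.filter fun p : St n => Set.range p.1 = Set.range q.1), f (p, q) := by
  rw [PB, Finset.sum_filter, Fintype.sum_prod_type_right, Finset.sum_filter]
  apply Finset.sum_congr rfl
  intro q _
  split_ifs with h
  · rw [Finset.sum_filter]; simp [h]
  · simp [h]

lemma ld_colS {n : ℕ} (β : Fin n → ℕ) (c : St n × St n → ℚ) :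
    ∑ x ∈ PB β, c x • ld β x.2.1 (et x.1.1) =
      ∑ q ∈ (Finset.univ.filter fun q : St n => LeB q.1 β), ld β q.1 (colS c q) := by
  rw [sum_PB]
  apply Finset.sum_congr rfl
  intro q _
  rw [colS, map_sum]
  simp only [map_smul]

lemma ld_indep {n : ℕ} (β : Fin n → ℕ) (c : St n × St n → ℚ)
    (h : ∑ x ∈ PB β, c x • ld β x.2.1 (et x.1.1) = 0) : ∀ x ∈ PB β, c x = 0 := by
  rw [ld_colS] at h
  have h1 := C3 β _ (fun q => pj β (mon (al q.1) * EL n (LL β q.1)))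
    (fun q hq => isLead_ld q.2 (Finset.mem_filter.1 hq).2) (colS c) (fun q _ => colS_mem c q) h
  rintro ⟨p, q⟩ hx
  rw [PB, Finset.mem_filter] at hx
  have h2 := h1 q (Finset.mem_filter.2 ⟨Finset.mem_univ _, hx.2.2⟩)
  exact et_indep _ (fun p => c (p, q)) h2 p (Finset.mem_filter.2 ⟨Finset.mem_univ _, hx.2.1⟩)

lemma ld_li {n : ℕ} (β : Fin n → ℕ) :
    LinearIndependent ℚ (fun x : PB β => ld β x.1.2.1 (et x.1.1.1)) := by
  rw [Fintype.linearIndependent_iff]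
  intro g hg
  have := ld_indep β (fun x => if h : x ∈ PB β then g ⟨x, h⟩ else 0) (by
    rw [← Finset.sum_coe_sort, ← hg]
    apply Finset.sum_congr rfl
    intro x _
    simp)
  intro x
  have h2 := this x.1 x.2
  simpa using h2

lemma card_PB_le {n : ℕ} (β : Fin n → ℕ) : (PB β).card ≤ (Orb β).card := by
  have h1 : LinearIndependent ℚ (fun x : PB β => (⟨ld β x.1.2.1 (et x.1.1.1), ld_mem _ _ _⟩ : MS β)) := by
    apply LinearIndependent.of_comp (MS β).subtype
    exact ld_li β
  have := h1.fintype_card_le_finrank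
  rw [Fintype.card_coe] at this
  exact this.trans (finrank_MS β)

lemma leB_of {n : ℕ} {q : Fin n → ℕ × ℕ} {β : Fin n → ℕ} (hβ : Monotone β)
    (h : ∀ (j : ℕ) (hj : j < n), j ∈ Dset q → β ⟨j - 1, by omega⟩ < β ⟨j, hj⟩) : LeB q β := by
  have step : ∀ (j : ℕ) (hj : j + 1 < n), al q ⟨j + 1, hj⟩ + β ⟨j, by omega⟩ ≤
      al q ⟨j, by omega⟩ + β ⟨j + 1, hj⟩ := by
    intro j hj
    have hm : β ⟨j, by omega⟩ ≤ β ⟨j + 1, hj⟩ := hβ (by simp [Fin.le_def])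
    by_cases hD : j + 1 ∈ Dset q
    · have h1 := h (j + 1) hj hD
      simp only [Nat.add_sub_cancel] at h1
      have h2 : al q ⟨j + 1, hj⟩ ≤ al q ⟨j, by omega⟩ + 1 := by
        unfold al
        refine (Finset.card_le_card (t := insert (j + 1) ((Dset q).filter fun i => i ≤ j)) ?_).trans
          (Finset.card_insert_le _ _)
        intro i hi
        rw [Finset.mem_filter] at hi
        simp only at hi
        rw [Finset.mem_insert, Finset.mem_filter]
        by_cases hi' : i = j + 1
        · exact Or.inl hi'
        · exact Or.inr ⟨hi.1, by omega⟩
      omega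
    · have h2 : al q ⟨j + 1, hj⟩ ≤ al q ⟨j, by omega⟩ := by
        unfold al
        apply Finset.card_le_card
        intro i hi
        rw [Finset.mem_filter] at hi ⊢
        simp only at hi ⊢
        refine ⟨hi.1, ?_⟩
        have : i ≠ j + 1 := fun he => hD (he ▸ hi.1)
        omega
      omega
  have key : ∀ (d i : ℕ) (hd : i + d < n), al q ⟨i + d, hd⟩ + β ⟨i, by omega⟩ ≤
      al q ⟨i, by omega⟩ + β ⟨i + d, hd⟩ := by
    intro d
    induction d with
    | zero => intro i hd; exact le_rfl
    | succ d ih =>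
      intro i hd
      have h1 := ih i (by omega)
      have h2 := step (i + d) (by omega)
      simp only [← Nat.add_assoc]
      omega
  have key' : ∀ i j : Fin n, i ≤ j → al q j + β i ≤ al q i + β j := by
    intro i j hij
    have := key (j - i) i (by have := j.2; omega)
    have e : (i : ℕ) + (j - i) = j := by have : (i : ℕ) ≤ j := hij; omega
    simpa only [e] using this
  have hle : ∀ i, al q i ≤ β i := by
    intro i
    have hn : 0 < n := by have := i.2; omega
    have := key' ⟨0, hn⟩ i (by simp [Fin.le_def])
    have h0 : al q ⟨0, hn⟩ = 0 := by
      unfold al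
      rw [Finset.card_eq_zero, Finset.filter_eq_empty_iff]
      intro j hj
      rw [Dset, Finset.mem_filter, Finset.mem_Ioo] at hj
      simp only
      omega
    omega
  refine ⟨fun i => β i - al q i, ?_, ?_⟩
  · intro i j hij
    have := key' i j hij
    have := hle i
    have := hle j
    simp only
    omega
  · funext i
    have := hle i
    simp only [Pi.add_apply]
    omega

/-! RSK -/

lemma psq_ex {n : ℕ} (w : {w : Equiv.Perm ℕ // SuppIn n w}) : ∃ x : St n × St n,
    Set.range x.1.1 = Set.range x.2.1 ∧ Ptab n w.1 = tabOf x.1.1 ∧ Qt n w.1 = tabOf x.2.1 ∧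
      x.2.1 = evF (qseq n w.1) := by
  obtain ⟨p, h1, h2, h3⟩ := Ptab_eq w.2
  have hq := qseq_lin n w.1
  refine ⟨(⟨p, h1⟩, ⟨evF (qseq n w.1), evF_lin hq⟩), ?_, h3, ?_, rfl⟩
  · simp only; rw [h2, evF_range hq]
  · rw [Qt, Qtab_eq w.2, evac_tabOf hq]

def rs {n : ℕ} (w : {w : Equiv.Perm ℕ // SuppIn n w}) : St n × St n := (psq_ex w).choose

lemma rs_range {n : ℕ} (w : {w : Equiv.Perm ℕ // SuppIn n w}) :
    Set.range (rs w).1.1 = Set.range (rs w).2.1 := (psq_ex w).choose_spec.1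
lemma rs_P {n : ℕ} (w : {w : Equiv.Perm ℕ // SuppIn n w}) : Ptab n w.1 = tabOf (rs w).1.1 :=
  (psq_ex w).choose_spec.2.1
lemma rs_Q {n : ℕ} (w : {w : Equiv.Perm ℕ // SuppIn n w}) : Qt n w.1 = tabOf (rs w).2.1 :=
  (psq_ex w).choose_spec.2.2.1
lemma rs_D {n : ℕ} (w : {w : Equiv.Perm ℕ // SuppIn n w}) :
    (Dset (rs w).2.1).image (fun i => n - i) = DslSet n w.1 := by
  have e : (rs w).2.1 = evF (qseq n w.1) := (psq_ex w).choose_spec.2.2.2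
  rw [e, evF_Dset (qseq_lin n w.1), dset_qseq]

lemma rs_inj {n : ℕ} : Function.Injective (rs (n := n)) := by
  intro w w' h
  have h1 : evF (qseq n w.1) = evF (qseq n w'.1) := by
    have e : (rs w).2.1 = evF (qseq n w.1) := (psq_ex w).choose_spec.2.2.2
    have e' : (rs w').2.1 = evF (qseq n w'.1) := (psq_ex w').choose_spec.2.2.2
    rw [← e, ← e', h]
  have h2 := evF_inj (qseq_lin n w.1) (qseq_lin n w'.1) h1
  apply Subtype.ext
  apply rsk_inj w.2 w'.2
  · rw [rs_P, rs_P, h]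
  · rw [Qtab_eq w.2, Qtab_eq w'.2, h2]



lemma embed_succ {n : ℕ} (σ : Equiv.Perm (Fin n)) (j : Fin n) :
    embedPerm n σ ((j : ℕ) + 1) = (σ j : ℕ) + 1 := by
  have := Equiv.Perm.extendDomain_apply_image σ (finShift n) j
  exact this

lemma embed_supp {n : ℕ} (σ : Equiv.Perm (Fin n)) : SuppIn n (embedPerm n σ) := by
  intro i hi
  apply Equiv.Perm.extendDomain_apply_not_subtype
  omega

lemma embed_inj {n : ℕ} {σ τ : Equiv.Perm (Fin n)} (h : embedPerm n σ = embedPerm n τ) : σ = τ := by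
  ext j
  have := DFunLike.congr_fun h ((j : ℕ) + 1)
  rw [embed_succ, embed_succ] at this
  omega

lemma embed_surj {n : ℕ} {w : Equiv.Perm ℕ} (hw : SuppIn n w) : ∃ σ, embedPerm n σ = w := by
  have key : ∀ j : Fin n, w (j + 1) ≠ 0 ∧ w (j + 1) ≤ n := by
    intro j
    constructor
    · intro h
      have h0 := hw 0 (Or.inl rfl)
      have := w.injective (h.trans h0.symm)
      omega
    · by_contra h
      have h0 := hw (w (j + 1)) (Or.inr (by omega))
      have := w.injective h0
      have := j.2
      omega
  let f : Fin n → Fin n := fun j => ⟨w (j + 1) - 1, by have := key j; have := j.2; omega⟩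
  have hf : Function.Injective f := by
    intro i j hij
    have h1 : w (i + 1) - 1 = w (j + 1) - 1 := congrArg Fin.val hij
    have h2 := key i
    have h3 := key j
    have h4 : w (i + 1) = w (j + 1) := by omega
    have := w.injective h4
    ext; omega
  refine ⟨Equiv.ofBijective f (Finite.injective_iff_bijective.1 hf), ?_⟩
  ext i
  by_cases hi : i = 0 ∨ n < i
  · rw [embed_supp _ i hi, hw i hi]
  · obtain ⟨j, rfl⟩ : ∃ j : Fin n, i = (j : ℕ) + 1 := ⟨⟨i - 1, by omega⟩, by simp only; omega⟩
    rw [embed_succ, Equiv.ofBijective_apply]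
    have := key j
    simp only [f]
    omega

def srt {n : ℕ} (b : Fin n → ℕ) : Equiv.Perm (Fin n) := Tuple.sort fun i => OrderDual.toDual (b i)

def wOf {n : ℕ} (b : Fin n → ℕ) : {w : Equiv.Perm ℕ // SuppIn n w} := ⟨embedPerm n (srt b), embed_supp _⟩

lemma srt_spec {n : ℕ} {b β : Fin n → ℕ} (hβ : Monotone β) (h : b ∈ Orb β) (i : Fin n) :
    b (srt b i) = β (Fin.rev i) := by
  have hm : Monotone (fun i => OrderDual.toDual (b (srt b i))) :=
    Tuple.monotone_sort fun i => OrderDual.toDual (b i)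
  obtain ⟨g, rfl⟩ := mem_Orb.1 h
  have h1 : Monotone (fun i => β (g (srt (β ∘ g) (Fin.rev i)))) := by
    intro i j hij
    exact hm (Fin.rev_le_rev.2 hij)
  have h2 := sort_uniq (fun _ => ()) β
    (Fin.revPerm.trans ((srt (β ∘ g)).trans g)) (fun _ => rfl)
    (fun i j hij _ => hβ hij.le) (fun i j hij _ => h1 hij.le)
  have h3 : β (g (srt (β ∘ g) (Fin.rev (Fin.rev i)))) = β (Fin.rev i) := h2 (Fin.rev i)
  simp only [Fin.rev_rev] at h3
  exact h3

lemma rs_wOf {n : ℕ} {b β : Fin n → ℕ} (hβ : Monotone β) (h : b ∈ Orb β) : rs (wOf b) ∈ PB β := by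
  rw [PB, Finset.mem_filter]
  refine ⟨Finset.mem_univ _, rs_range _, leB_of hβ ?_⟩
  intro j hj hD
  have hj0 : 0 < j := by
    rw [Dset, Finset.mem_filter, Finset.mem_Ioo] at hD; omega
  have h1 : n - j ∈ DslSet n (wOf b).1 := by
    rw [← rs_D]; exact Finset.mem_image_of_mem _ hD
  rw [DslSet, Finset.mem_filter] at h1
  have h2 := h1.2
  have e1 := embed_succ (srt b) ⟨n - j, by omega⟩
  have e2 := embed_succ (srt b) ⟨n - j - 1, by omega⟩
  simp only at e1 e2
  rw [show n - j - 1 + 1 = n - j by omega] at e2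
  change embedPerm n (srt b) (n - j + 1) < embedPerm n (srt b) (n - j) at h2
  rw [e1, e2] at h2
  have s1 := srt_spec hβ h ⟨n - j, by omega⟩
  have s2 := srt_spec hβ h ⟨n - j - 1, by omega⟩
  have r1 : Fin.rev (⟨n - j, by omega⟩ : Fin n) = ⟨j - 1, by omega⟩ := by
    ext; simp only [Fin.val_rev]; omega
  have r2 : Fin.rev (⟨n - j - 1, by omega⟩ : Fin n) = ⟨j, by omega⟩ := by
    ext; simp only [Fin.val_rev]; omega
  rw [r1] at s1
  rw [r2] at s2
  have hle : β ⟨j - 1, by omega⟩ ≤ β ⟨j, hj⟩ := hβ (by simp [Fin.le_def])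
  rcases hle.lt_or_eq with hlt | heq
  · exact hlt
  · exfalso
    have h3 := (Tuple.eq_sort_iff (f := fun i => OrderDual.toDual (b i)) (σ := srt b)).1 rfl
    have h4 := h3.2 ⟨n - j - 1, by omega⟩ ⟨n - j, by omega⟩ (by simp only [Fin.lt_def]; omega)
      (by
        show OrderDual.toDual (b _) = OrderDual.toDual (b _)
        rw [s1, s2, heq])
    have : ((srt b ⟨n - j - 1, by omega⟩ : Fin n) : ℕ) < srt b ⟨n - j, by omega⟩ := h4
    omega

lemma wOf_inj {n : ℕ} {b b' β : Fin n → ℕ} (hβ : Monotone β) (h : b ∈ Orb β) (h' : b' ∈ Orb β)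
    (he : wOf b = wOf b') : b = b' := by
  have h1 : srt b = srt b' := embed_inj (congrArg Subtype.val he)
  funext i
  have := srt_spec hβ h ((srt b)⁻¹ i)
  have h2 := srt_spec hβ h' ((srt b)⁻¹ i)
  rw [← h1] at h2
  have e : srt b ((srt b)⁻¹ i) = i := by simp
  rw [e] at this h2
  rw [this, h2]

lemma card_Orb_eq {n : ℕ} {β : Fin n → ℕ} (hβ : Monotone β) :
    (Orb β).card = (PB β).card ∧ ∀ x ∈ PB β, ∃ b ∈ Orb β, rs (wOf b) = x := by
  have hin : Set.InjOn (fun b => rs (wOf b)) (Orb β : Set (Fin n → ℕ)) := by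
    intro b hb b' hb' he
    exact wOf_inj hβ hb hb' (rs_inj he)
  have hle : (Orb β).card ≤ (PB β).card :=
    Finset.card_le_card_of_injOn _ (fun b hb => rs_wOf hβ hb) hin
  have heq := le_antisymm hle (card_PB_le β)
  refine ⟨heq, ?_⟩
  intro x hx
  have := Finset.surj_on_of_inj_on_of_card_le (s := Orb β) (t := PB β) (fun b _ => rs (wOf b))
    (fun b hb => rs_wOf hβ hb) (fun b b' hb hb' he => hin hb hb' he) heq.ge x hx
  obtain ⟨b, hb, he⟩ := this
  exact ⟨b, hb, he.symm⟩

lemma LeB.self {n : ℕ} (q : Fin n → ℕ × ℕ) : LeB q (al q) := ⟨0, fun _ _ _ => le_rfl, by simp⟩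

lemma rs_surj {n : ℕ} (x : St n × St n) (h : Set.range x.1.1 = Set.range x.2.1) : ∃ w, rs w = x := by
  obtain ⟨b, -, hb⟩ := (card_Orb_eq (al_mono x.2.1)).2 x
    (by rw [PB, Finset.mem_filter]; exact ⟨Finset.mem_univ _, h, LeB.self _⟩)
  exact ⟨_, hb⟩

lemma ld_span {n : ℕ} {β : Fin n → ℕ} (hβ : Monotone β) :
    Submodule.span ℚ (Set.range fun x : PB β => ld β x.1.2.1 (et x.1.1.1)) = MS β := by
  apply Submodule.eq_of_le_of_finrank_le
  · rw [Submodule.span_le]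
    rintro _ ⟨x, rfl⟩
    exact ld_mem _ _ _
  · rw [finrank_span_eq_card (ld_li β), Fintype.card_coe, ← (card_Orb_eq hβ).1]
    exact finrank_MS β

lemma exists_coef {n : ℕ} {β : Fin n → ℕ} (hβ : Monotone β) {p : Pn n} (hp : p ∈ MS β) :
    ∃ c : St n × St n → ℚ, p = ∑ x ∈ PB β, c x • ld β x.2.1 (et x.1.1) := by
  rw [← ld_span hβ, Submodule.mem_span_range_iff_exists_fun] at hp
  obtain ⟨c, hc⟩ := hp
  refine ⟨fun x => if h : x ∈ PB β then c ⟨x, h⟩ else 0, ?_⟩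
  rw [← Finset.sum_coe_sort, ← hc]
  apply Finset.sum_congr rfl
  intro x _
  simp

lemma straighten {n : ℕ} (q : St n) {v : Pn n} (hv : v ∈ Specht q.1) :
    ∃ c : St n × St n → ℚ, v = colS c q := by
  obtain ⟨c, hc⟩ := exists_coef (al_mono q.1) (ld_mem (al q.1) q.1 v)
  refine ⟨c, ?_⟩
  rw [ld_colS] at hc
  have h1 := C3 (al q.1) (Finset.univ.filter fun q' : St n => LeB q'.1 (al q.1))
    (fun q' => pj (al q.1) (mon (al q'.1) * EL n (LL (al q.1) q'.1)))
    (fun q' hq => isLead_ld q'.2 (Finset.mem_filter.1 hq).2)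
    (fun q' => colS c q' - if q' = q then v else 0)
    (fun q' _ => by
      apply Submodule.sub_mem _ (colS_mem c q')
      split_ifs with h
      · rw [h]; exact hv
      · exact Submodule.zero_mem _)
    (by
      simp only [map_sub, Finset.sum_sub_distrib]
      change ∑ q' ∈ _, ld (al q.1) q'.1 (colS c q') - ∑ q' ∈ _, ld (al q.1) q'.1 (if q' = q then v else 0) = 0
      rw [← hc, sub_eq_zero]
      rw [Finset.sum_eq_single q]
      · rw [if_pos rfl]
      · intro q' _ hne; rw [if_neg hne, map_zero]
      · intro hno
        exact absurd (Finset.mem_filter.2 ⟨Finset.mem_univ q, LeB.self q.1⟩) hno)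
  have h2 := h1 q (Finset.mem_filter.2 ⟨Finset.mem_univ _, LeB.self _⟩)
  simp only [if_pos] at h2
  exact (sub_eq_zero.1 h2).symm

lemma al_last {n : ℕ} (q : Fin n → ℕ × ℕ) (hn : 0 < n) : al q ⟨n - 1, by omega⟩ = (Dset q).card := by
  unfold al
  congr 1
  rw [Finset.filter_true_of_mem]
  intro j hj
  rw [Dset, Finset.mem_filter, Finset.mem_Ioo] at hj
  simp only
  omega

lemma tp_dom {n : ℕ} (q : Fin n → ℕ × ℕ) (v : Pn n) {b : Fin n → ℕ} (h : cf b (tp q v) ≠ 0) :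
    Dom b (al q) := by
  rw [tp, cf_th] at h
  obtain ⟨σ, -, hσ⟩ := Finset.exists_ne_zero_of_sum_ne_zero h
  have h2 := right_ne_zero_of_mul hσ
  rw [cf_mon] at h2
  split_ifs at h2 with he
  · have := (Dom.refl (al_mono q)).perm σ⁻¹
    have e : al q ∘ ⇑σ⁻¹ = b := by
      rw [he]; funext i; simp
    rwa [e] at this
  · exact absurd rfl h2

lemma uu_dom {n : ℕ} (q : Fin n → ℕ × ℕ) (v : Pn n) (L : Multiset ℕ) (hL : ∀ s ∈ L, s ≤ n)
    {b : Fin n → ℕ} (h : cf b (tp q v * EL n L) ≠ 0) : Dom b (al q + topL n L) := by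
  obtain ⟨a, c, rfl, h1, h2⟩ := exists_of_cf_mul_ne h
  exact (tp_dom q v h1).add ((good_EL L hL).2.1 c h2)

def SP (n N : ℕ) : Submodule ℚ (Pn n) :=
  Submodule.span ℚ {u | ∃ (x : St n × St n) (L : Multiset ℕ), Set.range x.1.1 = Set.range x.2.1 ∧
    (∀ s ∈ L, 1 ≤ s ∧ s ≤ n) ∧ L.card + (Dset x.2.1).card ≤ N ∧ u = tp x.2.1 (et x.1.1) * EL n L}

lemma mon_mem_SP {n N : ℕ} (hn : 0 < n) (m : ℕ) : ∀ b : Fin n → ℕ, ∑ i, b i * b i = m →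
    (∀ i, b i ≤ N) → mon b ∈ SP n N := by
  induction m using Nat.strong_induction_on with
  | _ m ih =>
    intro b hbm hbN
    set β := b ∘ Tuple.sort b with hβd
    have hβ : Monotone β := Tuple.monotone_sort b
    have hO : b ∈ Orb β := mem_Orb.2 ⟨(Tuple.sort b)⁻¹, by funext i; simp [hβd]⟩
    have hβN : ∀ i, β i ≤ N := fun i => hbN _
    have hsq : ∑ i, β i * β i = m := by
      rw [← hbm]
      exact Equiv.sum_comp (Tuple.sort b) fun i => b i * b i
    have hmem : mon b ∈ MS β :=
      Submodule.subset_span (Finset.mem_coe.2 (Finset.mem_image_of_mem _ hO))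
    obtain ⟨c, hc⟩ := exists_coef hβ hmem
    rw [hc]
    apply Submodule.sum_mem
    intro x hx
    apply Submodule.smul_mem
    rw [PB, Finset.mem_filter] at hx
    obtain ⟨h1, h2, h3⟩ := LL_spec hx.2.2
    set u := tp x.2.1 (et x.1.1) * EL n (LL β x.2.1) with hu
    have hu1 : u ∈ SP n N := by
      apply Submodule.subset_span
      refine ⟨x, LL β x.2.1, hx.2.1, h1, ?_, rfl⟩
      have e1 := congrFun h2 ⟨n - 1, by omega⟩
      rw [Pi.add_apply, al_last _ hn, ← h3 hn] at e1
      have := hβN ⟨n - 1, by omega⟩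
      omega
    have hu2 : u - pj β u ∈ SP n N := by
      rw [eq_sum_mon (u - pj β u)]
      apply Submodule.sum_mem
      intro d hd
      apply Submodule.smul_mem
      rw [mem_support_cf, map_sub, cf_pj] at hd
      split_ifs at hd with hdO
      · simp at hd
      · rw [sub_zero] at hd
        have hdom : Dom (⇑d) β := by
          rw [h2]; exact uu_dom _ _ _ (fun s hs => (h1 s hs).2) hd
        rcases dom_sq hβ hdom with ⟨g, hg⟩ | hlt
        · exact absurd (mem_Orb.2 ⟨g, hg⟩) hdO
        · rw [hsq] at hlt
          exact ih _ hlt (⇑d) rfl fun i => hdom.le hβ i N hβN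
    have : ld β x.2.1 (et x.1.1) = u - (u - pj β u) := by rw [ld_eq, ← hu]; simp
    rw [this]
    exact Submodule.sub_mem _ hu1 hu2

lemma K_lemma (A : Finset ℕ) : ∀ (Lc : ℕ) (ρ : Multiset ℕ), (∀ s ∈ ρ, s ≤ Lc) →
    A.card = Lc + ρ.card → ∃ K ⊆ A, K.card = Lc ∧
      (A \ K).val.map (fun i => (K.filter fun j => j < i).card) = ρ := by
  induction A using Finset.induction_on_max with
  | empty =>
    intro Lc ρ _ h
    rw [Finset.card_empty] at h
    have : ρ = 0 := by rw [← Multiset.card_eq_zero]; omega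
    refine ⟨∅, le_rfl, ?_, ?_⟩
    · rw [Finset.card_empty]; omega
    · rw [this]; rfl
  | insert a A ha ih =>
    intro Lc ρ hρ hc
    have haA : a ∉ A := fun h => lt_irrefl _ (ha a h)
    rw [Finset.card_insert_of_notMem haA] at hc
    by_cases hL : Lc ∈ ρ
    · obtain ⟨ρ', rfl⟩ := Multiset.exists_cons_of_mem hL
      rw [Multiset.card_cons] at hc
      obtain ⟨K, h1, h2, h3⟩ := ih Lc ρ' (fun s hs => hρ s (Multiset.mem_cons_of_mem hs)) (by omega)
      have haK : a ∉ K := fun h => haA (h1 h)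
      refine ⟨K, h1.trans (Finset.subset_insert _ _), h2, ?_⟩
      rw [Finset.insert_sdiff_of_notMem _ haK, Finset.insert_val_of_notMem
        (fun h => haA (Finset.sdiff_subset h)), Multiset.map_cons, h3]
      congr 1
      rw [Finset.filter_true_of_mem (fun j hj => ha j (h1 hj)), h2]
    · have hlt : ∀ s ∈ ρ, s < Lc := fun s hs =>
        lt_of_le_of_ne (hρ s hs) fun he => hL (he ▸ hs)
      have hL0 : 0 < Lc := by
        rcases Nat.eq_zero_or_pos Lc with h0 | h0
        · exfalso
          have : ρ ≠ 0 := by intro he; rw [he] at hc; simp at hc; omega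
          obtain ⟨s, hs⟩ := Multiset.exists_mem_of_ne_zero this
          have := hlt s hs
          omega
        · exact h0
      obtain ⟨K, h1, h2, h3⟩ := ih (Lc - 1) ρ (fun s hs => by have := hlt s hs; omega) (by omega)
      have haK : a ∉ K := fun h => haA (h1 h)
      refine ⟨insert a K, Finset.insert_subset_insert _ h1, ?_, ?_⟩
      · rw [Finset.card_insert_of_notMem haK]; omega
      · have e : insert a A \ insert a K = A \ K := by
          ext j
          simp only [Finset.mem_sdiff, Finset.mem_insert]
          constructor
          · rintro ⟨h | h, h'⟩
            · exact absurd (Or.inl h) h'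
            · exact ⟨h, fun hh => h' (Or.inr hh)⟩
          · rintro ⟨h, h'⟩
            refine ⟨Or.inr h, ?_⟩
            rintro (hh | hh)
            · exact haA (hh ▸ h)
            · exact h' hh
        rw [e, ← h3]
        apply Multiset.map_congr rfl
        intro i hi
        have hiA : i ∈ A := Finset.sdiff_subset hi
        rw [Finset.filter_insert, if_neg (by have := ha i hiA; omega)]

def Dc {n : ℕ} (q : Fin n → ℕ × ℕ) : Finset ℕ := (Dset q).image fun i => n - i

lemma Dset_lt {n : ℕ} {q : Fin n → ℕ × ℕ} {j : ℕ} (h : j ∈ Dset q) : 0 < j ∧ j < n := by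
  rw [Dset, Finset.mem_filter, Finset.mem_Ioo] at h
  exact h.1

lemma Dc_sub {n : ℕ} (q : Fin n → ℕ × ℕ) : Dc q ⊆ Finset.Ioo 0 n := by
  intro j hj
  obtain ⟨i, hi, rfl⟩ := Finset.mem_image.1 hj
  have := Dset_lt hi
  rw [Finset.mem_Ioo]; omega

lemma mem_Dc {n : ℕ} {q : Fin n → ℕ × ℕ} {j : ℕ} (hj : j < n) (h0 : 0 < j) : n - j ∈ Dc q ↔ j ∈ Dset q := by
  rw [Dc, Finset.mem_image]
  constructor
  · rintro ⟨i, hi, he⟩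
    have := Dset_lt hi
    have : i = j := by omega
    rwa [← this]
  · intro h; exact ⟨j, h, rfl⟩

lemma Dc_card {n : ℕ} (q : Fin n → ℕ × ℕ) : (Dc q).card = (Dset q).card := by
  apply Finset.card_image_of_injOn
  intro i hi j hj he
  have := Dset_lt (Finset.mem_coe.1 hi)
  have := Dset_lt (Finset.mem_coe.1 hj)
  simp only at he
  omega

def EI (n : ℕ) (I : Finset ℕ) (q : Fin n → ℕ × ℕ) : Pn n := ∏ i ∈ I \ Dc q, esymFin n (rIdxI n I i)

def PI (n : ℕ) (I : Finset ℕ) : Finset (St n × St n) :=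
  Finset.univ.filter fun x => Set.range x.1.1 = Set.range x.2.1 ∧ Dc x.2.1 ⊆ I

def uI {n : ℕ} (I : Finset ℕ) (x : St n × St n) : Pn n := tp x.2.1 (et x.1.1) * EI n I x.2.1

def Ik (n k : ℕ) : Finset (Finset ℕ) := (Finset.Ioo 0 n).powersetCard (k - 1)

lemma esymFin_zero (n : ℕ) : esymFin n 0 = 1 := by simp [esymFin]

lemma exists_I {n k : ℕ} (hk : 1 ≤ k) (hkn : k ≤ n) (q : Fin n → ℕ × ℕ) (L : Multiset ℕ)
    (hL : ∀ s ∈ L, s ≤ n - k) (hc : L.card + (Dset q).card ≤ k - 1) :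
    ∃ I ∈ Ik n k, Dc q ⊆ I ∧ EI n I q = EL n L := by
  have hA : (Finset.Ioo 0 n \ Dc q).card = n - 1 - (Dset q).card := by
    rw [Finset.card_sdiff_of_subset (Dc_sub q), Dc_card, Nat.card_Ioo]; omega
  obtain ⟨K, h1, h2, h3⟩ := K_lemma (Finset.Ioo 0 n \ Dc q) (n - k)
    (L + Multiset.replicate (k - 1 - (Dset q).card - L.card) 0) (by
      intro s hs
      rcases Multiset.mem_add.1 hs with h | h
      · exact hL s h
      · rw [Multiset.eq_of_mem_replicate h]; omega) (by
      rw [hA, Multiset.card_add, Multiset.card_replicate]; omega)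
  have hKs : K ⊆ Finset.Ioo 0 n := h1.trans Finset.sdiff_subset
  have hdis : ∀ j ∈ Dc q, j ∉ K := fun j hj hk => (Finset.mem_sdiff.1 (h1 hk)).2 hj
  have e1 : Finset.Ioo 0 n \ (Finset.Ioo 0 n \ K) = K := by
    rw [Finset.sdiff_sdiff_eq_self hKs]
  have e2 : (Finset.Ioo 0 n \ K) \ Dc q = (Finset.Ioo 0 n \ Dc q) \ K := sdiff_right_comm _ _ _
  refine ⟨Finset.Ioo 0 n \ K, ?_, ?_, ?_⟩
  · rw [Ik, Finset.mem_powersetCard]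
    refine ⟨Finset.sdiff_subset, ?_⟩
    rw [Finset.card_sdiff_of_subset hKs, h2, Nat.card_Ioo]; omega
  · intro j hj
    exact Finset.mem_sdiff.2 ⟨Dc_sub q hj, hdis j hj⟩
  · have h4 : EI n (Finset.Ioo 0 n \ K) q =
        ((((Finset.Ioo 0 n \ Dc q) \ K).val.map (fun i => (K.filter fun j => j < i).card)).map
          (esymFin n)).prod := by
      rw [EI, e2, Finset.prod, Multiset.map_map]
      congr 1
      apply Multiset.map_congr rfl
      intro i _
      rw [Function.comp_apply, rIdxI, e1]
    rw [h4, h3, Multiset.map_add, Multiset.prod_add, Multiset.map_replicate, esymFin_zero,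
      Multiset.prod_replicate, one_pow, mul_one, EL]

def SI (n k : ℕ) : Submodule ℚ (Pn n) :=
  ⨆ I ∈ Ik n k, Submodule.span ℚ ((fun x => uI I x) '' (PI n I : Set (St n × St n)))

def Jm (n k : ℕ) : Submodule ℚ (Pn n) := (Jnk n k).restrictScalars ℚ

lemma span_all {n k : ℕ} (hn : 1 ≤ n) (hk : 1 ≤ k) (hkn : k ≤ n) : Jm n k ⊔ SI n k = ⊤ := by
  rw [eq_top_iff]
  intro p _
  rw [eq_sum_mon p]
  apply Submodule.sum_mem
  intro d _
  apply Submodule.smul_mem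
  by_cases hd : ∃ i, k ≤ d i
  · apply Submodule.mem_sup_left
    obtain ⟨i, hi⟩ := hd
    show mon (⇑d) ∈ Jnk n k
    have hX : (X i : Pn n) ^ k ∈ Jnk n k := Ideal.subset_span (Or.inl ⟨i, rfl⟩)
    have : mon (⇑d) = mon (⇑(d - Finsupp.single i k)) * (X i : Pn n) ^ k := by
      rw [mon, mon, fs_coe, fs_coe, X_pow_eq_monomial, monomial_mul, mul_one]
      congr 1
      rw [tsub_add_cancel_of_le]
      rwa [Finsupp.single_le_iff]
    rw [this]
    exact Ideal.mul_mem_left _ _ hX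
  · push Not at hd
    have h1 : mon (⇑d) ∈ SP n (k - 1) :=
      mon_mem_SP hn _ _ rfl fun i => by have := hd i; omega
    have h2 : SP n (k - 1) ≤ Jm n k ⊔ SI n k := by
      rw [SP, Submodule.span_le]
      rintro _ ⟨x, L, hr, hL, hc, rfl⟩
      by_cases hs : ∃ s ∈ L, n - k < s
      · apply Submodule.mem_sup_left
        obtain ⟨s, hs, hlt⟩ := hs
        obtain ⟨L', rfl⟩ := Multiset.exists_cons_of_mem hs
        show _ ∈ Jnk n k
        rw [EL, Multiset.map_cons, Multiset.prod_cons]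
        apply Ideal.mul_mem_left
        apply Ideal.mul_mem_right
        exact Ideal.subset_span (Or.inr ⟨s, by omega, (hL s hs).2, rfl⟩)
      · push Not at hs
        apply Submodule.mem_sup_right
        obtain ⟨I, hI, h3, h4⟩ := exists_I hk hkn x.2.1 L hs hc
        have h5 : tp x.2.1 (et x.1.1) * EL n L ∈
            Submodule.span ℚ ((fun x => uI I x) '' (PI n I : Set (St n × St n))) := by
          apply Submodule.subset_span
          refine ⟨x, ?_, ?_⟩
          · rw [Finset.mem_coe, PI, Finset.mem_filter]; exact ⟨Finset.mem_univ _, hr, h3⟩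
          · simp only [uI, h4]
        exact (le_iSup₂_of_le (f := fun I (_ : I ∈ Ik n k) => Submodule.span ℚ
          ((fun x => uI I x) '' (PI n I : Set (St n × St n)))) I hI le_rfl) h5
    exact h2 h1

/-! the exponent vector of I -/
def bI (n : ℕ) (I : Finset ℕ) : Fin n → ℕ := fun i => (I.filter fun s => n ≤ (i : ℕ) + s).card

lemma bI_mono (n : ℕ) (I : Finset ℕ) : Monotone (bI n I) := by
  intro i j hij
  apply Finset.card_le_card
  intro s hs
  rw [Finset.mem_filter] at hs ⊢
  have : (i : ℕ) ≤ j := hij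
  exact ⟨hs.1, by omega⟩

lemma bI_step {n : ℕ} {I : Finset ℕ} (j : ℕ) (hj : j < n) (h0 : 0 < j) :
    bI n I ⟨j, hj⟩ = bI n I ⟨j - 1, by omega⟩ + if n - j ∈ I then 1 else 0 := by
  unfold bI
  simp only
  split_ifs with h
  · have : (I.filter fun s => n ≤ j + s) = insert (n - j) (I.filter fun s => n ≤ j - 1 + s) := by
      ext s
      simp only [Finset.mem_filter, Finset.mem_insert]
      constructor
      · rintro ⟨h1, h2⟩
        by_cases he : s = n - j
        · exact Or.inl he
        · exact Or.inr ⟨h1, by omega⟩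
      · rintro (h1 | ⟨h1, h2⟩)
        · exact ⟨h1 ▸ h, by omega⟩
        · exact ⟨h1, by omega⟩
    rw [this, Finset.card_insert_of_notMem]
    rw [Finset.mem_filter]
    omega
  · rw [add_zero]
    congr 1
    ext s
    simp only [Finset.mem_filter]
    constructor
    · rintro ⟨h1, h2⟩
      refine ⟨h1, ?_⟩
      have : s ≠ n - j := fun he => h (he ▸ h1)
      omega
    · rintro ⟨h1, h2⟩
      exact ⟨h1, by omega⟩

lemma Lin.row_Dset {n : ℕ} {q : Fin n → ℕ × ℕ} (j : ℕ) (hj : j < n) (hD : j ∈ Dset q) :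
    al q ⟨j - 1, by omega⟩ < al q ⟨j, hj⟩ := by
  have h0 := Dset_lt hD
  unfold al
  apply Finset.card_lt_card
  rw [Finset.ssubset_iff_of_subset]
  · refine ⟨j, ?_, ?_⟩
    · rw [Finset.mem_filter]; exact ⟨hD, le_rfl⟩
    · rw [Finset.mem_filter]; simp only; omega
  · intro i hi
    rw [Finset.mem_filter] at hi ⊢
    simp only at hi ⊢
    exact ⟨hi.1, by omega⟩

lemma leB_bI {n : ℕ} {I : Finset ℕ} (q : Fin n → ℕ × ℕ) : LeB q (bI n I) ↔ Dc q ⊆ I := by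
  constructor
  · rintro ⟨δ, h1, h2⟩ s hs
    obtain ⟨j, hj, rfl⟩ := Finset.mem_image.1 hs
    have h0 := Dset_lt hj
    have h3 := Lin.row_Dset j h0.2 hj
    have h4 := bI_step (n := n) (I := I) j h0.2 h0.1
    have h5 : δ ⟨j - 1, by omega⟩ ≤ δ ⟨j, h0.2⟩ := h1 (by simp [Fin.le_def])
    rw [h2, Pi.add_apply, Pi.add_apply] at h4
    by_contra hno
    rw [if_neg hno] at h4
    omega
  · intro h
    apply leB_of (bI_mono n I)
    intro j hj hD
    have h0 := Dset_lt hD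
    rw [bI_step j hj h0.1, if_pos (h ((mem_Dc hj h0.1).2 hD))]
    omega

lemma PI_eq {n : ℕ} (I : Finset ℕ) : PI n I = PB (bI n I) := by
  unfold PI PB
  simp only [leB_bI]

/-! ### Orbit harmonics -/

/-- surjections onto `{0, …, k-1}` -/
def XS (n k : ℕ) : Finset (Fin n → ℕ) :=
  (Fintype.piFinset fun _ => Finset.range k).filter fun x => ∀ j < k, ∃ i, x i = j

lemma mem_XS {n k : ℕ} {x : Fin n → ℕ} : x ∈ XS n k ↔ (∀ i, x i < k) ∧ ∀ j < k, ∃ i, x i = j := by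
  simp [XS, Fintype.mem_piFinset]

def evx (n k : ℕ) : Pn n →ₐ[ℚ] (↥(XS n k) → ℚ) :=
  Pi.algHom ℚ _ fun x => aeval fun i => ((x.1 i : ℕ) : ℚ)

lemma evx_apply {n k : ℕ} (p : Pn n) (x : ↥(XS n k)) :
    evx n k p x = aeval (fun i => ((x.1 i : ℕ) : ℚ)) p := rfl

lemma evx_surj (n k : ℕ) : Function.Surjective (evx n k) := by
  intro f
  let D : ↥(XS n k) → Pn n := fun x => ∏ i, ∏ j ∈ (Finset.range k).erase (x.1 i), (X i - C (j : ℚ))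
  have hD : ∀ x y, evx n k (D x) y = ∏ i, ∏ j ∈ (Finset.range k).erase (x.1 i),
      (((y.1 i : ℕ) : ℚ) - (j : ℚ)) := by
    intro x y
    rw [evx_apply]
    simp only [D, map_prod, map_sub, aeval_X, aeval_C, Algebra.algebraMap_self, RingHom.id_apply]
  have h0 : ∀ x, evx n k (D x) x ≠ 0 := by
    intro x
    rw [hD]
    refine Finset.prod_ne_zero_iff.2 fun i _ => Finset.prod_ne_zero_iff.2 fun j hj => ?_
    rw [sub_ne_zero]
    intro h
    exact (Finset.mem_erase.1 hj).1 (by exact_mod_cast h.symm)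
  have h1 : ∀ x y, x ≠ y → evx n k (D x) y = 0 := by
    intro x y hxy
    rw [hD]
    have : ∃ i, x.1 i ≠ y.1 i := by
      by_contra h
      push Not at h
      exact hxy (Subtype.ext (funext h))
    obtain ⟨i, hi⟩ := this
    apply Finset.prod_eq_zero (Finset.mem_univ i)
    apply Finset.prod_eq_zero (i := y.1 i)
    · exact Finset.mem_erase.2 ⟨fun h => hi h.symm, Finset.mem_range.2 ((mem_XS.1 y.2).1 i)⟩
    · simp
  refine ⟨∑ x, (f x / evx n k (D x) x) • D x, ?_⟩
  funext y
  rw [map_sum, Finset.sum_apply, Finset.sum_eq_single y]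
  · rw [map_smul, Pi.smul_apply, smul_eq_mul, div_mul_cancel₀ _ (h0 y)]
  · intro x _ hx
    rw [map_smul, Pi.smul_apply, h1 x y hx, smul_zero]
  · intro h; exact absurd (Finset.mem_univ _) h

def KX (n k : ℕ) : Submodule ℚ (Pn n) := LinearMap.ker (evx n k).toLinearMap

lemma mem_KX {n k : ℕ} {p : Pn n} : p ∈ KX n k ↔ evx n k p = 0 := Iff.rfl

def Wd (n d : ℕ) : Submodule ℚ (Pn n) := Submodule.span ℚ {p | ∃ e < d, IsHomogeneous p e}

lemma mul_Wd {n e r : ℕ} {a g : Pn n} (ha : IsHomogeneous a e) (hg : g ∈ Wd n r) :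
    a * g ∈ Wd n (e + r) := by
  induction hg using Submodule.span_induction with
  | mem x hx =>
    obtain ⟨f, hf, hx⟩ := hx
    exact Submodule.subset_span ⟨e + f, by omega, ha.mul hx⟩
  | zero => rw [mul_zero]; exact zero_mem _
  | add x y _ _ h1 h2 => rw [mul_add]; exact add_mem h1 h2
  | smul c x _ h => rw [mul_smul_comm]; exact Submodule.smul_mem _ _ h

lemma mon_hom {n : ℕ} (b : Fin n → ℕ) : IsHomogeneous (mon b) (∑ i, b i) := by
  apply isHomogeneous_monomial
  rw [Finsupp.degree_eq_sum]; rfl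

lemma esymFin_hom (n r : ℕ) : IsHomogeneous (esymFin n r) r := by
  unfold esymFin
  apply IsHomogeneous.sum
  intro s hs
  have h := IsHomogeneous.prod s (fun i : Fin n => (X i : Pn n)) (fun _ => 1) fun i _ => isHomogeneous_X ℚ i
  rw [Finset.sum_const, smul_eq_mul, mul_one, (Finset.mem_powersetCard.1 hs).2] at h
  exact h

/-- coefficients of the inverse of `∏ (1 + j t)` -/
def Apoly (k : ℕ) : Polynomial ℚ := ∏ j ∈ Finset.range k, (1 + Polynomial.C (j : ℚ) * Polynomial.X)

lemma coeff_prod_gen {n : ℕ} (x : Fin n → ℕ) (m : ℕ) :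
    (∏ i, (1 + Polynomial.C ((x i : ℕ) : ℚ) * Polynomial.X)).coeff m =
      aeval (fun i => ((x i : ℕ) : ℚ)) (esymFin n m) := by
  rw [Finset.prod_one_add, Polynomial.finsetSum_coeff, esymFin, map_sum]
  simp only [map_prod, aeval_X]
  have h : ∀ s : Finset (Fin n), (∏ i ∈ s, (Polynomial.C ((x i : ℕ) : ℚ) * Polynomial.X)).coeff m =
      if s.card = m then ∏ i ∈ s, ((x i : ℕ) : ℚ) else 0 := by
    intro s
    rw [Finset.prod_mul_distrib, Finset.prod_const, ← map_prod, Polynomial.coeff_C_mul_X_pow]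
    simp only [eq_comm]
  simp only [h]
  rw [← Finset.sum_filter]
  apply Finset.sum_congr _ fun _ _ => rfl
  ext s
  simp [Finset.mem_powersetCard]

lemma gen_esym {n k r : ℕ} (hkn : k ≤ n) (hr : n - k + 1 ≤ r) :
    esymFin n r ∈ KX n k ⊔ Wd n r := by
  let A : PowerSeries ℚ := (Apoly k : PowerSeries ℚ)
  have hA0 : PowerSeries.constantCoeff A = 1 := by
    simp [A, Apoly, Polynomial.coeff_zero_eq_eval_zero, Polynomial.eval_prod,
      ← PowerSeries.coeff_zero_eq_constantCoeff_apply, Polynomial.coeff_coe]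
  let hc : ℕ → ℚ := fun m => PowerSeries.coeff m A⁻¹
  have hc0 : hc 0 = 1 := by
    simp only [hc, PowerSeries.coeff_zero_eq_constantCoeff_apply, PowerSeries.constantCoeff_inv, hA0, inv_one]
  let g : Pn n := ∑ m ∈ Finset.HasAntidiagonal.antidiagonal r, hc m.1 • esymFin n m.2
  have hg : g ∈ KX n k := by
    rw [mem_KX]
    funext x
    rw [evx_apply, map_sum]
    simp only [map_smul, ← coeff_prod_gen, smul_eq_mul]
    obtain ⟨h1, h2⟩ := mem_XS.1 x.2
    choose s hs using h2
    let sec : Finset (Fin n) := (Finset.range k).attach.image fun j => s j.1 (Finset.mem_range.1 j.2)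
    have hinj : Function.Injective fun j : ↥(Finset.range k) => s j.1 (Finset.mem_range.1 j.2) := by
      intro a b hab
      simp only at hab
      apply Subtype.ext
      rw [← hs a.1 (Finset.mem_range.1 a.2), hab, hs]
    have hcard : sec.card = k := by
      rw [Finset.card_image_of_injective _ hinj, Finset.card_attach, Finset.card_range]
    let B : Polynomial ℚ := ∏ i, (1 + Polynomial.C ((x.1 i : ℕ) : ℚ) * Polynomial.X)
    let Rp : Polynomial ℚ := ∏ i ∈ secᶜ, (1 + Polynomial.C ((x.1 i : ℕ) : ℚ) * Polynomial.X)
    have hB : B = Apoly k * Rp := by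
      simp only [B, Rp]
      rw [← Finset.prod_mul_prod_compl sec]
      congr 1
      rw [Finset.prod_image (fun a _ b _ h => hinj h), Apoly, ← Finset.prod_attach (Finset.range k)]
      apply Finset.prod_congr rfl
      intro j _
      rw [hs]
    have hR : Rp.natDegree ≤ n - k := by
      refine (Polynomial.natDegree_prod_le _ _).trans ?_
      refine (Finset.sum_le_card_nsmul _ _ 1 ?_).trans ?_
      · intro i _
        compute_degree
      · rw [Finset.card_compl, hcard, Fintype.card_fin]; simp
    have e : PowerSeries.coeff r (A⁻¹ * (B : PowerSeries ℚ)) = 0 := by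
      have hAB : A⁻¹ * (B : PowerSeries ℚ) = (Rp : PowerSeries ℚ) := by
        rw [hB, Polynomial.coe_mul, ← mul_assoc, PowerSeries.inv_mul_cancel A (by rw [hA0]; exact one_ne_zero),
          one_mul]
      rw [hAB, Polynomial.coeff_coe]
      exact Polynomial.coeff_eq_zero_of_natDegree_lt (by omega)
    rw [PowerSeries.coeff_mul] at e
    simp only [Polynomial.coeff_coe] at e
    exact e
  have e : esymFin n r = g + (esymFin n r - g) := by ring
  rw [e]
  refine add_mem (Submodule.mem_sup_left hg) (Submodule.mem_sup_right ?_)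
  have hm : ((0, r) : ℕ × ℕ) ∈ Finset.HasAntidiagonal.antidiagonal r := by simp
  have : esymFin n r - g = - ∑ m ∈ (Finset.HasAntidiagonal.antidiagonal r).erase (0, r), hc m.1 • esymFin n m.2 := by
    simp only [g]
    rw [← Finset.add_sum_erase _ _ hm, hc0, one_smul]
    abel
  rw [this]
  apply neg_mem
  apply Submodule.sum_mem
  intro m hm
  apply Submodule.smul_mem
  apply Submodule.subset_span
  rw [Finset.mem_erase, Finset.HasAntidiagonal.mem_antidiagonal] at hm
  refine ⟨m.2, ?_, esymFin_hom n m.2⟩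
  rcases Nat.eq_zero_or_pos m.1 with h | h
  · exfalso; apply hm.1; ext <;> simp <;> omega
  · omega

lemma prod_sub_mem {n : ℕ} (i : Fin n) (k : ℕ) :
    (X i : Pn n) ^ k - ∏ j ∈ Finset.range k, (X i - C (j : ℚ)) ∈ Wd n k := by
  induction k with
  | zero => simp
  | succ k ih =>
    have e : (X i : Pn n) ^ (k + 1) - ∏ j ∈ Finset.range (k + 1), (X i - C (j : ℚ)) =
        X i * (X i ^ k - ∏ j ∈ Finset.range k, (X i - C (j : ℚ))) +
          (C (k : ℚ) * X i ^ k - C (k : ℚ) * (X i ^ k - ∏ j ∈ Finset.range k, (X i - C (j : ℚ)))) := by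
      rw [Finset.prod_range_succ]; ring
    have hX : IsHomogeneous (X i : Pn n) 1 := isHomogeneous_X ℚ i
    have hC : IsHomogeneous (C (k : ℚ) : Pn n) 0 := isHomogeneous_C _ _
    have hle : Wd n k ≤ Wd n (k + 1) := by
      apply Submodule.span_mono
      rintro p ⟨e, he, hp⟩
      exact ⟨e, by omega, hp⟩
    rw [e]
    refine add_mem ?_ (sub_mem ?_ ?_)
    · have := mul_Wd hX ih
      rwa [add_comm] at this
    · apply Submodule.subset_span
      refine ⟨k, by omega, ?_⟩
      have := hC.mul (hX.pow k)
      simpa using this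
    · have := mul_Wd hC ih
      rw [zero_add] at this
      exact hle this

lemma gen_pow {n k : ℕ} (i : Fin n) : (X i : Pn n) ^ k ∈ KX n k ⊔ Wd n k := by
  have e : (X i : Pn n) ^ k = ∏ j ∈ Finset.range k, (X i - C (j : ℚ)) +
    (X i ^ k - ∏ j ∈ Finset.range k, (X i - C (j : ℚ))) := by ring
  rw [e]
  refine add_mem (Submodule.mem_sup_left ?_) (Submodule.mem_sup_right (prod_sub_mem i k))
  rw [mem_KX]
  funext x
  rw [evx_apply, map_prod]
  apply Finset.prod_eq_zero (i := x.1 i) (Finset.mem_range.2 ((mem_XS.1 x.2).1 i))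
  simp

lemma mul_KW {n k e r : ℕ} {a g : Pn n} (ha : IsHomogeneous a e) (hg : g ∈ KX n k ⊔ Wd n r) :
    a * g ∈ KX n k ⊔ Wd n (e + r) := by
  obtain ⟨g1, h1, g2, h2, rfl⟩ := Submodule.mem_sup.1 hg
  rw [mul_add]
  refine add_mem (Submodule.mem_sup_left ?_) (Submodule.mem_sup_right (mul_Wd ha h2))
  rw [mem_KX] at h1 ⊢
  rw [map_mul, h1, mul_zero]

lemma hc_gen {n k r : ℕ} {g : Pn n} (hg : IsHomogeneous g r) (h : g ∈ KX n k ⊔ Wd n r) (a : Pn n) (d : ℕ) :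
    homogeneousComponent d (a * g) ∈ KX n k ⊔ Wd n d := by
  rw [eq_sum_mon a, Finset.sum_mul, map_sum]
  apply Submodule.sum_mem
  intro m _
  rw [smul_mul_assoc, map_smul]
  apply Submodule.smul_mem
  have h1 := (mon_hom (n := n) ⇑m).mul hg
  rw [homogeneousComponent_of_mem ((mem_homogeneousSubmodule _ _).2 h1)]
  split_ifs with hd
  · rw [hd]; exact mul_KW (mon_hom _) h
  · exact zero_mem _

lemma hc_J {n k : ℕ} (hkn : k ≤ n) {h : Pn n} (hh : h ∈ Jm n k) (d : ℕ) :
    homogeneousComponent d h ∈ KX n k ⊔ Wd n d := by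
  have hh' : h ∈ Jnk n k := hh
  have key : ∀ a : Pn n, homogeneousComponent d (a * h) ∈ KX n k ⊔ Wd n d := by
    unfold Jnk at hh'
    induction hh' using Submodule.span_induction with
    | mem x hx =>
      intro a
      rcases hx with ⟨i, rfl⟩ | ⟨r, h1, h2, rfl⟩
      · refine hc_gen (r := k) ?_ (gen_pow i) a d
        have := (isHomogeneous_X ℚ i).pow k
        simpa using this
      · exact hc_gen (esymFin_hom n r) (gen_esym hkn h1) a d
    | zero => intro a; rw [mul_zero, map_zero]; exact zero_mem _
    | add x y _ _ h1 h2 =>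
      intro a
      rw [mul_add, map_add]
      exact add_mem (h1 (by assumption) a) (h2 (by assumption) a)
    | smul c x _ h1 =>
      intro a
      rw [smul_eq_mul, ← mul_assoc]
      exact h1 (by assumption) _
  simpa using key 1

/-! ### The basis modulo the ideal -/

lemma span_coef {ι M : Type*} [AddCommGroup M] [Module ℚ M] (A : Finset ι) (f : ι → M) {x : M}
    (hx : x ∈ Submodule.span ℚ (f '' (A : Set ι))) : ∃ c : ι → ℚ, ∑ y ∈ A, c y • f y = x := by
  rw [Submodule.mem_span_image_finset_iff_exists_fun] at hx
  obtain ⟨c, rfl⟩ := hx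
  refine ⟨fun y => if h : y ∈ A then c ⟨y, h⟩ else 0, ?_⟩
  rw [← Finset.sum_coe_sort]
  apply Finset.sum_congr rfl
  rintro ⟨y, hy⟩ _
  simp [hy]

lemma bI_lt {n k : ℕ} (hk : 1 ≤ k) {I : Finset ℕ} (hI : I ∈ Ik n k) (i : Fin n) : bI n I i < k := by
  have h1 := (Finset.mem_powersetCard.1 hI).2
  have : bI n I i ≤ I.card := Finset.card_le_card (Finset.filter_subset _ _)
  omega

lemma bI_zero {n : ℕ} {I : Finset ℕ} (hI : I ⊆ Finset.Ioo 0 n) (h : 0 < n) : bI n I ⟨0, h⟩ = 0 := by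
  rw [bI, Finset.card_eq_zero, Finset.filter_eq_empty_iff]
  intro s hs
  have := Finset.mem_Ioo.1 (hI hs)
  simp only; omega

lemma bI_last {n : ℕ} {I : Finset ℕ} (hI : I ⊆ Finset.Ioo 0 n) (h : 0 < n) :
    bI n I ⟨n - 1, by omega⟩ = I.card := by
  rw [bI, Finset.filter_true_of_mem]
  intro s hs
  have := Finset.mem_Ioo.1 (hI hs)
  simp only; omega

lemma bI_ivt {n : ℕ} {I : Finset ℕ} (hI : I ⊆ Finset.Ioo 0 n) (i : ℕ) :
    ∀ (hi : i < n), ∀ v ≤ bI n I ⟨i, hi⟩, ∃ j, bI n I j = v := by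
  induction i with
  | zero =>
    intro hi v hv
    rw [bI_zero hI] at hv
    exact ⟨⟨0, hi⟩, by rw [bI_zero hI]; omega⟩
  | succ i ih =>
    intro hi v hv
    by_cases h : v = bI n I ⟨i + 1, hi⟩
    · exact ⟨_, h.symm⟩
    · apply ih (by omega)
      have := bI_step (I := I) (i + 1) hi (by omega)
      simp only [Nat.add_sub_cancel] at this
      split_ifs at this <;> omega

lemma bI_mem_XS {n k : ℕ} (hn : 1 ≤ n) (hk : 1 ≤ k) {I : Finset ℕ} (hI : I ∈ Ik n k) : bI n I ∈ XS n k := by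
  refine mem_XS.2 ⟨bI_lt hk hI, fun j hj => ?_⟩
  obtain ⟨h1, h2⟩ := Finset.mem_powersetCard.1 hI
  apply bI_ivt h1 (n - 1) (by omega)
  rw [bI_last h1 (by omega)]; omega

lemma bI_inj {n : ℕ} {I J : Finset ℕ} (hI : I ⊆ Finset.Ioo 0 n) (hJ : J ⊆ Finset.Ioo 0 n)
    (h : bI n I = bI n J) : I = J := by
  have key : ∀ s, 0 < s → s < n → (s ∈ I ↔ s ∈ J) := by
    intro s h0 hs
    have h1 := bI_step (I := I) (n - s) (by omega : n - s < n) (by omega)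
    have h2 := bI_step (I := J) (n - s) (by omega : n - s < n) (by omega)
    rw [h] at h1
    have e : n - (n - s) = s := by omega
    rw [e] at h1 h2
    by_cases a : s ∈ I <;> by_cases b : s ∈ J <;> simp [a, b] at h1 h2 ⊢ <;> omega
  ext s
  constructor
  · intro hs
    have := Finset.mem_Ioo.1 (hI hs)
    exact (key s this.1 this.2).1 hs
  · intro hs
    have := Finset.mem_Ioo.1 (hJ hs)
    exact (key s this.1 this.2).2 hs

lemma Orb_sub_XS {n k : ℕ} {b : Fin n → ℕ} (hb : b ∈ XS n k) : Orb b ⊆ XS n k := by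
  intro c hc
  obtain ⟨g, rfl⟩ := mem_Orb.1 hc
  obtain ⟨h1, h2⟩ := mem_XS.1 hb
  refine mem_XS.2 ⟨fun i => h1 _, fun j hj => ?_⟩
  obtain ⟨i, hi⟩ := h2 j hj
  exact ⟨g⁻¹ i, by simpa using hi⟩

lemma Orb_disj {n : ℕ} {b c : Fin n → ℕ} (hb : Monotone b) (hc : Monotone c) {x : Fin n → ℕ}
    (h1 : x ∈ Orb b) (h2 : x ∈ Orb c) : b = c := by
  obtain ⟨g, rfl⟩ := mem_Orb.1 h1
  obtain ⟨h, hh⟩ := mem_Orb.1 h2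
  have e : b ∘ (g * h⁻¹) = c := by
    funext i
    have := congrFun hh (h⁻¹ i)
    simpa using this
  have := Tuple.unique_monotone (f := b) (σ := 1) (τ := g * h⁻¹) hb (by rw [e]; exact hc)
  rw [e] at this
  exact this

def UF (n k : ℕ) : Finset (Σ _ : Finset ℕ, St n × St n) := (Ik n k).sigma fun I => PI n I

def uu {n : ℕ} (y : Σ _ : Finset ℕ, St n × St n) : Pn n := uI y.1 y.2

lemma card_UF_le {n k : ℕ} (hn : 1 ≤ n) (hk : 1 ≤ k) : (UF n k).card ≤ (XS n k).card := by
  rw [UF, Finset.card_sigma]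
  have h1 : ∀ I ∈ Ik n k, (PI n I).card = (Orb (bI n I)).card := by
    intro I _
    rw [PI_eq]; exact (card_Orb_eq (bI_mono n I)).1.symm
  rw [Finset.sum_congr rfl h1, ← Finset.card_biUnion]
  · apply Finset.card_le_card
    intro x hx
    obtain ⟨I, hI, hx⟩ := Finset.mem_biUnion.1 hx
    exact Orb_sub_XS (bI_mem_XS hn hk hI) hx
  · intro I hI J hJ hne
    refine Finset.disjoint_left.2 ?_
    intro x h1 h2
    exact hne (bI_inj (Finset.mem_powersetCard.1 hI).1 (Finset.mem_powersetCard.1 hJ).1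
      (Orb_disj (bI_mono n I) (bI_mono n J) h1 h2))

def dg {n : ℕ} (y : Σ _ : Finset ℕ, St n × St n) : ℕ :=
  ∑ i, al y.2.2.1 i + ∑ i ∈ y.1 \ Dc y.2.2.1, rIdxI n y.1 i

lemma uu_hom {n : ℕ} (y : Σ _ : Finset ℕ, St n × St n) : IsHomogeneous (uu y) (dg y) := by
  unfold uu uI dg
  apply IsHomogeneous.mul
  · rw [tp, th_apply]
    apply IsHomogeneous.sum
    intro σ _
    rw [smul_eq_C_mul, ← zero_add (∑ i, al y.2.2.1 i)]
    apply (isHomogeneous_C _ _).mul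
    rw [ren_apply]
    exact (mon_hom _).rename_isHomogeneous
  · exact IsHomogeneous.prod _ _ _ fun i _ => esymFin_hom _ _

lemma SI_eq (n k : ℕ) : SI n k = Submodule.span ℚ (uu '' (UF n k : Set _)) := by
  apply le_antisymm
  · unfold SI
    refine iSup₂_le fun I hI => ?_
    rw [Submodule.span_le]
    rintro _ ⟨x, hx, rfl⟩
    exact Submodule.subset_span ⟨⟨I, x⟩, Finset.mem_coe.2 (Finset.mem_sigma.2 ⟨hI, hx⟩), rfl⟩
  · rw [Submodule.span_le]
    rintro _ ⟨⟨I, x⟩, hx, rfl⟩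
    obtain ⟨h1, h2⟩ := Finset.mem_sigma.1 (Finset.mem_coe.1 hx)
    exact (le_iSup₂_of_le (f := fun I (_ : I ∈ Ik n k) => Submodule.span ℚ
          ((fun x => uI I x) '' (PI n I : Set (St n × St n)))) I h1 le_rfl)
          (Submodule.subset_span ⟨x, h2, rfl⟩)

lemma hc_sum {n : ℕ} (A : Finset (Σ _ : Finset ℕ, St n × St n)) (c : (Σ _ : Finset ℕ, St n × St n) → ℚ) (d : ℕ) :
    homogeneousComponent d (∑ y ∈ A, c y • uu y) = ∑ y ∈ A.filter (fun y => dg y = d), c y • uu y := by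
  rw [map_sum, Finset.sum_filter]
  apply Finset.sum_congr rfl
  intro y _
  rw [map_smul, homogeneousComponent_of_mem ((mem_homogeneousSubmodule _ _).2 (uu_hom y))]
  by_cases h : dg y = d
  · rw [if_pos h.symm, if_pos h]
  · rw [if_neg (fun e => h e.symm), if_neg h, smul_zero]

def SD (n k d : ℕ) : Submodule ℚ (Pn n) := Submodule.span ℚ (uu '' {y | y ∈ UF n k ∧ dg y < d})

lemma Wd_le {n k : ℕ} (hn : 1 ≤ n) (hk : 1 ≤ k) (hkn : k ≤ n) (d : ℕ) : Wd n d ≤ KX n k ⊔ SD n k d := by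
  induction d with
  | zero =>
    rw [Wd, Submodule.span_le]
    rintro p ⟨e, he, _⟩; omega
  | succ d ih =>
    have hm : SD n k d ≤ SD n k (d + 1) := by
      apply Submodule.span_mono
      apply Set.image_mono
      rintro y ⟨h1, h2⟩
      exact ⟨h1, by omega⟩
    have ih' : Wd n d ≤ KX n k ⊔ SD n k (d + 1) := ih.trans (sup_le_sup_left hm _)
    rw [Wd, Submodule.span_le]
    rintro p ⟨e, he, hp⟩
    by_cases hed : e < d
    · exact ih' (Submodule.subset_span ⟨e, hed, hp⟩)
    have hed : e = d := by omega
    subst hed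
    have hpt : p ∈ Jm n k ⊔ SI n k := by rw [span_all hn hk hkn]; trivial
    obtain ⟨h, hh, s, hs, hps⟩ := Submodule.mem_sup.1 hpt
    rw [SI_eq] at hs
    obtain ⟨c, rfl⟩ := span_coef _ _ hs
    have e1 : p = homogeneousComponent e h + ∑ y ∈ (UF n k).filter (fun y => dg y = e), c y • uu y := by
      rw [← hc_sum, ← map_add, hps, homogeneousComponent_eq_self hp]
    rw [e1]
    refine add_mem ?_ (Submodule.mem_sup_right ?_)
    · have := hc_J hkn hh e
      exact (sup_le le_sup_left ih') this
    · apply Submodule.sum_mem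
      intro y hy
      rw [Finset.mem_filter] at hy
      exact Submodule.smul_mem _ _ (Submodule.subset_span ⟨y, ⟨hy.1, by omega⟩, rfl⟩)

lemma exists_Wd {n : ℕ} (p : Pn n) : ∃ d, p ∈ Wd n d := by
  refine ⟨p.totalDegree + 1, ?_⟩
  rw [← sum_homogeneousComponent p]
  apply Submodule.sum_mem
  intro i hi
  exact Submodule.subset_span ⟨i, by rw [sum_homogeneousComponent]; exact Finset.mem_range.1 hi, homogeneousComponent_isHomogeneous _ _⟩

lemma ev_li {n k : ℕ} (hn : 1 ≤ n) (hk : 1 ≤ k) (hkn : k ≤ n) :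
    LinearIndependent ℚ fun y : ↥(UF n k) => evx n k (uu y.1) := by
  have hspan : ⊤ ≤ Submodule.span ℚ (Set.range fun y : ↥(UF n k) => evx n k (uu y.1)) := by
    intro f _
    obtain ⟨p, rfl⟩ := evx_surj n k f
    obtain ⟨d, hd⟩ := exists_Wd p
    obtain ⟨g, hg, s, hs, rfl⟩ := Submodule.mem_sup.1 (Wd_le hn hk hkn d hd)
    rw [mem_KX] at hg
    rw [map_add, hg, zero_add]
    have h2 : (evx n k).toLinearMap s ∈ (SD n k d).map (evx n k).toLinearMap := Submodule.mem_map_of_mem hs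
    rw [SD, Submodule.map_span] at h2
    refine Submodule.span_mono ?_ h2
    rintro _ ⟨_, ⟨y, hy, rfl⟩, rfl⟩
    exact ⟨⟨y, hy.1⟩, rfl⟩
  apply linearIndependent_of_top_le_span_of_card_eq_finrank hspan
  have h1 : Module.finrank ℚ (↥(XS n k) → ℚ) = (XS n k).card := by
    rw [Module.finrank_fintype_fun_eq_card, Fintype.card_coe]
  have h2 := finrank_range_le_card (R := ℚ) fun y : ↥(UF n k) => evx n k (uu y.1)
  rw [Set.finrank, top_le_iff.1 hspan, finrank_top] at h2
  rw [h1] at h2 ⊢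
  rw [Fintype.card_coe] at h2 ⊢
  exact le_antisymm (card_UF_le hn hk) h2

/-- the polynomials `uu y` are linearly independent modulo the ideal -/
lemma mod_indep {n k : ℕ} (hn : 1 ≤ n) (hk : 1 ≤ k) (hkn : k ≤ n)
    (c : (Σ _ : Finset ℕ, St n × St n) → ℚ) (h : ∑ y ∈ UF n k, c y • uu y ∈ Jm n k) :
    ∀ y ∈ UF n k, c y = 0 := by
  intro y0 hy0
  have h1 := hc_J hkn h (dg y0)
  rw [hc_sum] at h1
  have h2 := (sup_le le_sup_left (Wd_le hn hk hkn _) : KX n k ⊔ Wd n (dg y0) ≤ KX n k ⊔ SD n k (dg y0)) h1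
  obtain ⟨g, hg, s, hs, he⟩ := Submodule.mem_sup.1 h2
  have hset : {y | y ∈ UF n k ∧ dg y < dg y0} = (((UF n k).filter fun y => dg y < dg y0 : Finset _) : Set _) := by
    ext y; simp
  rw [SD, hset] at hs
  obtain ⟨b, rfl⟩ := span_coef _ _ hs
  rw [mem_KX] at hg
  have h3 := congrArg (evx n k) he
  rw [map_add, hg, zero_add, map_sum, map_sum] at h3
  have hli := ev_li hn hk hkn
  rw [Fintype.linearIndependent_iff] at hli
  have h4 := hli (fun y => (if dg y.1 = dg y0 then c y.1 else 0) - if dg y.1 < dg y0 then b y.1 else 0) ?_ ⟨y0, hy0⟩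
  · simpa using h4
  · rw [Finset.sum_coe_sort (UF n k) (fun y => ((if dg y = dg y0 then c y else 0) -
      if dg y < dg y0 then b y else 0) • evx n k (uu y))]
    simp only [sub_smul, ite_smul, zero_smul]
    rw [Finset.sum_sub_distrib, ← Finset.sum_filter, ← Finset.sum_filter, sub_eq_zero]
    simp only [map_smul] at h3
    exact h3.symm

/-! ### Translation to variables indexed by natural numbers -/

def io (n : ℕ) : Pn n →ₐ[ℚ] MvPolynomial ℕ ℚ := rename fun j : Fin n => (j : ℕ) + 1

lemma io_inj (n : ℕ) : Function.Injective (io n) :=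
  rename_injective _ fun a b h => Fin.ext (by simpa using h)

lemma io_X {n : ℕ} (i : Fin n) : io n (X i) = X ((i : ℕ) + 1) := rename_X _ _

lemma toFin_io {n : ℕ} (p : Pn n) : toFin n (io n p) = p := by
  have : (toFin n).comp (io n) = AlgHom.id ℚ (Pn n) := by
    apply MvPolynomial.algHom_ext
    intro i
    rw [AlgHom.comp_apply, io_X, toFin, aeval_X, dif_pos ⟨by omega, i.2⟩]
    simp
  exact DFunLike.congr_fun this p

lemma rename_io {n : ℕ} (σ : Equiv.Perm (Fin n)) (p : Pn n) :
    rename (⇑(embedPerm n σ)) (io n p) = io n (ren σ p) := by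
  rw [io, ren_apply, rename_rename, rename_rename]
  congr 1
  congr 1
  funext j
  exact embed_succ σ j

lemma suc_inj (n : ℕ) : Function.Injective fun j : Fin n => (j : ℕ) + 1 :=
  fun a b h => Fin.ext (by simpa using h)

def sucE (n : ℕ) : Fin n ↪ ℕ := ⟨fun j : Fin n => (j : ℕ) + 1, suc_inj n⟩

lemma sucE_apply {n : ℕ} (j : Fin n) : sucE n j = (j : ℕ) + 1 := rfl

lemma Icc_eq (n : ℕ) : Finset.Icc 1 n = (Finset.univ : Finset (Fin n)).map (sucE n) := by
  ext i
  simp only [Finset.mem_Icc, Finset.mem_map, Finset.mem_univ, true_and, sucE_apply]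
  constructor
  · rintro ⟨h1, h2⟩; exact ⟨⟨i - 1, by omega⟩, by simp; omega⟩
  · rintro ⟨j, rfl⟩; have := j.2; omega

lemma esym_io (n r : ℕ) : esym n r = io n (esymFin n r) := by
  rw [esym, esymFin, Icc_eq, Finset.powersetCard_map, Finset.sum_map, map_sum]
  apply Finset.sum_congr rfl
  intro s _
  rw [map_prod]
  simp only [io_X]
  show ∏ i ∈ Finset.map _ s, _ = _
  rw [Finset.prod_map]
  rfl

lemma mem_flt {α : Type*} {p : α → Prop} {inst : DecidablePred p} {s : Finset α} {a : α} :
    a ∈ @Finset.filter α p inst s ↔ a ∈ s ∧ p a := @Finset.mem_filter α p inst s a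

def Rg {n : ℕ} (t : Fin n → ℕ × ℕ) : Finset (Equiv.Perm (Fin n)) :=
  Finset.univ.filter fun σ => ∀ i, row t (σ i) = row t i

lemma forall_Icc {n : ℕ} (P : ℕ → Prop) : (∀ i ∈ Finset.Icc 1 n, P i) ↔ ∀ j : Fin n, P (j + 1) := by
  rw [Icc_eq]; simp [sucE_apply]

lemma rowFinset_eq {n : ℕ} {t : Fin n → ℕ × ℕ} (ht : Function.Injective t) : rowFinset n (tabOf t) = Rg t := by
  unfold rowFinset Rg
  ext σ
  have e : (∀ i ∈ Finset.Icc 1 n, rowIdx (tabOf t) (embedPerm n σ i) = rowIdx (tabOf t) i) ↔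
      ∀ i, row t (σ i) = row t i := by
    rw [forall_Icc]
    simp only [embed_succ, rowIdx_tabOf ht]
    rfl
  exact ⟨fun h => mem_flt.2 ⟨Finset.mem_univ _, e.1 (mem_flt.1 h).2⟩,
    fun h => mem_flt.2 ⟨Finset.mem_univ _, e.2 (mem_flt.1 h).2⟩⟩

lemma colFinset_eq {n : ℕ} {t : Fin n → ℕ × ℕ} (ht : Function.Injective t) : colFinset n (tabOf t) = Cg t := by
  unfold colFinset Cg
  ext σ
  have e : (∀ i ∈ Finset.Icc 1 n, colIdx (tabOf t) (embedPerm n σ i) = colIdx (tabOf t) i) ↔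
      ∀ i, col t (σ i) = col t i := by
    rw [forall_Icc]
    simp only [embed_succ, colIdx_tabOf ht]
    rfl
  exact ⟨fun h => mem_flt.2 ⟨Finset.mem_univ _, e.1 (mem_flt.1 h).2⟩,
    fun h => mem_flt.2 ⟨Finset.mem_univ _, e.2 (mem_flt.1 h).2⟩⟩

lemma mon_eq_prod {n : ℕ} (b : Fin n → ℕ) : mon b = ∏ i, (X i : Pn n) ^ b i := by
  rw [mon, monomial_eq, map_one, one_mul, Finsupp.prod_fintype]
  · rfl
  · intro i; simp

lemma pTS_eq {n : ℕ} {s t : Fin n → ℕ × ℕ} (hs : Function.Injective s) (ht : Function.Injective t)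
    (g : Equiv.Perm (Fin n)) (hg : ∀ i, t i = s (g i)) :
    pTS n (tabOf t) (tabOf s) = io n (mon fun i => al s (g i)) := by
  rw [pTS, mon_eq_prod, map_prod, Icc_eq, Finset.prod_map]
  apply Finset.prod_congr rfl
  intro i _
  rw [map_pow, io_X]
  rw [sucE_apply]
  rw [posOf_tabOf ht, hg, ctEntry, dsi_tabOf hs, tabOf_apply hs, al]
  congr 2
  ext j
  simp only [Finset.mem_filter, Nat.lt_succ_iff]

lemma epsAct_eq {n : ℕ} {t : Fin n → ℕ × ℕ} (ht : Function.Injective t) (p : Pn n) :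
    epsAct n (tabOf t) (io n p) = io n (Cm t (∑ τ ∈ Rg t, ren τ p)) := by
  rw [epsAct, colFinset_eq ht, rowFinset_eq ht, Cm_apply, map_sum]
  apply Finset.sum_congr rfl
  intro σ _
  rw [map_smul, map_sum, map_sum, Finset.smul_sum]
  apply Finset.sum_congr rfl
  intro τ _
  rw [Equiv.Perm.coe_mul, ← rename_rename, rename_io, rename_io, sg, Int.cast_smul_eq_zsmul]

lemma th_row {n : ℕ} {s t : Fin n → ℕ × ℕ} (g : Equiv.Perm (Fin n)) (hg : ∀ i, t i = s (g i)) (G : Pn n) :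
    th s G (mon (row t)) = ∑ τ ∈ Rg t, ren τ (ren g⁻¹ G) := by
  rw [th_apply, Rg, Finset.sum_filter, ← Equiv.sum_comp (Equiv.mulRight g⁻¹)]
  apply Finset.sum_congr rfl
  intro τ _
  rw [Equiv.coe_mulRight, ← ren_mul, cf_mon]
  have e : (row t = fun i => row s ((τ * g⁻¹)⁻¹ i)) ↔ ∀ i, row t (τ i) = row t i := by
    have e1 : (fun i => row s ((τ * g⁻¹)⁻¹ i)) = fun i => row t (τ⁻¹ i) := by
      funext i
      simp [row, hg]
    rw [e1]
    constructor
    · intro h i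
      have := congrFun h (τ i)
      simpa using this
    · intro h
      funext i
      have := h (τ⁻¹ i)
      simpa using this
  by_cases h : ∀ i, row t (τ i) = row t i
  · rw [if_pos (e.2 h), if_pos h, one_smul]
  · rw [if_neg (fun h' => h (e.1 h')), if_neg h, zero_smul]

lemma sTS_ne (n : ℕ) (T S : Tab) : (sTS n T S : ℚ) ≠ 0 := by
  have e : embedPerm n 1 = 1 := by simp [embedPerm]
  rw [Nat.cast_ne_zero, sTS, ← Nat.pos_iff_ne_zero, Finset.card_pos]
  refine ⟨1, ?_⟩
  refine mem_flt.2 ⟨mem_flt.2 ⟨Finset.mem_univ _, fun i _ => ?_⟩, ?_⟩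
  · rw [e]; rfl
  rw [e]
  rw [Equiv.Perm.coe_one, rename_id_apply]

lemma FTS_eq {n : ℕ} {s t : Fin n → ℕ × ℕ} (hs : Function.Injective s) (ht : Function.Injective t)
    (hr : Set.range t = Set.range s) :
    FTS n (tabOf t) (tabOf s) = ((sTS n (tabOf t) (tabOf s) : ℚ))⁻¹ • io n (tp s (et t)) := by
  obtain ⟨g, hg⟩ := exists_perm hs ht hr
  rw [FTS, pTS_eq hs ht g hg, epsAct_eq ht, tp, et, th_Cm, th_row g hg, ren_mon]
  simp

def UI (n : ℕ) (I : Finset ℕ) : Submodule ℚ (Pn n) :=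
  Submodule.span ℚ ((fun x => uI I x) '' (PI n I : Set (St n × St n)))

lemma FwI_eq {n : ℕ} (I : Finset ℕ) (w : {w : Equiv.Perm ℕ // SuppIn n w}) :
    ∃ c : ℚ, c ≠ 0 ∧ FwI n I w.1 = c • io n (uI I (rs w)) := by
  refine ⟨((sTS n (tabOf (rs w).1.1) (tabOf (rs w).2.1) : ℚ))⁻¹, inv_ne_zero (sTS_ne _ _ _), ?_⟩
  rw [FwI, Fw, rs_P, rs_Q, FTS_eq (rs w).2.2.inj (rs w).1.2.inj (rs_range w), ← rs_D, uI, map_mul,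
    smul_mul_assoc]
  congr 2
  rw [EI, map_prod]
  simp only [esym_io]
  rfl

lemma mem_PI_rs {n : ℕ} {I : Finset ℕ} (w : {w : Equiv.Perm ℕ // SuppIn n w}) :
    rs w ∈ PI n I ↔ DslSet n w.1 ⊆ I := by
  rw [PI, Finset.mem_filter, ← rs_D]
  exact ⟨fun h => h.2.2, fun h => ⟨Finset.mem_univ _, rs_range w, h⟩⟩

lemma RnI_eq (n : ℕ) (I : Finset ℕ) : RnI n I = (UI n I).map (io n).toLinearMap := by
  rw [RnI, UI, Submodule.map_span]
  apply le_antisymm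
  · rw [Submodule.span_le]
    rintro _ ⟨w, hw, hD, rfl⟩
    obtain ⟨c, -, hc⟩ := FwI_eq I ⟨w, hw⟩
    rw [hc]
    exact Submodule.smul_mem _ _ (Submodule.subset_span ⟨_, ⟨_, mem_PI_rs ⟨w, hw⟩ |>.2 hD, rfl⟩, rfl⟩)
  · rw [Submodule.span_le]
    rintro _ ⟨_, ⟨x, hx, rfl⟩, rfl⟩
    have hx' := Finset.mem_filter.1 (Finset.mem_coe.1 hx)
    obtain ⟨w, rfl⟩ := rs_surj x hx'.2.1
    obtain ⟨c, hc0, hc⟩ := FwI_eq I w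
    have e : io n (uI I (rs w)) = c⁻¹ • FwI n I w.1 := by rw [hc, smul_smul, inv_mul_cancel₀ hc0, one_smul]
    show io n (uI I (rs w)) ∈ Submodule.span ℚ {p | ∃ w : Equiv.Perm ℕ, SuppIn n w ∧ DslSet n w ⊆ I ∧ p = FwI n I w}
    rw [e]
    exact Submodule.smul_mem _ _ (Submodule.subset_span ⟨w.1, w.2, (mem_PI_rs w).1 hx, rfl⟩)

/-- the map `v ↦ tp q v * EI` -/
def tq {n : ℕ} (I : Finset ℕ) (q : Fin n → ℕ × ℕ) : Pn n →ₗ[ℚ] Pn n :=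
  (LinearMap.mulRight ℚ (EI n I q)).comp (tp q)

lemma tq_apply {n : ℕ} (I : Finset ℕ) (q : Fin n → ℕ × ℕ) (v : Pn n) : tq I q v = tp q v * EI n I q := rfl

lemma rIdxI_le (n : ℕ) (I : Finset ℕ) (i : ℕ) : rIdxI n I i ≤ n := by
  rw [rIdxI]
  refine (Finset.card_le_card ((Finset.filter_subset _ _).trans Finset.sdiff_subset)).trans ?_
  rw [Nat.card_Ioo]; omega

lemma eProd_eq {n : ℕ} (I : Finset ℕ) {s : Fin n → ℕ × ℕ} (hs : Function.Injective s) :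
    eProd n (hSI n I (tabOf s)) = io n (EI n I s) := by
  have hD : Dsic n (tabOf s) = Dc s := by rw [Dsic, dsi_tabOf hs]; rfl
  have h1 : EI n I s = ∏ r ∈ Finset.range (n + 1),
      esymFin n r ^ ((I \ Dc s).filter fun i => rIdxI n I i = r).card := by
    rw [EI, ← Finset.prod_fiberwise_of_maps_to (g := rIdxI n I) (t := Finset.range (n + 1))]
    · apply Finset.prod_congr rfl
      intro r _
      rw [← Finset.prod_const]
      apply Finset.prod_congr rfl
      intro i hi
      rw [(Finset.mem_filter.1 hi).2]
    · intro i _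
      have := rIdxI_le n I i
      exact Finset.mem_range.2 (by omega)
  rw [h1, map_prod, eProd]
  symm
  rw [← Finset.prod_subset (s₁ := Finset.Icc 1 n)]
  · apply Finset.prod_congr rfl
    intro r hr
    rw [map_pow, esym_io, hSI, if_pos (Finset.mem_Icc.1 hr).1, hD]
  · intro r hr
    have := Finset.mem_Icc.1 hr
    exact Finset.mem_range.2 (by omega)
  · intro r hr hr'
    have h2 : r = 0 := by
      have := Finset.mem_range.1 hr
      rw [Finset.mem_Icc] at hr'
      omega
    rw [h2, esymFin_zero, one_pow, map_one]

lemma VS_eq {n : ℕ} {s : Fin n → ℕ × ℕ} (hs : Function.Injective s) {cells : Finset (ℕ × ℕ)}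
    (hc : (cells : Set (ℕ × ℕ)) = Set.range s) :
    VS n cells (tabOf s) = ((Specht s).map (tp s)).map (io n).toLinearMap := by
  have hcard : cells.card = n := (filling_tabOf hs hc).2
  rw [VS, Specht, Submodule.map_span, Submodule.map_span]
  apply le_antisymm
  · rw [Submodule.span_le]
    rintro _ ⟨T, hT, rfl⟩
    obtain ⟨t, ht, hr, rfl⟩ := exists_seq hT hcard
    have hr' : Set.range t = Set.range s := hr.symm.trans hc
    rw [FTS_eq hs ht hr']
    exact Submodule.smul_mem _ _ (Submodule.subset_span ⟨_, ⟨_, ⟨t, ht, hr', rfl⟩, rfl⟩, rfl⟩)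
  · rw [Submodule.span_le]
    rintro _ ⟨_, ⟨_, ⟨t, ht, hr, rfl⟩, rfl⟩, rfl⟩
    have e : io n (tp s (et t)) = (sTS n (tabOf t) (tabOf s) : ℚ) • FTS n (tabOf t) (tabOf s) := by
      rw [FTS_eq hs ht hr, smul_smul, mul_inv_cancel₀ (sTS_ne _ _ _), one_smul]
    show io n (tp s (et t)) ∈ Submodule.span ℚ {p | ∃ T : Tab, IsFillingF cells T ∧ p = FTS n T (tabOf s)}
    rw [e]
    exact Submodule.smul_mem _ _ (Submodule.subset_span ⟨_, (filling_tabOf ht (hc.trans hr.symm)).1, rfl⟩)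

lemma VSh_eq {n : ℕ} (I : Finset ℕ) {s : Fin n → ℕ × ℕ} (hs : Function.Injective s) {cells : Finset (ℕ × ℕ)}
    (hc : (cells : Set (ℕ × ℕ)) = Set.range s) :
    VSh n cells (tabOf s) (hSI n I (tabOf s)) = ((Specht s).map (tq I s)).map (io n).toLinearMap := by
  rw [VSh, polyMul, eProd_eq I hs, VS_eq hs hc, ← Submodule.map_comp, ← Submodule.map_comp, ← Submodule.map_comp]
  congr 1
  apply LinearMap.ext
  intro v
  show io n (EI n I s) * io n (tp s v) = io n (tp s v * EI n I s)
  rw [map_mul, mul_comm]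

lemma ren_EI {n : ℕ} (I : Finset ℕ) (q : Fin n → ℕ × ℕ) (σ : Equiv.Perm (Fin n)) : ren σ (EI n I q) = EI n I q := by
  rw [ren_apply, EI, map_prod]
  simp only [rename_esymFin]

lemma tq_ren {n : ℕ} (I : Finset ℕ) (q : Fin n → ℕ × ℕ) (σ : Equiv.Perm (Fin n)) (v : Pn n) :
    tq I q (ren σ v) = ren σ (tq I q v) := by
  rw [tq_apply, tq_apply, tp, th_ren, ren_apply σ (_ * _), map_mul, ← ren_apply, ← ren_apply, ren_EI]

lemma Specht_ren {n : ℕ} (q : Fin n → ℕ × ℕ) (σ : Equiv.Perm (Fin n)) {v : Pn n} (hv : v ∈ Specht q) :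
    ren σ v ∈ Specht q := by
  unfold Specht at hv
  induction hv using Submodule.span_induction with
  | mem x hx =>
    obtain ⟨t, ht, hr, rfl⟩ := hx
    rw [ren_et]
    refine et_mem (ht.comp (Equiv.injective σ⁻¹)) ?_
    rw [← hr]
    exact (Equiv.surjective σ⁻¹).range_comp t
  | zero => rw [map_zero]; exact zero_mem _
  | add x y _ _ h1 h2 => rw [map_add]; exact add_mem h1 h2
  | smul c x _ h => rw [map_smul]; exact Submodule.smul_mem _ _ h

/-- columns -/
def QI (n : ℕ) (I : Finset ℕ) : Finset (St n) := Finset.univ.filter fun q => Dc q.1 ⊆ I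

lemma mem_QI {n : ℕ} {I : Finset ℕ} {q : St n} : q ∈ QI n I ↔ Dc q.1 ⊆ I := by simp [QI]

lemma sum_PI {n : ℕ} (I : Finset ℕ) (c : St n × St n → ℚ)
    (L : (Fin n → ℕ × ℕ) → Pn n →ₗ[ℚ] Pn n) :
    ∑ x ∈ PI n I, c x • L x.2.1 (et x.1.1) = ∑ q ∈ QI n I, L q.1 (colS c q) := by
  rw [PI, QI, Finset.sum_filter, Fintype.sum_prod_type_right, Finset.sum_filter]
  apply Finset.sum_congr rfl
  intro q _
  split_ifs with h
  · rw [colS, map_sum, Finset.sum_filter]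
    apply Finset.sum_congr rfl
    intro p _
    by_cases hp : Set.range p.1 = Set.range q.1
    · rw [if_pos ⟨hp, h⟩, if_pos hp, map_smul]
    · rw [if_neg (fun h' => hp h'.1), if_neg hp]
  · apply Finset.sum_eq_zero
    intro p _
    rw [if_neg (fun h' => h h'.2)]

lemma UI_eq (n : ℕ) (I : Finset ℕ) : UI n I = ⨆ q ∈ QI n I, (Specht q.1).map (tq I q.1) := by
  apply le_antisymm
  · rw [UI, Submodule.span_le]
    rintro _ ⟨x, hx, rfl⟩
    have hx' := Finset.mem_filter.1 (Finset.mem_coe.1 hx)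
    have h1 : uI I x ∈ (Specht x.2.1).map (tq I x.2.1) := ⟨et x.1.1, et_mem x.1.2.inj hx'.2.1, rfl⟩
    exact (le_iSup₂_of_le (f := fun (q : St n) (_ : q ∈ QI n I) => (Specht q.1).map (tq I q.1)) x.2
      (mem_QI.2 hx'.2.2) le_rfl) h1
  · refine iSup₂_le fun q hq => ?_
    rintro _ ⟨v, hv, rfl⟩
    obtain ⟨c, rfl⟩ := straighten q hv
    rw [colS, map_sum]
    apply Submodule.sum_mem
    intro p hp
    rw [map_smul]
    apply Submodule.smul_mem
    exact Submodule.subset_span ⟨(p, q), Finset.mem_coe.2 (Finset.mem_filter.2 ⟨Finset.mem_univ _,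
      (Finset.mem_filter.1 hp).2, mem_QI.1 hq⟩), rfl⟩

/-- independence of the summands -/
lemma tq_indep {n k : ℕ} (hn : 1 ≤ n) (hk : 1 ≤ k) (hkn : k ≤ n)
    (v : Finset ℕ → St n → Pn n) (hv : ∀ I ∈ Ik n k, ∀ q ∈ QI n I, v I q ∈ Specht q.1)
    (h : ∑ I ∈ Ik n k, ∑ q ∈ QI n I, tq I q.1 (v I q) ∈ Jm n k) :
    ∀ I ∈ Ik n k, ∀ q ∈ QI n I, v I q = 0 := by
  have hc : ∀ I q, ∃ c : St n × St n → ℚ, I ∈ Ik n k → q ∈ QI n I → v I q = colS c q := by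
    intro I q
    by_cases h : I ∈ Ik n k ∧ q ∈ QI n I
    · obtain ⟨c, hc⟩ := straighten q (hv I h.1 q h.2)
      exact ⟨c, fun _ _ => hc⟩
    · exact ⟨0, fun h1 h2 => absurd ⟨h1, h2⟩ h⟩
  choose c hc using hc
  have h1 : ∑ y ∈ UF n k, c y.1 y.2.2 y.2 • uu y ∈ Jm n k := by
    rw [UF, Finset.sum_sigma]
    have e : ∀ I ∈ Ik n k, ∑ x ∈ PI n I, c I x.2 x • uu (⟨I, x⟩ : Σ _ : Finset ℕ, St n × St n) =
        ∑ q ∈ QI n I, tq I q.1 (v I q) := by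
      intro I hI
      have := sum_PI I (fun x => c I x.2 x) (tq I)
      refine Eq.trans this ?_
      apply Finset.sum_congr rfl
      intro q hq
      rw [hc I q hI hq]
      rfl
    rw [Finset.sum_congr rfl e]
    exact h
  have h2 := mod_indep hn hk hkn _ h1
  intro I hI q hq
  rw [hc I q hI hq, colS]
  apply Finset.sum_eq_zero
  intro p hp
  have := h2 ⟨I, (p, q)⟩ (Finset.mem_sigma.2 ⟨hI, Finset.mem_filter.2 ⟨Finset.mem_univ _,
      (Finset.mem_filter.1 hp).2, mem_QI.1 hq⟩⟩)
  simp only at this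
  rw [this, zero_smul]

lemma indep_fin {ι M : Type*} [Fintype ι] [AddCommGroup M] [Module ℚ M] (p : ι → Submodule ℚ M)
    (h : ∀ v : ι → M, (∀ i, v i ∈ p i) → ∑ i, v i = 0 → ∀ i, v i = 0) : iSupIndep p := by
  rw [iSupIndep_iff_finsetSum_eq_zero_imp_eq_zero]
  intro s v hv h0 i hi
  have := h (fun i => if i ∈ s then v i else 0) (by
    intro j
    by_cases hj : j ∈ s
    · simpa [hj] using hv j hj
    · simp [hj]) (by simpa using h0) i
  simpa [hi] using this

lemma UI_repr {n : ℕ} {I : Finset ℕ} {u : Pn n} (hu : u ∈ UI n I) :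
    ∃ v : St n → Pn n, (∀ q ∈ QI n I, v q ∈ Specht q.1) ∧ u = ∑ q ∈ QI n I, tq I q.1 (v q) := by
  obtain ⟨c, hc⟩ := span_coef _ _ hu
  refine ⟨fun q => colS c q, fun q _ => colS_mem c q, ?_⟩
  rw [← hc]
  exact sum_PI I c (tq I)

lemma UI_indep {n k : ℕ} (hn : 1 ≤ n) (hk : 1 ≤ k) (hkn : k ≤ n) (u : Finset ℕ → Pn n)
    (hu : ∀ I ∈ Ik n k, u I ∈ UI n I) (h : ∑ I ∈ Ik n k, u I ∈ Jm n k) :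
    ∀ I ∈ Ik n k, u I = 0 := by
  have hv : ∀ I, ∃ v : St n → Pn n, I ∈ Ik n k → ((∀ q ∈ QI n I, v q ∈ Specht q.1) ∧
      u I = ∑ q ∈ QI n I, tq I q.1 (v q)) := by
    intro I
    by_cases hI : I ∈ Ik n k
    · obtain ⟨v, h⟩ := UI_repr (hu I hI)
      exact ⟨v, fun _ => h⟩
    · exact ⟨0, fun h => absurd h hI⟩
  choose v hv using hv
  have h1 := tq_indep hn hk hkn v (fun I hI => (hv I hI).1) (by
    rw [← Finset.sum_congr rfl fun I hI => (hv I hI).2]; exact h)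
  intro I hI
  rw [(hv I hI).2]
  apply Finset.sum_eq_zero
  intro q hq
  rw [h1 I hI q hq, map_zero]

lemma UI_iSupIndep {n k : ℕ} (hn : 1 ≤ n) (hk : 1 ≤ k) (hkn : k ≤ n) :
    iSupIndep fun J : {J // J ∈ Ik n k} => UI n J.1 := by
  apply indep_fin
  intro v hv h0
  have := UI_indep hn hk hkn (fun J => if h : J ∈ Ik n k then v ⟨J, h⟩ else 0) (by
    intro I hI; simpa [hI] using hv ⟨I, hI⟩) (by
    rw [← Finset.sum_coe_sort]
    simp only [Subtype.coe_eta, Finset.coe_mem, dite_true]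
    rw [h0]; exact Submodule.zero_mem _)
  intro i
  simpa using this i.1 i.2

lemma tq_iSupIndep {n k : ℕ} (hn : 1 ≤ n) (hk : 1 ≤ k) (hkn : k ≤ n) {I : Finset ℕ} (hI : I ∈ Ik n k) :
    iSupIndep fun q : {q // q ∈ QI n I} => (Specht q.1.1).map (tq I q.1.1) := by
  apply indep_fin
  intro v hv h0
  choose z hz hzv using hv
  have := tq_indep hn hk hkn (fun J q => if h : J = I ∧ q ∈ QI n I then z ⟨q, h.2⟩ else 0) (by
    intro J hJ q hq
    by_cases h : J = I ∧ q ∈ QI n I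
    · rw [dif_pos h]; exact hz ⟨q, h.2⟩
    · rw [dif_neg h]; exact Submodule.zero_mem _) (by
    rw [Finset.sum_eq_single I]
    · rw [← Finset.sum_coe_sort]
      simp only [Subtype.coe_eta, Finset.coe_mem, and_self, dite_true]
      rw [Finset.sum_congr rfl fun q _ => hzv q, h0]; exact Submodule.zero_mem _
    · intro J _ hJ
      apply Finset.sum_eq_zero
      intro q _
      rw [dif_neg (fun h => hJ h.1), map_zero]
    · intro h; exact absurd hI h)
  intro i
  have h2 := this I hI i.1 i.2
  rw [dif_pos ⟨rfl, i.2⟩] at h2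
  rw [← hzv i, h2, map_zero]

lemma UI_ren {n : ℕ} (I : Finset ℕ) (σ : Equiv.Perm (Fin n)) {u : Pn n} (hu : u ∈ UI n I) :
    ren σ u ∈ UI n I := by
  obtain ⟨v, hv, rfl⟩ := UI_repr hu
  rw [map_sum]
  apply Submodule.sum_mem
  intro q hq
  rw [← tq_ren, UI_eq]
  exact (le_iSup₂_of_le (f := fun (q : St n) (_ : q ∈ QI n I) => (Specht q.1).map (tq I q.1)) q hq
    le_rfl) ⟨_, Specht_ren q.1 σ (hv q hq), rfl⟩

lemma RnI_rename {n : ℕ} (I : Finset ℕ) (w : Equiv.Perm ℕ) (hw : SuppIn n w) (p : MvPolynomial ℕ ℚ)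
    (hp : p ∈ RnI n I) : rename (⇑w) p ∈ RnI n I := by
  obtain ⟨σ, rfl⟩ := embed_surj hw
  rw [RnI_eq] at hp ⊢
  obtain ⟨u, hu, rfl⟩ := hp
  exact ⟨ren σ u, UI_ren I σ hu, (rename_io σ u).symm⟩

lemma Dsic_tabOf {n : ℕ} {s : Fin n → ℕ × ℕ} (hs : Function.Injective s) : Dsic n (tabOf s) = Dc s := by
  rw [Dsic, dsi_tabOf hs]; rfl

lemma SIdx_ex {n : ℕ} {I : Finset ℕ} (q : SIdx n I) :
    ∃ s : {q // q ∈ QI n I}, (q.1.1.cells : Set (ℕ × ℕ)) = Set.range s.1.1 ∧ q.1.2 = tabOf s.1.1 := by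
  obtain ⟨⟨μ, T⟩, hc, hT, hD⟩ := q
  obtain ⟨t, ht, hr, rfl⟩ := exists_lin hT hc
  exact ⟨⟨⟨t, ht⟩, mem_QI.2 (Dsic_tabOf ht.inj ▸ hD)⟩, hr, rfl⟩

lemma VSh_idx {n : ℕ} {I : Finset ℕ} (q : SIdx n I) (s : {q // q ∈ QI n I})
    (h1 : (q.1.1.cells : Set (ℕ × ℕ)) = Set.range s.1.1) (h2 : q.1.2 = tabOf s.1.1) :
    VSh n q.1.1.cells q.1.2 (hSI n I q.1.2) =
      ((Specht s.1.1).map (tq I s.1.1)).map (io n).toLinearMap := by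
  rw [h2]; exact VSh_eq I s.1.2.inj h1

lemma RnI_dec (n : ℕ) (I : Finset ℕ) :
    RnI n I = (⨆ q : SIdx n I, VSh n q.1.1.cells q.1.2 (hSI n I q.1.2)) := by
  rw [RnI_eq, UI_eq]
  simp only [Submodule.map_iSup]
  apply le_antisymm
  · apply iSup₂_le
    intro s hs
    let q : SIdx n I := ⟨(ydOf s.2.toFil, tabOf s.1), (filling_tabOf s.2.inj (ydOf_cells s.2.toFil)).2,
      std_tabOf s.2 (ydOf_cells s.2.toFil), by rw [Dsic_tabOf s.2.inj]; exact mem_QI.1 hs⟩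
    rw [← VSh_idx q ⟨s, hs⟩ (ydOf_cells s.2.toFil) rfl]
    exact le_iSup (fun q : SIdx n I => VSh n q.1.1.cells q.1.2 (hSI n I q.1.2)) q
  · apply iSup_le
    intro q
    obtain ⟨s, h1, h2⟩ := SIdx_ex q
    rw [VSh_idx q s h1 h2]
    exact le_iSup₂_of_le (f := fun (q : St n) (_ : q ∈ QI n I) =>
      ((Specht q.1).map (tq I q.1)).map (io n).toLinearMap) s.1 s.2 le_rfl

lemma RnI_ind {n k : ℕ} (hn : 1 ≤ n) (hk : 1 ≤ k) (hkn : k ≤ n) {I : Finset ℕ} (hI : I ∈ Ik n k) :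
    iSupIndep fun q : SIdx n I => VSh n q.1.1.cells q.1.2 (hSI n I q.1.2) := by
  choose s h1 h2 using fun q : SIdx n I => SIdx_ex q
  have hinj : Function.Injective s := by
    intro q q' h
    apply Subtype.ext
    apply Prod.ext
    · apply YoungDiagram.ext
      apply Finset.coe_injective
      rw [h1 q, h1 q', h]
    · rw [h2 q, h2 q', h]
  have := (LinearMap.iSupIndep_map (io n).toLinearMap (io_inj n) (tq_iSupIndep hn hk hkn hI)).comp hinj
  refine Eq.mp ?_ this
  congr 1
  funext q
  exact (VSh_idx q (s q) (h1 q) (h2 q)).symm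

lemma R_ind {n k : ℕ} (hn : 1 ≤ n) (hk : 1 ≤ k) (hkn : k ≤ n) :
    iSupIndep (fun J : {J : Finset ℕ // J ⊆ Finset.Ioo 0 n ∧ J.card = k - 1} => RnI n J.1) := by
  have := (LinearMap.iSupIndep_map (io n).toLinearMap (io_inj n) (UI_iSupIndep hn hk hkn)).comp
    (f := fun J : {J : Finset ℕ // J ⊆ Finset.Ioo 0 n ∧ J.card = k - 1} =>
      (⟨J.1, Finset.mem_powersetCard.2 J.2⟩ : {J // J ∈ Ik n k}))
    (fun J J' h => Subtype.ext (Subtype.mk.inj h))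
  simp only [RnI_eq]
  exact this

lemma sup_R (n k : ℕ) :
    (⨆ J : {J : Finset ℕ // J ⊆ Finset.Ioo 0 n ∧ J.card = k - 1}, RnI n J.1) =
      (SI n k).map (io n).toLinearMap := by
  rw [SI]
  simp only [Submodule.map_iSup]
  apply le_antisymm
  · apply iSup_le
    intro J
    rw [RnI_eq]
    exact le_iSup₂_of_le (f := fun J (_ : J ∈ Ik n k) => (UI n J).map (io n).toLinearMap) J.1
      (Finset.mem_powersetCard.2 J.2) le_rfl
  · apply iSup₂_le
    intro J hJ
    refine le_trans (le_of_eq (RnI_eq n J).symm) ?_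
    exact le_iSup (fun J : {J : Finset ℕ // J ⊆ Finset.Ioo 0 n ∧ J.card = k - 1} => RnI n J.1)
      ⟨J, Finset.mem_powersetCard.1 hJ⟩

lemma proj_io {n k : ℕ} (u : Pn n) : projNK n k (io n u) = Ideal.Quotient.mk (Jnk n k) u := by
  rw [projNK, AlgHom.comp_apply, toFin_io]; rfl

lemma SI_J {n k : ℕ} (hn : 1 ≤ n) (hk : 1 ≤ k) (hkn : k ≤ n) {u : Pn n} (hu : u ∈ SI n k)
    (hJ : u ∈ Jnk n k) : u = 0 := by
  have h1 : ∃ v : Finset ℕ → Pn n, (∀ I ∈ Ik n k, v I ∈ UI n I) ∧ ∑ I ∈ Ik n k, v I = u := by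
    have := (Submodule.mem_iSup_finset_iff_exists_sum (s := Ik n k) (fun I => UI n I) u).1 hu
    obtain ⟨μ, hμ⟩ := this
    exact ⟨fun I => (μ I : Pn n), fun I _ => (μ I).2, hμ⟩
  obtain ⟨v, hv, rfl⟩ := h1
  exact Finset.sum_eq_zero (UI_indep hn hk hkn v hv hJ)

lemma R_bij {n k : ℕ} (hn : 1 ≤ n) (hk : 1 ≤ k) (hkn : k ≤ n) :
    Function.Bijective
       (fun p : ↥(⨆ J : {J : Finset ℕ // J ⊆ Finset.Ioo 0 n ∧ J.card = k - 1}, RnI n J.1)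
          => projNK n k (p : MvPolynomial ℕ ℚ)) := by
  rw [sup_R]
  constructor
  · rintro ⟨_, u, hu, rfl⟩ ⟨_, v, hv, rfl⟩ h
    have h' : projNK n k (io n u) = projNK n k (io n v) := h
    rw [proj_io, proj_io, Ideal.Quotient.eq] at h'
    have := SI_J hn hk hkn (Submodule.sub_mem _ hu hv) h'
    rw [sub_eq_zero] at this
    subst this
    rfl
  · intro y
    obtain ⟨u, rfl⟩ := Ideal.Quotient.mk_surjective y
    have hu : u ∈ Jm n k ⊔ SI n k := by rw [span_all hn hk hkn]; trivial
    obtain ⟨a, ha, b, hb, rfl⟩ := Submodule.mem_sup.1 hu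
    refine ⟨⟨io n b, b, hb, rfl⟩, ?_⟩
    show projNK n k (io n b) = _
    rw [proj_io, Ideal.Quotient.eq]
    have : b - (a + b) = -a := by ring
    rw [this]
    exact (Jnk n k).neg_mem ha

lemma toFin_rename {n : ℕ} (σ : Equiv.Perm (Fin n)) (p : MvPolynomial ℕ ℚ) :
    toFin n (rename (embedPerm n σ) p) = rename σ (toFin n p) := by
  have : (toFin n).comp (rename (embedPerm n σ)) = (rename σ).comp (toFin n) := by
    apply MvPolynomial.algHom_ext
    intro i
    simp only [AlgHom.comp_apply, rename_X]
    by_cases hi : 1 ≤ i ∧ i ≤ n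
    · obtain ⟨j, rfl⟩ : ∃ j : Fin n, i = j + 1 := ⟨⟨i - 1, by omega⟩, by simp; omega⟩
      rw [embed_succ]
      have e : ∀ j : Fin n, toFin n (X ((j : ℕ) + 1)) = X j := by
        intro j
        rw [toFin, aeval_X, dif_pos ⟨by omega, by omega⟩]
        rfl
      rw [e, e, rename_X]
    · rw [embed_supp σ i (by omega), toFin, aeval_X, dif_neg hi, map_zero]
  exact DFunLike.congr_fun this p

lemma Jnk_rename {n k : ℕ} (σ : Equiv.Perm (Fin n)) {p : Pn n} (hp : p ∈ Jnk n k) :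
    rename σ p ∈ Jnk n k := by
  have : Jnk n k ≤ (Jnk n k).comap (rename (R := ℚ) σ).toRingHom := by
    rw [Jnk, Ideal.span_le]
    rintro _ (⟨i, rfl⟩ | ⟨r, h1, h2, rfl⟩)
    · show rename σ (X i ^ k) ∈ Ideal.span _
      rw [map_pow, rename_X]
      exact Ideal.subset_span (Or.inl ⟨σ i, rfl⟩)
    · show rename σ (esymFin n r) ∈ Ideal.span _
      rw [rename_esymFin]
      exact Ideal.subset_span (Or.inr ⟨r, h1, h2, rfl⟩)
  exact this hp

lemma proj_rename {n k : ℕ} (w : Equiv.Perm ℕ) (hw : SuppIn n w) (p : MvPolynomial ℕ ℚ)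
    (hp : projNK n k p = 0) : projNK n k (rename (⇑w) p) = 0 := by
  obtain ⟨σ, rfl⟩ := embed_surj hw
  have h1 : toFin n p ∈ Jnk n k := Ideal.Quotient.eq_zero_iff_mem.1 hp
  show Ideal.Quotient.mk (Jnk n k) (toFin n (rename _ p)) = 0
  rw [Ideal.Quotient.eq_zero_iff_mem, toFin_rename]
  exact Jnk_rename σ h1

lemma cnt_iff {n : ℕ} {I : Finset ℕ} (hI : I ⊆ Finset.Ioo 0 n) {p h : ℕ} (hp : p ≤ n) (hh : h ≤ I.card) :
    p ≤ jval n I (h + 1) ↔ (I.filter fun s => s < p).card ≤ h := by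
  rcases Nat.lt_or_ge h I.card with h1 | h1
  · have e0 : jval n I (h + 1) = I.orderEmbOfFin rfl ⟨h, h1⟩ := by
      rw [jval, if_neg (by omega), if_pos (by omega), Finset.orderEmbOfFin_apply]
      simp [List.getD_eq_getElem?_getD, h1]
    have e1 : (I.filter fun s => s < p).card =
        (Finset.univ.filter fun j : Fin I.card => I.orderEmbOfFin rfl j < p).card := by
      rw [← Finset.card_map (I.orderEmbOfFin rfl).toEmbedding]
      congr 1
      ext s
      simp only [Finset.mem_filter, Finset.mem_map, Finset.mem_univ, true_and]
      constructor
      · rintro ⟨hs, hp⟩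
        have : s ∈ Set.range (I.orderEmbOfFin rfl) := by rw [Finset.range_orderEmbOfFin]; exact hs
        obtain ⟨j, rfl⟩ := this
        exact ⟨j, hp, rfl⟩
      · rintro ⟨j, hj, rfl⟩
        exact ⟨Finset.orderEmbOfFin_mem _ _ _, hj⟩
    rw [e0, e1]
    constructor
    · intro h2
      have : (Finset.univ.filter fun j : Fin I.card => I.orderEmbOfFin rfl j < p) ⊆ Finset.Iio ⟨h, h1⟩ := by
        intro j hj
        rw [Finset.mem_filter] at hj
        rw [Finset.mem_Iio]
        exact (I.orderEmbOfFin rfl).lt_iff_lt.1 (lt_of_lt_of_le hj.2 h2)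
      have := Finset.card_le_card this
      simpa using this
    · intro h2
      by_contra h3
      push Not at h3
      have : Finset.Iic (⟨h, h1⟩ : Fin I.card) ⊆
          (Finset.univ.filter fun j : Fin I.card => I.orderEmbOfFin rfl j < p) := by
        intro j hj
        rw [Finset.mem_Iic] at hj
        rw [Finset.mem_filter]
        exact ⟨Finset.mem_univ _, lt_of_le_of_lt ((I.orderEmbOfFin rfl).monotone hj) h3⟩
      have := Finset.card_le_card this
      rw [Fin.card_Iic] at this
      simp only at this
      omega
  · have : jval n I (h + 1) = n := by rw [jval, if_neg (by omega), if_neg (by omega)]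
    rw [this]
    exact ⟨fun _ => (Finset.card_le_card (Finset.filter_subset _ _)).trans h1, fun _ => hp⟩

lemma jval_le {n : ℕ} {I : Finset ℕ} (hI : I ⊆ Finset.Ioo 0 n) (h : ℕ) : jval n I h ≤ n := by
  rw [jval]
  split_ifs with h1 h2
  · omega
  · have hl : h - 1 < (I.sort (· ≤ ·)).length := by rw [Finset.length_sort]; omega
    have : (I.sort (· ≤ ·)).getD (h - 1) 0 ∈ I.sort (· ≤ ·) := by
      rw [List.getD_eq_getElem _ _ hl]; exact List.getElem_mem hl
    have := hI ((Finset.mem_sort _).1 this)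
    rw [Finset.mem_Ioo] at this
    omega
  · exact le_rfl

lemma bI_cnt {n : ℕ} {I : Finset ℕ} (i : Fin n) :
    bI n I i + (I.filter fun s => s < n - (i : ℕ)).card = I.card := by
  have := Finset.card_filter_add_card_filter_not (s := I) (fun s => n ≤ (i : ℕ) + s)
  rw [← this, bI]
  congr 2
  apply Finset.filter_congr
  intro s _
  omega

lemma bI_fib {n : ℕ} {I : Finset ℕ} (hI : I ⊆ Finset.Ioo 0 n) {h : ℕ} (hh : h ≤ I.card) :
    (Finset.univ.filter fun i : Fin n => bI n I i = I.card - h).card = compFun n I h := by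
  rw [compFun, ← Nat.card_Ioc (jval n I h) (jval n I (h + 1))]
  have key : ∀ p, 1 ≤ p → p ≤ n → (p ∈ Finset.Ioc (jval n I h) (jval n I (h + 1)) ↔
      (I.filter fun s => s < p).card = h) := by
    intro p h1 h2
    rw [Finset.mem_Ioc, cnt_iff hI h2 hh]
    rcases Nat.eq_zero_or_pos h with rfl | h0
    · rw [jval, if_pos rfl]; omega
    · have := cnt_iff hI h2 (h := h - 1) (by omega)
      rw [Nat.sub_add_cancel h0] at this
      rw [← not_le, this]; omega
  apply Finset.card_bij (fun (i : Fin n) _ => n - (i : ℕ))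
  · intro i hi
    rw [key _ (by omega) (by omega)]
    have := bI_cnt (I := I) i
    have h2 := (Finset.mem_filter.1 hi).2
    omega
  · intro i _ j _ h
    apply Fin.ext; omega
  · intro p hp
    have h2 := (Finset.mem_Ioc.1 hp)
    have h3 := jval_le hI (h + 1)
    rw [key p (by omega) (by omega)] at hp
    refine ⟨⟨n - p, by omega⟩, Finset.mem_filter.2 ⟨Finset.mem_univ _, ?_⟩, by simp only; omega⟩
    have := bI_cnt (I := I) (⟨n - p, by omega⟩ : Fin n)
    simp only at this
    rw [show n - (n - p) = p by omega] at this
    omega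

/-- The ordered set partition attached to an exponent vector. -/
def opB {n : ℕ} (m : ℕ) (b : Fin n → ℕ) (h : ℕ) : Finset ℕ :=
  if h ≤ m then (Finset.univ.filter fun i : Fin n => b i = m - h).image (fun i : Fin n => (i : ℕ) + 1) else ∅

lemma mem_opB {n m : ℕ} {b : Fin n → ℕ} {h : ℕ} {i : Fin n} :
    (i : ℕ) + 1 ∈ opB m b h ↔ h ≤ m ∧ b i = m - h := by
  rw [opB]
  split_ifs with h1
  · simp only [Finset.mem_image, Finset.mem_filter, Finset.mem_univ, true_and, h1]
    constructor
    · rintro ⟨j, hj, e⟩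
      have : j = i := Fin.ext (by omega)
      rwa [← this]
    · intro h; exact ⟨i, h, rfl⟩
  · simp [h1]

lemma opB_form {n m : ℕ} {b : Fin n → ℕ} {h x : ℕ} (hx : x ∈ opB m b h) : ∃ i : Fin n, x = (i : ℕ) + 1 := by
  rw [opB] at hx
  split_ifs at hx with h1
  · obtain ⟨i, -, e⟩ := Finset.mem_image.1 hx
    exact ⟨i, e.symm⟩
  · simp at hx

lemma opB_card {n m : ℕ} {b : Fin n → ℕ} {h : ℕ} (hh : h ≤ m) :
    (opB m b h).card = (Finset.univ.filter fun i : Fin n => b i = m - h).card := by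
  rw [opB, if_pos hh, Finset.card_image_of_injective]
  intro i j h
  apply Fin.ext; simp only at h; omega

lemma fib_perm {n : ℕ} (b : Fin n → ℕ) (g : Equiv.Perm (Fin n)) (v : ℕ) :
    (Finset.univ.filter fun i : Fin n => b (g i) = v).card = (Finset.univ.filter fun i : Fin n => b i = v).card := by
  apply Finset.card_bij (fun i _ => g i)
  · intro i hi; simpa using hi
  · intro i _ j _ h; exact g.injective h
  · intro i hi
    have e : g (g⁻¹ i) = i := by simp
    refine ⟨g⁻¹ i, ?_, e⟩
    rw [Finset.mem_filter] at hi ⊢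
    rw [e]; exact ⟨Finset.mem_univ _, hi.2⟩

lemma bI_le {n : ℕ} {I : Finset ℕ} (i : Fin n) : bI n I i ≤ I.card := Finset.card_filter_le _ _

lemma Orb_le {n : ℕ} {I : Finset ℕ} {b : Fin n → ℕ} (hb : b ∈ Orb (bI n I)) (i : Fin n) : b i ≤ I.card := by
  obtain ⟨g, rfl⟩ := mem_Orb.1 hb
  exact bI_le _

lemma opB_mem {n : ℕ} {I : Finset ℕ} (hI : I ⊆ Finset.Ioo 0 n) {b : Fin n → ℕ} (hb : b ∈ Orb (bI n I)) :
    opB I.card b ∈ OPset n I := by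
  refine ⟨?_, ?_, ?_, ?_⟩
  · intro h hh
    rw [opB, if_neg (by omega)]
  · intro h₁ h₂ hne
    rw [Finset.disjoint_left]
    intro x h1 h2
    obtain ⟨i, rfl⟩ := opB_form h1
    rw [mem_opB] at h1 h2
    omega
  · intro h hh
    rw [opB_card hh, ← bI_fib hI hh]
    obtain ⟨g, rfl⟩ := mem_Orb.1 hb
    exact fib_perm _ g _
  · ext x
    rw [Finset.mem_biUnion, Finset.mem_Icc]
    constructor
    · intro hx
      have e : x = ((⟨x - 1, by omega⟩ : Fin n) : ℕ) + 1 := by simp only; omega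
      have h1 := Orb_le hb ⟨x - 1, by omega⟩
      refine ⟨I.card - b ⟨x - 1, by omega⟩, Finset.mem_range.2 (by omega), ?_⟩
      have h3 := (mem_opB (m := I.card) (b := b) (h := I.card - b ⟨x - 1, by omega⟩)
        (i := ⟨x - 1, by omega⟩)).2 ⟨by omega, by omega⟩
      rwa [← e] at h3
    · rintro ⟨h, -, hx⟩
      obtain ⟨i, rfl⟩ := opB_form hx
      omega

lemma opB_inj {n : ℕ} {m : ℕ} {b b' : Fin n → ℕ} (hb : ∀ i, b i ≤ m)
    (h : opB m b = opB m b') : b = b' := by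
  funext i
  have h1 : (i : ℕ) + 1 ∈ opB m b (m - b i) := mem_opB.2 ⟨by omega, by have := hb i; omega⟩
  rw [h, mem_opB] at h1
  have := hb i
  omega

lemma opB_surj {n : ℕ} {I : Finset ℕ} (hI : I ⊆ Finset.Ioo 0 n) {B : ℕ → Finset ℕ} (hB : B ∈ OPset n I) :
    ∃ b ∈ Orb (bI n I), opB I.card b = B := by
  obtain ⟨h1, h2, h3, h4⟩ := hB
  have hx : ∀ i : Fin n, ∃ h, h ≤ I.card ∧ (i : ℕ) + 1 ∈ B h := by
    intro i
    have : (i : ℕ) + 1 ∈ Finset.Icc 1 n := Finset.mem_Icc.2 ⟨by omega, by omega⟩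
    rw [h4, Finset.mem_biUnion] at this
    obtain ⟨h, hh, hi⟩ := this
    rw [Finset.mem_range] at hh
    exact ⟨h, by omega, hi⟩
  choose f hf hfB using hx
  have huniq : ∀ (i : Fin n) h, (i : ℕ) + 1 ∈ B h → h = f i := by
    intro i h hi
    by_contra hne
    exact Finset.disjoint_left.1 (h2 _ _ hne) hi (hfB i)
  have hform : ∀ h x, x ∈ B h → ∃ i : Fin n, x = (i : ℕ) + 1 := by
    intro h x hx
    have hh : h ≤ I.card := by
      by_contra hc
      rw [h1 h (by omega)] at hx
      simp at hx
    have : x ∈ Finset.Icc 1 n := by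
      rw [h4, Finset.mem_biUnion]
      exact ⟨h, Finset.mem_range.2 (by omega), hx⟩
    rw [Finset.mem_Icc] at this
    exact ⟨⟨x - 1, by omega⟩, by simp only; omega⟩
  have hop : opB I.card (fun i => I.card - f i) = B := by
    funext h
    ext x
    constructor
    · intro hx
      obtain ⟨i, rfl⟩ := opB_form hx
      rw [mem_opB] at hx
      have := hf i
      have e : h = f i := by omega
      rw [e]; exact hfB i
    · intro hx
      obtain ⟨i, rfl⟩ := hform h x hx
      have := huniq i h hx
      rw [mem_opB, this]
      exact ⟨hf i, rfl⟩
  refine ⟨fun i => I.card - f i, ?_, hop⟩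
  have hcard : ∀ v, (Finset.univ.filter fun i : Fin n => I.card - f i = v).card =
      (Finset.univ.filter fun i : Fin n => bI n I i = v).card := by
    intro v
    rcases Nat.lt_or_ge I.card v with hv | hv
    · rw [Finset.filter_false_of_mem, Finset.filter_false_of_mem]
      · intro i _; have := bI_le (I := I) i; omega
      · intro i _; omega
    · have e := bI_fib hI (h := I.card - v) (by omega)
      have e2 := opB_card (n := n) (m := I.card) (b := fun i => I.card - f i) (h := I.card - v) (by omega)
      rw [hop, h3 _ (by omega), ← e] at e2
      rw [show I.card - (I.card - v) = v by omega] at e2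
      exact e2.symm
  have hE : ∀ v, Nonempty ({i : Fin n // I.card - f i = v} ≃ {i : Fin n // bI n I i = v}) := by
    intro v
    rw [← Fintype.card_eq, Fintype.card_subtype, Fintype.card_subtype]
    exact hcard v
  let g := Equiv.ofFiberEquiv (f := fun i : Fin n => I.card - f i) (g := bI n I) (fun v => (hE v).some)
  rw [mem_Orb]
  refine ⟨g, ?_⟩
  funext i
  exact (Equiv.ofFiberEquiv_map (f := fun i : Fin n => I.card - f i) (g := bI n I) (fun v => (hE v).some) i).symm

lemma perm_OP {n : ℕ} {I : Finset ℕ} (w : Equiv.Perm ℕ) (hw : SuppIn n w) (B : ℕ → Finset ℕ)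
    (hB : B ∈ OPset n I) : permOP w B ∈ OPset n I := by
  obtain ⟨h1, h2, h3, h4⟩ := hB
  refine ⟨?_, ?_, ?_, ?_⟩
  · intro h hh
    rw [permOP, h1 h hh, Finset.image_empty]
  · intro a b hab
    exact (Finset.disjoint_image w.injective).2 (h2 a b hab)
  · intro h hh
    rw [permOP, Finset.card_image_of_injective _ w.injective, h3 h hh]
  · have e : (Finset.range (I.card + 1)).biUnion (permOP w B) =
        ((Finset.range (I.card + 1)).biUnion B).image w := by
      rw [Finset.biUnion_image]; rfl
    rw [e, ← h4]
    symm
    apply Finset.eq_of_subset_of_card_le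
    · intro x hx
      obtain ⟨i, hi, rfl⟩ := Finset.mem_image.1 hx
      by_contra hc
      rw [Finset.mem_Icc] at hc
      have := w.injective (hw (w i) (by omega))
      rw [this] at hc
      exact hc (Finset.mem_Icc.1 hi)
    · rw [Finset.card_image_of_injective _ w.injective]

/-- The bijection between the orbit of the exponent vector and ordered set partitions. -/
def opE {n : ℕ} {I : Finset ℕ} (hI : I ⊆ Finset.Ioo 0 n) : {b // b ∈ Orb (bI n I)} ≃ ↥(OPset n I) :=
  Equiv.ofBijective (fun b => ⟨opB I.card b.1, opB_mem hI b.2⟩) (by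
    constructor
    · intro b b' h
      exact Subtype.ext (opB_inj (Orb_le b.2) (congrArg Subtype.val h))
    · intro B
      obtain ⟨b, hb, h⟩ := opB_surj hI B.2
      exact ⟨⟨b, hb⟩, Subtype.ext h⟩)

lemma opE_apply {n : ℕ} {I : Finset ℕ} (hI : I ⊆ Finset.Ioo 0 n) (b : {b // b ∈ Orb (bI n I)}) :
    (opE hI b).1 = opB I.card b.1 := rfl

lemma opE_perm {n : ℕ} {I : Finset ℕ} (hI : I ⊆ Finset.Ioo 0 n) (σ : Equiv.Perm (Fin n))
    (B B' : ↥(OPset n I)) (h : permOP (embedPerm n σ) B.1 = B'.1) :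
    ((opE hI).symm B').1 ∘ σ = ((opE hI).symm B).1 := by
  obtain ⟨b, rfl⟩ := (opE hI).surjective B
  obtain ⟨b', rfl⟩ := (opE hI).surjective B'
  rw [Equiv.symm_apply_apply, Equiv.symm_apply_apply]
  rw [opE_apply, opE_apply] at h
  funext i
  have hb := Orb_le b.2 i
  have h1 : (i : ℕ) + 1 ∈ opB I.card b.1 (I.card - b.1 i) := mem_opB.2 ⟨by omega, by omega⟩
  have h2 : ((σ i : Fin n) : ℕ) + 1 ∈ permOP (embedPerm n σ) (opB I.card b.1) (I.card - b.1 i) := by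
    rw [← embed_succ]; exact Finset.mem_image_of_mem _ h1
  rw [h, mem_opB] at h2
  have h3 := Orb_le b'.2 (σ i)
  simp only [Function.comp_apply]
  omega

/-- The coefficients identify `MS β` with functions on the orbit. -/
def msE {n : ℕ} (β : Fin n → ℕ) : ↥(MS β) ≃ₗ[ℚ] ({b // b ∈ Orb β} → ℚ) :=
  LinearEquiv.ofBijective (LinearMap.pi fun b => (cf b.1).comp (MS β).subtype) (by
    constructor
    · rw [← LinearMap.ker_eq_bot, LinearMap.ker_eq_bot']
      rintro ⟨p, hp⟩ h
      rw [MS, Finset.coe_image] at hp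
      obtain ⟨c, hc⟩ := span_coef _ _ hp
      apply Subtype.ext
      show p = 0
      rw [← hc]
      apply Finset.sum_eq_zero
      intro b hb
      have h1 : cf b p = 0 := congrFun h ⟨b, hb⟩
      rw [← hc, map_sum] at h1
      simp only [map_smul, cf_mon, smul_eq_mul, mul_ite, mul_one, mul_zero,
        Finset.sum_ite_eq', hb, if_true] at h1
      rw [h1, zero_smul]
    · intro g
      refine ⟨⟨∑ b : {b // b ∈ Orb β}, g b • mon b.1, Submodule.sum_mem _ fun b _ =>
        Submodule.smul_mem _ _ (Submodule.subset_span (by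
          rw [Finset.coe_image]; exact ⟨b.1, b.2, rfl⟩))⟩, ?_⟩
      funext b
      show cf b.1 (∑ b : {b // b ∈ Orb β}, g b • mon b.1) = g b
      rw [map_sum, Finset.sum_eq_single b]
      · rw [map_smul, cf_mon, if_pos rfl, smul_eq_mul, mul_one]
      · intro b' _ hb
        rw [map_smul, cf_mon, if_neg (fun h => hb (Subtype.ext h)), smul_zero]
      · intro h; exact absurd (Finset.mem_univ _) h)

lemma msE_apply {n : ℕ} (β : Fin n → ℕ) (p : ↥(MS β)) (b : {b // b ∈ Orb β}) :
    msE β p b = cf b.1 p.1 := rfl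

lemma uI_li {n k : ℕ} (hn : 1 ≤ n) (hk : 1 ≤ k) (hkn : k ≤ n) {I : Finset ℕ} (hI : I ∈ Ik n k) :
    LinearIndependent ℚ fun x : {x // x ∈ PI n I} => uI I x.1 := by
  rw [Fintype.linearIndependent_iff]
  intro g hg x
  have := mod_indep hn hk hkn (fun y => if h : y.1 = I ∧ y.2 ∈ PI n I then g ⟨y.2, h.2⟩ else 0) (by
    rw [UF, Finset.sum_sigma, Finset.sum_eq_single I]
    · rw [← Finset.sum_coe_sort]
      simp only [Subtype.coe_eta, Finset.coe_mem, and_self, dite_true]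
      refine Eq.subst (motive := fun z => z ∈ Jm n k) hg.symm (Submodule.zero_mem _)
    · intro J _ hJ
      apply Finset.sum_eq_zero
      intro q _
      rw [dif_neg (fun h => hJ h.1), zero_smul]
    · intro h; exact absurd hI h) ⟨I, x.1⟩ (Finset.mem_sigma.2 ⟨hI, x.2⟩)
  rw [dif_pos ⟨rfl, x.2⟩] at this
  exact this

lemma psi_ex {n k : ℕ} (hn : 1 ≤ n) (hk : 1 ≤ k) (hkn : k ≤ n) {I : Finset ℕ} (hI : I ∈ Ik n k) :
    ∃ ψ : ↥(UI n I) ≃ₗ[ℚ] ↥(MS (bI n I)), ∀ (c : St n × St n → ℚ) (u : ↥(UI n I)),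
      u.1 = ∑ x ∈ PI n I, c x • uI I x →
      (ψ u).1 = ∑ x ∈ PI n I, c x • ld (bI n I) x.2.1 (et x.1.1) := by
  have l1 := uI_li hn hk hkn hI
  have l2 : LinearIndependent ℚ fun x : {x // x ∈ PI n I} => ld (bI n I) x.1.2.1 (et x.1.1.1) := by
    rw [PI_eq]; exact ld_li _
  have s1 : Submodule.span ℚ (Set.range fun x : {x // x ∈ PI n I} => uI I x.1) = UI n I := by
    rw [UI]
    congr 1
    ext z
    simp
  have s2 : Submodule.span ℚ (Set.range fun x : {x // x ∈ PI n I} => ld (bI n I) x.1.2.1 (et x.1.1.1)) =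
      MS (bI n I) := by
    rw [PI_eq]; exact ld_span (bI_mono n I)
  let b1 := (Module.Basis.span l1).map (LinearEquiv.ofEq _ _ s1)
  let b2 := (Module.Basis.span l2).map (LinearEquiv.ofEq _ _ s2)
  have v1 : ∀ x, (b1 x).1 = uI I x.1 := by
    intro x
    simp only [b1, Module.Basis.map_apply, LinearEquiv.coe_ofEq_apply]
    rw [Module.Basis.span_apply l1 x]
  have v2 : ∀ x, (b2 x).1 = ld (bI n I) x.1.2.1 (et x.1.1.1) := by
    intro x
    simp only [b2, Module.Basis.map_apply, LinearEquiv.coe_ofEq_apply]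
    rw [Module.Basis.span_apply l2 x]
  refine ⟨b1.equiv b2 (Equiv.refl _), ?_⟩
  intro c u hu
  have h1 : u = ∑ x : {x // x ∈ PI n I}, c x.1 • b1 x := by
    apply Subtype.ext
    rw [hu, ← Finset.sum_coe_sort, Submodule.coe_sum]
    apply Finset.sum_congr rfl
    intro x _
    rw [Submodule.coe_smul, v1]
  rw [h1, map_sum, Submodule.coe_sum, ← Finset.sum_coe_sort (PI n I)]
  apply Finset.sum_congr rfl
  intro x _
  rw [map_smul, Module.Basis.equiv_apply, Submodule.coe_smul, Equiv.refl_apply, v2]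

lemma ld_ren {n : ℕ} (β : Fin n → ℕ) (q : Fin n → ℕ × ℕ) (σ : Equiv.Perm (Fin n)) (v : Pn n) :
    ld β q (ren σ v) = ren σ (ld β q v) := th_ren _ _ _ _

lemma psi_equiv {n k : ℕ} (hn : 1 ≤ n) (hk : 1 ≤ k) (hkn : k ≤ n) {I : Finset ℕ} (hI : I ∈ Ik n k) :
    ∃ ψ : ↥(UI n I) ≃ₗ[ℚ] ↥(MS (bI n I)), ∀ (σ : Equiv.Perm (Fin n)) (u u' : ↥(UI n I)),
      u'.1 = ren σ u.1 → (ψ u').1 = ren σ (ψ u).1 := by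
  obtain ⟨ψ, hψ⟩ := psi_ex hn hk hkn hI
  have key : ∀ (v : St n → Pn n), (∀ q ∈ QI n I, v q ∈ Specht q.1) → ∀ u : ↥(UI n I),
      u.1 = ∑ q ∈ QI n I, tq I q.1 (v q) → (ψ u).1 = ∑ q ∈ QI n I, ld (bI n I) q.1 (v q) := by
    intro v hv u hu
    have hc : ∀ q, ∃ c : St n × St n → ℚ, q ∈ QI n I → v q = colS c q := by
      intro q
      by_cases h : q ∈ QI n I
      · obtain ⟨c, hc⟩ := straighten q (hv q h)
        exact ⟨c, fun _ => hc⟩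
      · exact ⟨0, fun h1 => absurd h1 h⟩
    choose c hc using hc
    have e : ∀ L : (Fin n → ℕ × ℕ) → Pn n →ₗ[ℚ] Pn n,
        ∑ x ∈ PI n I, c x.2 x • L x.2.1 (et x.1.1) = ∑ q ∈ QI n I, L q.1 (v q) := by
      intro L
      refine (sum_PI I (fun x => c x.2 x) L).trans ?_
      apply Finset.sum_congr rfl
      intro q hq
      rw [hc q hq]
      rfl
    rw [hψ (fun x => c x.2 x) u (hu.trans (e (tq I)).symm)]
    exact e (ld (bI n I))
  refine ⟨ψ, ?_⟩
  intro σ u u' h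
  obtain ⟨v, hv, hu⟩ := UI_repr u.2
  rw [key v hv u hu, key (fun q => ren σ (v q)) (fun q hq => Specht_ren q.1 σ (hv q hq)) u' ?_, map_sum]
  · apply Finset.sum_congr rfl
    intro q _
    rw [ld_ren]
  · rw [h, hu, map_sum]
    apply Finset.sum_congr rfl
    intro q _
    rw [tq_ren]

lemma R_iso {n k : ℕ} (hn : 1 ≤ n) (hk : 1 ≤ k) (hkn : k ≤ n) {I : Finset ℕ}
    (hI : I ⊆ Finset.Ioo 0 n) (hIcard : I.card = k - 1) :
    ∃ φ : ↥(RnI n I) ≃ₗ[ℚ] (↥(OPset n I) → ℚ),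
       ∀ w : Equiv.Perm ℕ, SuppIn n w → ∀ p : ↥(RnI n I),
         ∀ hp : rename (⇑w) (p : MvPolynomial ℕ ℚ) ∈ RnI n I,
         ∀ B B' : ↥(OPset n I), permOP w B.1 = B'.1 →
           φ ⟨rename (⇑w) (p : MvPolynomial ℕ ℚ), hp⟩ B' = φ p B := by
  obtain ⟨ψ, hψ⟩ := psi_equiv hn hk hkn (Finset.mem_powersetCard.2 ⟨hI, hIcard⟩ : I ∈ Ik n k)
  let e1 : ↥(UI n I) ≃ₗ[ℚ] ↥(RnI n I) := (Submodule.equivMapOfInjective (io n).toLinearMap (io_inj n)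
    (UI n I)).trans (LinearEquiv.ofEq _ _ (RnI_eq n I).symm)
  have he1 : ∀ u, (e1 u).1 = io n u.1 := fun u => rfl
  let φ : ↥(RnI n I) ≃ₗ[ℚ] (↥(OPset n I) → ℚ) :=
    ((e1.symm.trans ψ).trans (msE (bI n I))).trans (LinearEquiv.funCongrLeft ℚ ℚ (opE hI).symm)
  have hφ : ∀ u B, φ (e1 u) B = cf ((opE hI).symm B).1 (ψ u).1 := by
    intro u B
    have : φ (e1 u) B = msE (bI n I) (ψ (e1.symm (e1 u))) ((opE hI).symm B) := rfl
    rw [this, LinearEquiv.symm_apply_apply, msE_apply]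
  refine ⟨φ, ?_⟩
  intro w hw p hp B B' hB
  obtain ⟨σ, rfl⟩ := embed_surj hw
  obtain ⟨u, rfl⟩ := e1.surjective p
  have h2 : (⟨rename (embedPerm n σ) (e1 u).1, hp⟩ : ↥(RnI n I)) = e1 ⟨ren σ u.1, UI_ren I σ u.2⟩ := by
    apply Subtype.ext
    show rename (embedPerm n σ) (io n u.1) = io n (ren σ u.1)
    exact rename_io σ u.1
  rw [h2, hφ, hφ, hψ σ u _ rfl, ren_apply, cf_rename, opE_perm hI σ B B' hB]

/-- (i) `R_{n,I}` is an `Sₙ`-subrepresentation and equals the direct sum,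
over partitions `λ ⊢ n` and standard Young tableaux `S` of shape `λ` with `Dsi^c(S) ⊆ I`,
of the spaces `V^S_{h^S_I}`; (ii) `R_{n,I}` is isomorphic, as a representation of `Sₙ`, to
the permutation representation `ℚ[OP_{n,I}]`; (iii) the sum of the `R_{n,I}` over subsets
`I ⊆ {1,…,n-1}` of size `k-1` is direct, and it lifts the quotient `R_{n,k}`. -/
theorem statement_0 (n k : ℕ) (hn : 1 ≤ n) (hk₁ : 1 ≤ k) (hk₂ : k ≤ n)
    (I : Finset ℕ) (hI : I ⊆ Finset.Ioo 0 n) (hIcard : I.card = k - 1) :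
    -- (i)
    ((∀ w : Equiv.Perm ℕ, SuppIn n w → ∀ p ∈ RnI n I, rename (⇑w) p ∈ RnI n I) ∧
     RnI n I = (⨆ q : SIdx n I, VSh n q.1.1.cells q.1.2 (hSI n I q.1.2)) ∧
     iSupIndep fun q : SIdx n I => VSh n q.1.1.cells q.1.2 (hSI n I q.1.2)) ∧
    -- (ii)
    ((∀ w : Equiv.Perm ℕ, SuppIn n w → ∀ B ∈ OPset n I, permOP w B ∈ OPset n I) ∧
     ∃ φ : ↥(RnI n I) ≃ₗ[ℚ] (↥(OPset n I) → ℚ),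
       ∀ w : Equiv.Perm ℕ, SuppIn n w → ∀ p : ↥(RnI n I),
         ∀ hp : rename (⇑w) (p : MvPolynomial ℕ ℚ) ∈ RnI n I,
         ∀ B B' : ↥(OPset n I), permOP w B.1 = B'.1 →
           φ ⟨rename (⇑w) (p : MvPolynomial ℕ ℚ), hp⟩ B' = φ p B) ∧
    -- (iii)
    (iSupIndep
        (fun J : {J : Finset ℕ // J ⊆ Finset.Ioo 0 n ∧ J.card = k - 1} => RnI n J.1) ∧
     (∀ w : Equiv.Perm ℕ, SuppIn n w → ∀ p : MvPolynomial ℕ ℚ,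
        projNK n k p = 0 → projNK n k (rename (⇑w) p) = 0) ∧
     Function.Bijective
       (fun p : ↥(⨆ J : {J : Finset ℕ // J ⊆ Finset.Ioo 0 n ∧ J.card = k - 1}, RnI n J.1)
          => projNK n k (p : MvPolynomial ℕ ℚ))) := by
  have hIk : I ∈ Ik n k := Finset.mem_powersetCard.2 ⟨hI, hIcard⟩
  exact ⟨⟨RnI_rename I, RnI_dec n I, RnI_ind hn hk₁ hk₂ hIk⟩,
    ⟨perm_OP, R_iso hn hk₁ hk₂ hI hIcard⟩,
    R_ind hn hk₁ hk₂, proj_rename, R_bij hn hk₁ hk₂⟩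

end HigherSpecht
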